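/- Let G be a finite group and k a field of characteristic p dividing |G|. The generating hypothesis holds for kG if and only if a Sylow p-subgroup of G is cyclic of order 2 or cyclic of order 3. -/

import Mathlib

open CategoryTheory

namespace StmodGH

/-- The trivial `kG`-module `k`, as a module over the group algebra. -/
noncomputable def triv (k G : Type) [Field k] [Group G] : ModuleCat (MonoidAlgebra k G) :=
  ModuleCat.of _ (Representation.trivial k (G := G) (V := k)).asModule

variable {A : Type} [Ring A]

/-- A map is zero in the stable module category iff it factors through a projective. -/
def StablyZero {M N : ModuleCat A} (f : M ⟶ N) : Prop :=
  ∃ P : ModuleCat A, Projective P ∧ ∃ (g : M ⟶ P) (h : P ⟶ N), f = g ≫ h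

/-- Two modules are isomorphic in the stable module category. -/
def StablyIso (M N : ModuleCat A) : Prop :=
  ∃ (f : M ⟶ N) (g : N ⟶ M), StablyZero (f ≫ g - 𝟙 M) ∧ StablyZero (g ≫ f - 𝟙 N)

/-- A short exact sequence `0 → X → Y → Z → 0` of modules. -/
structure SES (X Y Z : ModuleCat A) where
  i : X ⟶ Y
  p : Y ⟶ Z
  inj : Function.Injective i
  surj : Function.Surjective p
  exact : ∀ y : Y, p y = 0 ↔ ∃ x, i x = y

/-- `Ω` is a family of syzygies/cosyzygies of `M`: `Ω 0 ≃ M` stably, and each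
`Ω (i+1)` is the kernel of a surjection from a (finitely generated) projective onto `Ω i`. -/
def IsSyzygyFamily (M : ModuleCat A) (Ω : ℤ → ModuleCat A) : Prop :=
  (∀ i, Module.Finite A (Ω i)) ∧ StablyIso (Ω 0) M ∧
    ∀ i : ℤ, ∃ P : ModuleCat A, Projective P ∧ Nonempty (SES (Ω (i + 1)) P (Ω i))

/-- Indecomposability, via idempotent endomorphisms. -/
def Indecomp (M : ModuleCat A) : Prop :=
  ¬ Limits.IsZero M ∧ ∀ f : M ⟶ M, f ≫ f = f → f = 0 ∨ f = 𝟙 M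

/-- Membership in the thick subcategory of the stable module category generated by `G₀`:
the smallest class containing `G₀`, containing the (stably trivial) projective modules,
closed under stable isomorphism, under exact triangles (equivalently, two-out-of-three for
short exact sequences), and under direct summands. -/
inductive InThick (G₀ : ModuleCat A) : ModuleCat A → Prop
  | gen : InThick G₀ G₀
  | proj (P : ModuleCat A) : Projective P → InThick G₀ P
  | iso {M N : ModuleCat A} : StablyIso M N → InThick G₀ M → InThick G₀ N
  | ext₁ {X Y Z : ModuleCat A} : SES X Y Z → InThick G₀ X → InThick G₀ Y → InThick G₀ Z
  | ext₂ {X Y Z : ModuleCat A} : SES X Y Z → InThick G₀ X → InThick G₀ Z → InThick G₀ Y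
  | ext₃ {X Y Z : ModuleCat A} : SES X Y Z → InThick G₀ Y → InThick G₀ Z → InThick G₀ X
  | summand {M N : ModuleCat A} : (∃ (s : M ⟶ N) (r : N ⟶ M), s ≫ r = 𝟙 M) →
      InThick G₀ N → InThick G₀ M

/-- A short exact sequence `0 → X → B → N → 0` is almost split: it is non-split, has
indecomposable end terms, and every map to `N` that is not a split epimorphism factors
through the middle term `B`. -/
def IsAlmostSplit {X B N : ModuleCat A} (s : SES X B N) : Prop :=
  Indecomp X ∧ Indecomp N ∧ (¬ ∃ sec : N ⟶ B, sec ≫ s.p = 𝟙 N) ∧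
    ∀ (M : ModuleCat A) (f : M ⟶ N),
      (¬ ∃ sec : N ⟶ M, sec ≫ f = 𝟙 N) → ∃ g : M ⟶ B, g ≫ s.p = f

/-- The generating hypothesis for `kG`: every map in the thick subcategory generated by the
trivial module which induces the zero map on Tate cohomology
`Ĥ^i(G,−) = Hom_stmod(Ω^i k, −)` is zero in the stable module category. -/
def GHolds (k G : Type) [Field k] [Group G] [Fintype G] : Prop :=
  ∀ Ωk : ℤ → ModuleCat (MonoidAlgebra k G), IsSyzygyFamily (triv k G) Ωk →
    ∀ M N : ModuleCat (MonoidAlgebra k G), InThick (triv k G) M → InThick (triv k G) N →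
      ∀ f : M ⟶ N, (∀ (i : ℤ) (g : Ωk i ⟶ M), StablyZero (g ≫ f)) → StablyZero f

section RelativeTrace

set_option linter.unusedSectionVars false

variable {k : Type} [Field k]

/-- A `k`-linear map commuting with the action of `Γ`. -/
def Eqv (Γ : Type) [Group Γ] {X Y : Type} [AddCommGroup X] [Module k X] [DistribMulAction Γ X]
    [AddCommGroup Y] [Module k Y] [DistribMulAction Γ Y] (f : X →ₗ[k] Y) : Prop :=
  ∀ (s : Γ) (x : X), f (s • x) = s • f x

/-- The sum of the conjugates of a `k`-linear map under a finite group. -/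
noncomputable def tr (Γ : Type) [Group Γ] [Finite Γ] {X Y : Type}
    [AddCommGroup X] [Module k X] [DistribMulAction Γ X] [SMulCommClass Γ k X]
    [AddCommGroup Y] [Module k Y] [DistribMulAction Γ Y] [SMulCommClass Γ k Y] :
    (X →ₗ[k] Y) →ₗ[k] (X →ₗ[k] Y) :=
  letI := Fintype.ofFinite Γ
  ∑ s : Γ, (LinearMap.lcomp k Y (DistribSMul.toLinearMap k X s⁻¹)) ∘ₗ
    (LinearMap.llcomp k X Y Y (DistribSMul.toLinearMap k Y s))

/-- A map is relatively trivial if it is a trace from the trivial subgroup. -/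
def Rel (Γ : Type) [Group Γ] [Finite Γ] {X Y : Type}
    [AddCommGroup X] [Module k X] [DistribMulAction Γ X] [SMulCommClass Γ k X]
    [AddCommGroup Y] [Module k Y] [DistribMulAction Γ Y] [SMulCommClass Γ k Y]
    (f : X →ₗ[k] Y) : Prop :=
  ∃ φ : X →ₗ[k] Y, tr Γ φ = f

variable {Γ : Type} [Group Γ]
variable {X Y Z W : Type}
  [AddCommGroup X] [Module k X] [DistribMulAction Γ X]
  [AddCommGroup Y] [Module k Y] [DistribMulAction Γ Y]
  [AddCommGroup Z] [Module k Z] [DistribMulAction Γ Z]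
  [AddCommGroup W] [Module k W] [DistribMulAction Γ W]

theorem Eqv.comp {g : Y →ₗ[k] Z} {f : X →ₗ[k] Y} (hg : Eqv Γ g) (hf : Eqv Γ f) :
    Eqv Γ (g ∘ₗ f) := fun s x => by simp [hf s, hg s]

theorem Eqv.id : Eqv Γ (LinearMap.id : X →ₗ[k] X) := fun _ _ => rfl

theorem Eqv.add {f g : X →ₗ[k] Y} (hf : Eqv Γ f) (hg : Eqv Γ g) : Eqv Γ (f + g) :=
  fun s x => by simp [hf s, hg s]

theorem Eqv.sub {f g : X →ₗ[k] Y} (hf : Eqv Γ f) (hg : Eqv Γ g) : Eqv Γ (f - g) :=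
  fun s x => by simp [hf s, hg s, smul_sub]

theorem Eqv.smul [SMulCommClass Γ k Y] {f : X →ₗ[k] Y} (hf : Eqv Γ f) (c : k) : Eqv Γ (c • f) :=
  fun s x => by simp [hf s, smul_comm]

theorem Eqv.subgroup (H : Subgroup Γ) {f : X →ₗ[k] Y} (hf : Eqv Γ f) : Eqv H f :=
  fun s x => hf s x

theorem Eqv.pow {f : X →ₗ[k] X} (hf : Eqv Γ f) (n : ℕ) : Eqv Γ (f ^ n) := by
  induction n with
  | zero => exact Eqv.id
  | succ n ih => rw [pow_succ]; exact ih.comp hf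

/-- A short exact sequence of representations of `Γ` on `k`-vector spaces. -/
structure ShortEx (Γ : Type) [Group Γ] {X Y Z : Type}
    [AddCommGroup X] [Module k X] [DistribMulAction Γ X]
    [AddCommGroup Y] [Module k Y] [DistribMulAction Γ Y]
    [AddCommGroup Z] [Module k Z] [DistribMulAction Γ Z]
    (i : X →ₗ[k] Y) (p : Y →ₗ[k] Z) : Prop where
  eqv_i : Eqv Γ i
  eqv_p : Eqv Γ p
  inj : Function.Injective i
  surj : Function.Surjective p
  exact : ∀ y : Y, p y = 0 ↔ ∃ x, i x = y

namespace ShortEx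

variable {i : X →ₗ[k] Y} {p : Y →ₗ[k] Z}

theorem subgroup (h : ShortEx Γ i p) (H : Subgroup Γ) : ShortEx H i p :=
  ⟨h.eqv_i.subgroup H, h.eqv_p.subgroup H, h.inj, h.surj, h.exact⟩

theorem p_i (h : ShortEx Γ i p) (x : X) : p (i x) = 0 := (h.exact _).2 ⟨x, rfl⟩

theorem exists_section (h : ShortEx Γ i p) : ∃ σ : Z →ₗ[k] Y, p ∘ₗ σ = LinearMap.id :=
  p.exists_rightInverse_of_surjective (LinearMap.range_eq_top.2 h.surj)

theorem exists_retraction (h : ShortEx Γ i p) : ∃ ρ : Y →ₗ[k] X, ρ ∘ₗ i = LinearMap.id :=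
  i.exists_leftInverse_of_injective (LinearMap.ker_eq_bot.2 h.inj)

theorem exists_factor_ker (h : ShortEx Γ i p) (f : W →ₗ[k] Y) (hf : p ∘ₗ f = 0) :
    ∃ g : W →ₗ[k] X, i ∘ₗ g = f ∧ (Eqv Γ f → Eqv Γ g) := by
  obtain ⟨ρ, hρ⟩ := h.exists_retraction
  have key : ∀ w, i (ρ (f w)) = f w := fun w => by
    obtain ⟨x, hx⟩ := (h.exact (f w)).1 (LinearMap.congr_fun hf w)
    have : ρ (i x) = x := LinearMap.congr_fun hρ x
    rw [← hx, this]
  refine ⟨ρ ∘ₗ f, LinearMap.ext key, fun he s w => h.inj ?_⟩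
  rw [h.eqv_i]
  simp only [LinearMap.comp_apply, key]
  exact he s w

theorem exists_factor_coker (h : ShortEx Γ i p) (f : Y →ₗ[k] W) (hf : f ∘ₗ i = 0) :
    ∃ g : Z →ₗ[k] W, g ∘ₗ p = f ∧ (Eqv Γ f → Eqv Γ g) := by
  obtain ⟨σ, hσ⟩ := h.exists_section
  have key : ∀ y, f (σ (p y)) = f y := fun y => by
    have h0 : p (σ (p y) - y) = 0 := by
      have : p (σ (p y)) = p y := LinearMap.congr_fun hσ (p y)
      rw [map_sub, this, sub_self]
    obtain ⟨x, hx⟩ := (h.exact _).1 h0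
    have : f (i x) = 0 := LinearMap.congr_fun hf x
    rw [hx, map_sub] at this
    exact sub_eq_zero.1 this
  refine ⟨f ∘ₗ σ, LinearMap.ext key, fun he s z => ?_⟩
  obtain ⟨y, rfl⟩ := h.surj z
  rw [← h.eqv_p]
  simp only [LinearMap.comp_apply, key, he s y]

theorem finrank_eq [FiniteDimensional k Y] (h : ShortEx Γ i p) :
    Module.finrank k Y = Module.finrank k X + Module.finrank k Z := by
  rw [← LinearMap.finrank_range_add_finrank_ker p, LinearMap.range_eq_top.2 h.surj,
    finrank_top, add_comm, ← LinearMap.finrank_range_of_inj h.inj]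
  have : p.ker = i.range := Submodule.ext fun y => by simp [h.exact]
  rw [this]

end ShortEx

variable [SMulCommClass Γ k X] [SMulCommClass Γ k Y] [SMulCommClass Γ k Z] [SMulCommClass Γ k W]

theorem tr_apply [Fintype Γ] (φ : X →ₗ[k] Y) (x : X) :
    tr Γ φ x = ∑ s : Γ, s • φ (s⁻¹ • x) := by
  rw [tr, LinearMap.sum_apply, LinearMap.sum_apply]
  convert! rfl

variable [Finite Γ]

theorem tr_eqv (φ : X →ₗ[k] Y) : Eqv Γ (tr Γ φ) := fun s x => by
  let := Fintype.ofFinite Γ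
  rw [tr_apply, tr_apply, Finset.smul_sum, ← Equiv.sum_comp (Equiv.mulLeft s)]
  refine Finset.sum_congr rfl fun t _ => ?_
  simp [smul_smul]

theorem comp_tr {g : Y →ₗ[k] Z} (hg : Eqv Γ g) (φ : X →ₗ[k] Y) :
    g ∘ₗ tr Γ φ = tr Γ (g ∘ₗ φ) := by
  let := Fintype.ofFinite Γ
  ext x
  simp [tr_apply, hg _ _]

theorem tr_comp {f : X →ₗ[k] Y} (hf : Eqv Γ f) (φ : Y →ₗ[k] Z) :
    tr Γ φ ∘ₗ f = tr Γ (φ ∘ₗ f) := by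
  let := Fintype.ofFinite Γ
  ext x
  simp [tr_apply, hf _ _]

theorem tr_of_eqv {f : X →ₗ[k] Y} (hf : Eqv Γ f) : tr Γ f = (Nat.card Γ : k) • f := by
  let := Fintype.ofFinite Γ
  ext x
  simp [tr_apply, hf _ _, Nat.cast_smul_eq_nsmul]

namespace Rel

theorem eqv {f : X →ₗ[k] Y} (h : Rel Γ f) : Eqv Γ f := by
  obtain ⟨φ, rfl⟩ := h; exact tr_eqv φ

theorem zero : Rel Γ (0 : X →ₗ[k] Y) := ⟨0, map_zero _⟩

theorem add {f g : X →ₗ[k] Y} (hf : Rel Γ f) (hg : Rel Γ g) : Rel Γ (f + g) := by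
  obtain ⟨φ, rfl⟩ := hf; obtain ⟨ψ, rfl⟩ := hg; exact ⟨φ + ψ, map_add _ _ _⟩

theorem sub {f g : X →ₗ[k] Y} (hf : Rel Γ f) (hg : Rel Γ g) : Rel Γ (f - g) := by
  obtain ⟨φ, rfl⟩ := hf; obtain ⟨ψ, rfl⟩ := hg; exact ⟨φ - ψ, map_sub _ _ _⟩

theorem smul {f : X →ₗ[k] Y} (hf : Rel Γ f) (c : k) : Rel Γ (c • f) := by
  obtain ⟨φ, rfl⟩ := hf; exact ⟨c • φ, map_smul _ _ _⟩

theorem comp_left {g : Y →ₗ[k] Z} {f : X →ₗ[k] Y} (hf : Rel Γ f) (hg : Eqv Γ g) :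
    Rel Γ (g ∘ₗ f) := by
  obtain ⟨φ, rfl⟩ := hf; exact ⟨_, (comp_tr hg φ).symm⟩

theorem comp_right {g : Y →ₗ[k] Z} {f : X →ₗ[k] Y} (hg : Rel Γ g) (hf : Eqv Γ f) :
    Rel Γ (g ∘ₗ f) := by
  obtain ⟨φ, rfl⟩ := hg; exact ⟨_, (tr_comp hf φ).symm⟩

theorem of_source {f : X →ₗ[k] Y} (hX : Rel Γ (LinearMap.id : X →ₗ[k] X)) (hf : Eqv Γ f) :
    Rel Γ f := by simpa using hX.comp_left hf

theorem of_target {f : X →ₗ[k] Y} (hY : Rel Γ (LinearMap.id : Y →ₗ[k] Y)) (hf : Eqv Γ f) :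
    Rel Γ f := by simpa using hY.comp_right hf

end Rel

namespace ShortEx

variable {i : X →ₗ[k] Y} {p : Y →ₗ[k] Z}

theorem exists_lift (h : ShortEx Γ i p) (hW : Rel Γ (LinearMap.id : W →ₗ[k] W))
    {f : W →ₗ[k] Z} (hf : Eqv Γ f) : ∃ g : W →ₗ[k] Y, Eqv Γ g ∧ p ∘ₗ g = f := by
  obtain ⟨σ, hσ⟩ := h.exists_section
  obtain ⟨Φ, hΦ⟩ := hW
  refine ⟨tr Γ (σ ∘ₗ f ∘ₗ Φ), tr_eqv _, ?_⟩
  rw [comp_tr h.eqv_p, ← LinearMap.comp_assoc, hσ, LinearMap.id_comp, ← comp_tr hf, hΦ,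
    LinearMap.comp_id]

theorem exists_extension (h : ShortEx Γ i p) (hW : Rel Γ (LinearMap.id : W →ₗ[k] W))
    {f : X →ₗ[k] W} (hf : Eqv Γ f) : ∃ g : Y →ₗ[k] W, Eqv Γ g ∧ g ∘ₗ i = f := by
  obtain ⟨ρ, hρ⟩ := h.exists_retraction
  obtain ⟨Φ, hΦ⟩ := hW
  refine ⟨tr Γ (Φ ∘ₗ f ∘ₗ ρ), tr_eqv _, ?_⟩
  rw [tr_comp h.eqv_i, LinearMap.comp_assoc, LinearMap.comp_assoc, hρ, LinearMap.comp_id,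
    ← tr_comp hf, hΦ, LinearMap.id_comp]

theorem exists_rel_lift (h : ShortEx Γ i p) {f : W →ₗ[k] Z} (hf : Rel Γ f) :
    ∃ g : W →ₗ[k] Y, Rel Γ g ∧ p ∘ₗ g = f := by
  obtain ⟨σ, hσ⟩ := h.exists_section
  obtain ⟨φ, rfl⟩ := hf
  refine ⟨tr Γ (σ ∘ₗ φ), ⟨_, rfl⟩, ?_⟩
  rw [comp_tr h.eqv_p, ← LinearMap.comp_assoc, hσ, LinearMap.id_comp]

theorem exists_rel_extension (h : ShortEx Γ i p) {f : X →ₗ[k] W} (hf : Rel Γ f) :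
    ∃ g : Y →ₗ[k] W, Rel Γ g ∧ g ∘ₗ i = f := by
  obtain ⟨ρ, hρ⟩ := h.exists_retraction
  obtain ⟨φ, rfl⟩ := hf
  refine ⟨tr Γ (φ ∘ₗ ρ), ⟨_, rfl⟩, ?_⟩
  rw [tr_comp h.eqv_i, LinearMap.comp_assoc, hρ, LinearMap.comp_id]

variable {X' Y' Z' : Type}
  [AddCommGroup X'] [Module k X'] [DistribMulAction Γ X'] [SMulCommClass Γ k X']
  [AddCommGroup Y'] [Module k Y'] [DistribMulAction Γ Y'] [SMulCommClass Γ k Y']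
  [AddCommGroup Z'] [Module k Z'] [DistribMulAction Γ Z'] [SMulCommClass Γ k Z']
  {i' : X' →ₗ[k] Y'} {p' : Y' →ₗ[k] Z'}
  {a : X →ₗ[k] X'} {b : Y →ₗ[k] Y'} {c : Z →ₗ[k] Z'}

theorem rel_left (h : ShortEx Γ i p) (h' : ShortEx Γ i' p')
    (hY : Rel Γ (LinearMap.id : Y →ₗ[k] Y)) (hb : Eqv Γ b)
    (hab : i' ∘ₗ a = b ∘ₗ i) (hbc : p' ∘ₗ b = c ∘ₗ p) (hc : Rel Γ c) : Rel Γ a := by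
  obtain ⟨c', hc', hpc⟩ := h'.exists_rel_lift hc
  obtain ⟨d, hd, hde⟩ := h'.exists_factor_ker (b - c' ∘ₗ p)
    (by rw [LinearMap.comp_sub, ← LinearMap.comp_assoc, hpc, hbc, sub_self])
  have hdr : Rel Γ d := .of_source hY (hde (hb.sub (hc'.eqv.comp h.eqv_p)))
  have : a = d ∘ₗ i := by
    ext x
    apply h'.inj
    have h1 := LinearMap.congr_fun hd (i x)
    have h2 := LinearMap.congr_fun hab x
    simp only [LinearMap.comp_apply, LinearMap.sub_apply, h.p_i, map_zero, sub_zero] at h1 h2 ⊢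
    rw [h1, h2]
  rw [this]
  exact hdr.comp_right h.eqv_i

theorem rel_right (h : ShortEx Γ i p) (h' : ShortEx Γ i' p')
    (hY' : Rel Γ (LinearMap.id : Y' →ₗ[k] Y')) (hb : Eqv Γ b)
    (hab : i' ∘ₗ a = b ∘ₗ i) (hbc : p' ∘ₗ b = c ∘ₗ p) (ha : Rel Γ a) : Rel Γ c := by
  obtain ⟨a', ha', hai⟩ := h.exists_rel_extension ha
  obtain ⟨e, he, hee⟩ := h.exists_factor_coker (b - i' ∘ₗ a')
    (by rw [LinearMap.sub_comp, LinearMap.comp_assoc, hai, hab, sub_self])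
  have her : Rel Γ e := .of_target hY' (hee (hb.sub (h'.eqv_i.comp ha'.eqv)))
  have : c = p' ∘ₗ e := by
    ext z
    obtain ⟨y, rfl⟩ := h.surj z
    have h1 := LinearMap.congr_fun he y
    have h2 := LinearMap.congr_fun hbc y
    simp only [LinearMap.comp_apply, LinearMap.sub_apply] at h1 h2 ⊢
    rw [h1, ← h2, map_sub, h'.p_i, sub_zero]
  rw [this]
  exact her.comp_left h'.eqv_p

end ShortEx

/-- `G` is the product of a set of coset representatives and a subgroup. -/
noncomputable def cosetEquiv (H : Subgroup Γ) : (Γ ⧸ H) × H ≃ Γ :=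
  Equiv.ofBijective (fun x => x.1.out * x.2) <| by
    constructor
    · rintro ⟨q, h⟩ ⟨q', h'⟩ e
      have e' : q.out * (h : Γ) = q'.out * (h' : Γ) := e
      have hq : q = q' := by
        have := congrArg (QuotientGroup.mk : Γ → Γ ⧸ H) e'
        simpa using this
      subst hq
      simpa using e'
    · intro g
      obtain ⟨h, hh⟩ := QuotientGroup.mk_out_eq_mul H g
      exact ⟨⟨g, h⁻¹⟩, by simp [hh]⟩

omit [Finite Γ] in
theorem cosetEquiv_apply (H : Subgroup Γ) (q : Γ ⧸ H) (h : H) :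
    cosetEquiv H (q, h) = q.out * h := rfl

theorem tr_eq_tr_subgroup (H : Subgroup Γ) (φ : X →ₗ[k] Y) :
    letI := Fintype.ofFinite (Γ ⧸ H)
    tr Γ φ = tr H (∑ q : Γ ⧸ H, DistribSMul.toLinearMap k Y q.out⁻¹ ∘ₗ φ ∘ₗ
      DistribSMul.toLinearMap k X q.out) := by
  let := Fintype.ofFinite (Γ ⧸ H)
  let := Fintype.ofFinite H
  let := Fintype.ofFinite Γ
  ext x
  rw [tr_apply, tr_apply, ← Equiv.sum_comp (Equiv.inv Γ), ← (cosetEquiv H).sum_comp,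
    Fintype.sum_prod_type, Finset.sum_comm, ← Equiv.sum_comp (Equiv.inv H)]
  refine Finset.sum_congr rfl fun h _ => ?_
  simp only [LinearMap.sum_apply, Finset.smul_sum]
  refine Finset.sum_congr rfl fun q _ => ?_
  simp [cosetEquiv_apply, mul_smul, Subgroup.smul_def]

theorem tr_of_tr_subgroup (H : Subgroup Γ) (φ : X →ₗ[k] Y) (h : Eqv Γ (tr H φ)) :
    tr Γ φ = (H.index : k) • tr H φ := by
  let := Fintype.ofFinite (Γ ⧸ H)
  let := Fintype.ofFinite H
  let := Fintype.ofFinite Γ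
  ext x
  rw [tr_apply, ← (cosetEquiv H).sum_comp, Fintype.sum_prod_type]
  have : ∀ q : Γ ⧸ H, (∑ y : H, cosetEquiv H (q, y) • φ ((cosetEquiv H (q, y))⁻¹ • x)) =
      tr H φ x := fun q => by
    have h1 := h q.out (q.out⁻¹ • x)
    rw [smul_inv_smul] at h1
    rw [h1, tr_apply, Finset.smul_sum]
    refine Finset.sum_congr rfl fun h _ => ?_
    simp [cosetEquiv_apply, mul_smul, Subgroup.smul_def]
  simp [this, Nat.cast_smul_eq_nsmul, Subgroup.index_eq_card]

theorem Rel.subgroup (H : Subgroup Γ) {f : X →ₗ[k] Y} (hf : Rel Γ f) : Rel H f := by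
  obtain ⟨φ, rfl⟩ := hf; exact ⟨_, (tr_eq_tr_subgroup H φ).symm⟩

theorem Rel.of_subgroup (H : Subgroup Γ) (hH : (H.index : k) ≠ 0) {f : X →ₗ[k] Y}
    (he : Eqv Γ f) (hf : Rel H f) : Rel Γ f := by
  obtain ⟨φ, rfl⟩ := hf
  exact ⟨(H.index : k)⁻¹ • φ, by rw [map_smul, tr_of_tr_subgroup H φ he, inv_smul_smul₀ hH]⟩

end RelativeTrace

section GroupAlgebra

open scoped ModuleCat

variable {k G : Type} [Field k] [Group G]

/-- The action of `G` on a `kG`-module. -/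
noncomputable instance groupAction (M : ModuleCat.{0} (MonoidAlgebra k G)) : DistribMulAction G M :=
  DistribMulAction.compHom M (MonoidAlgebra.of k G)

theorem group_smul_def (M : ModuleCat.{0} (MonoidAlgebra k G)) (g : G) (m : M) :
    g • m = (MonoidAlgebra.of k G g : MonoidAlgebra k G) • m := rfl

theorem smul_eq_algebraMap_smul (M : ModuleCat.{0} (MonoidAlgebra k G)) (c : k) (m : M) :
    c • m = algebraMap k (MonoidAlgebra k G) c • m := rfl

instance groupAction_smulComm (M : ModuleCat.{0} (MonoidAlgebra k G)) : SMulCommClass G k M where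
  smul_comm g c m := by
    rw [group_smul_def, group_smul_def, smul_eq_algebraMap_smul, smul_eq_algebraMap_smul,
      smul_smul, smul_smul, Algebra.commutes]

theorem single_smul_eq (M : ModuleCat.{0} (MonoidAlgebra k G)) (g : G) (c : k) (m : M) :
    (MonoidAlgebra.single g c : MonoidAlgebra k G) • m = c • g • m := by
  rw [group_smul_def, smul_eq_algebraMap_smul, smul_smul]
  congr 1
  simp

variable {M N L : ModuleCat.{0} (MonoidAlgebra k G)}

/-- The `k`-linear map underlying a map of `kG`-modules. -/
noncomputable def toLin (f : M ⟶ N) : M →ₗ[k] N := f.hom.restrictScalars k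

@[simp] theorem toLin_apply (f : M ⟶ N) (x : M) : toLin f x = f x := rfl

theorem toLin_eqv (f : M ⟶ N) : Eqv G (toLin f) := fun _ x => f.hom.map_smul _ x

@[simp] theorem toLin_comp (f : M ⟶ N) (g : N ⟶ L) : toLin (f ≫ g) = toLin g ∘ₗ toLin f := rfl

theorem toLin_injective : Function.Injective (toLin : (M ⟶ N) → _) := fun f g h => by
  ext x
  exact LinearMap.congr_fun h x

theorem map_smul_of_eqv {f : M →ₗ[k] N} (hf : Eqv G f) (a : MonoidAlgebra k G) (x : M) :
    f (a • x) = a • f x := by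
  induction a using MonoidAlgebra.induction_linear with
  | zero => simp
  | add a b ha hb => simp [add_smul, ha, hb]
  | single g c => rw [single_smul_eq, single_smul_eq, map_smul, hf]

/-- An equivariant `k`-linear map is a map of `kG`-modules. -/
noncomputable def homOfEqv (f : M →ₗ[k] N) (hf : Eqv G f) : M ⟶ N :=
  ModuleCat.ofHom { toFun := f, map_add' := f.map_add, map_smul' := map_smul_of_eqv hf }

@[simp] theorem toLin_homOfEqv (f : M →ₗ[k] N) (hf : Eqv G f) : toLin (homOfEqv f hf) = f := rfl

theorem SES.shortEx {M N L : ModuleCat.{0} (MonoidAlgebra k G)} (s : SES M N L) :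
    ShortEx G (toLin s.i) (toLin s.p) :=
  ⟨toLin_eqv _, toLin_eqv _, s.inj, s.surj, s.exact⟩

/-- A short exact sequence of representations is one of modules. -/
noncomputable def ShortEx.ses {i : M →ₗ[k] N} {p : N →ₗ[k] L} (h : ShortEx G i p) : SES M N L :=
  ⟨homOfEqv i h.eqv_i, homOfEqv p h.eqv_p, h.inj, h.surj, h.exact⟩

variable [Finite G]

theorem rel_id_of_projective (h : Projective M) : Rel G (LinearMap.id : M →ₗ[k] M) := by
  let := Fintype.ofFinite G
  have h' : Module.Projective (MonoidAlgebra k G) M := (IsProjective.iff_projective M).2 h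
  obtain ⟨s, hs⟩ := Module.projective_def'.1 h'
  let c1 : MonoidAlgebra k G →ₗ[k] k :=
    { toFun := fun a => a.coeff 1, map_add' := fun _ _ => rfl, map_smul' := fun _ _ => rfl }
  let ev : (M →₀ MonoidAlgebra k G) →ₗ[k] M :=
    Finsupp.linearCombination k id ∘ₗ Finsupp.mapRange.linearMap c1
  have key : ∀ y : M →₀ MonoidAlgebra k G,
      ∑ g : G, g • ev ((MonoidAlgebra.of k G g⁻¹ : MonoidAlgebra k G) • y) =
        Finsupp.linearCombination (MonoidAlgebra k G) id y := fun y => by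
    induction y using Finsupp.induction_linear with
    | zero => simp
    | add a b ha hb => simp only [smul_add, map_add, Finset.sum_add_distrib, ha, hb]
    | single m a =>
      have h0 : ∀ a : MonoidAlgebra k G, ev (Finsupp.single m a) = a.coeff 1 • m := fun a => by
        simp only [ev, LinearMap.comp_apply, Finsupp.mapRange.linearMap_apply,
          Finsupp.mapRange_single, Finsupp.linearCombination_single]
        rfl
      induction a using MonoidAlgebra.induction_linear with
      | zero => simp
      | add a b ha hb =>
        simp only [Finsupp.single_add, smul_add, map_add, Finset.sum_add_distrib, ha, hb]
      | single t c =>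
        classical
        have h1 : ∀ g : G, ev ((MonoidAlgebra.of k G g⁻¹ : MonoidAlgebra k G) •
            Finsupp.single m (MonoidAlgebra.single t c)) = if g = t then c • m else 0 := fun g => by
          rw [Finsupp.smul_single, smul_eq_mul, h0, MonoidAlgebra.of_apply,
            MonoidAlgebra.single_mul_single]
          by_cases hg : g = t
          · simp [hg]
          · have : g⁻¹ * t ≠ 1 := fun e => hg (inv_mul_eq_one.1 e)
            simp [hg, this]
        simp only [h1]
        simp [single_smul_eq, smul_comm t c m, smul_ite]
  refine ⟨ev ∘ₗ (s.restrictScalars k : M →ₗ[k] _), ?_⟩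
  ext x
  rw [tr_apply]
  have h2 := key (s x)
  rw [show Finsupp.linearCombination (MonoidAlgebra k G) id (s x) = x from
    LinearMap.congr_fun hs x] at h2
  refine Eq.trans (Finset.sum_congr rfl fun g _ => ?_) h2
  rw [← s.map_smul]
  rfl

omit [Finite G] in
theorem exists_projective_cover (N : ModuleCat.{0} (MonoidAlgebra k G)) :
    ∃ (F : ModuleCat.{0} (MonoidAlgebra k G)) (π : F ⟶ N), Projective F ∧
      Function.Surjective π :=
  ⟨ModuleCat.of _ (N →₀ MonoidAlgebra k G),
    ModuleCat.ofHom (Finsupp.linearCombination (MonoidAlgebra k G) id),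
    (IsProjective.iff_projective _).1 inferInstance,
    Finsupp.linearCombination_id_surjective (MonoidAlgebra k G) N⟩

omit [Finite G] in
theorem exists_finite_projective_cover (N : ModuleCat.{0} (MonoidAlgebra k G))
    [Module.Finite (MonoidAlgebra k G) N] :
    ∃ (F : ModuleCat.{0} (MonoidAlgebra k G)) (π : F ⟶ N), Projective F ∧
      Function.Surjective π ∧ Module.Finite (MonoidAlgebra k G) F := by
  obtain ⟨n, f, hf⟩ := Module.Finite.exists_fin' (MonoidAlgebra k G) N
  exact ⟨ModuleCat.of _ (Fin n → MonoidAlgebra k G), ModuleCat.ofHom f,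
    (IsProjective.iff_projective _).1 inferInstance, hf,
    inferInstanceAs (Module.Finite (MonoidAlgebra k G) (Fin n → MonoidAlgebra k G))⟩

omit [Finite G] in
theorem exists_kernel_ses {F N : ModuleCat.{0} (MonoidAlgebra k G)} (π : F ⟶ N)
    (hπ : Function.Surjective π) :
    ∃ (K : ModuleCat.{0} (MonoidAlgebra k G)) (s : SES K F N), s.p = π :=
  ⟨ModuleCat.of _ (LinearMap.ker π.hom), ⟨ModuleCat.ofHom (LinearMap.ker π.hom).subtype, π,
    Subtype.val_injective, hπ, fun y => ⟨fun h => ⟨⟨y, h⟩, rfl⟩, fun ⟨x, hx⟩ => hx ▸ x.2⟩⟩, rfl⟩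

omit [Finite G] in
theorem exists_cokernel_ses {N F : ModuleCat.{0} (MonoidAlgebra k G)} (i : N ⟶ F)
    (hi : Function.Injective i) :
    ∃ (C : ModuleCat.{0} (MonoidAlgebra k G)) (s : SES N F C), s.i = i :=
  ⟨ModuleCat.of _ (F ⧸ LinearMap.range i.hom), ⟨i,
    ModuleCat.ofHom (LinearMap.range i.hom).mkQ, hi, Submodule.mkQ_surjective _,
    fun _ => (Submodule.Quotient.mk_eq_zero (LinearMap.range i.hom)).trans
      LinearMap.mem_range⟩, rfl⟩

theorem stablyZero_iff_rel (f : M ⟶ N) : StablyZero f ↔ Rel G (toLin f) := by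
  constructor
  · rintro ⟨P, hP, g, h, rfl⟩
    exact (Rel.of_target (rel_id_of_projective hP) (toLin_eqv g)).comp_left (toLin_eqv h)
  · rintro ⟨φ, hφ⟩
    obtain ⟨F, π, hF, hπ⟩ := exists_projective_cover N
    obtain ⟨σ, hσ⟩ := (toLin π).exists_rightInverse_of_surjective (LinearMap.range_eq_top.2 hπ)
    refine ⟨F, hF, homOfEqv (tr G (σ ∘ₗ φ)) (tr_eqv _), π, toLin_injective ?_⟩
    rw [toLin_comp, toLin_homOfEqv, comp_tr (toLin_eqv π), ← LinearMap.comp_assoc, hσ,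
      LinearMap.id_comp, hφ]

theorem projective_iff_rel_id : Projective M ↔ Rel G (LinearMap.id : M →ₗ[k] M) := by
  refine ⟨rel_id_of_projective, fun h => ?_⟩
  obtain ⟨P, hP, g, h, e⟩ := (stablyZero_iff_rel (𝟙 M)).2 h
  refine ⟨fun {E X} f e' he' => ?_⟩
  refine ⟨g ≫ Projective.factorThru (h ≫ f) e', ?_⟩
  rw [Category.assoc, Projective.factorThru_comp, ← Category.assoc, ← e, Category.id_comp]

theorem finiteDimensional_of_finite [Module.Finite (MonoidAlgebra k G) M] :
    FiniteDimensional k M :=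
  have : Module.Finite k (MonoidAlgebra k G) := by
    let e : MonoidAlgebra k G ≃ₗ[k] (G →₀ k) := MonoidAlgebra.coeffLinearEquiv k
    exact Module.Finite.equiv e.symm
  Module.Finite.trans (MonoidAlgebra k G) M

omit [Finite G] in
theorem finite_of_finiteDimensional [FiniteDimensional k M] :
    Module.Finite (MonoidAlgebra k G) M :=
  Module.Finite.of_restrictScalars_finite k (MonoidAlgebra k G) M

/-- The `kG`-module attached to a representation. -/
noncomputable def modOf (k G W : Type) [Field k] [Group G] [AddCommGroup W] [Module k W]
    [DistribMulAction G W] [SMulCommClass G k W] : ModuleCat.{0} (MonoidAlgebra k G) :=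
  ModuleCat.of _ (Representation.ofDistribMulAction k G W).asModule

/-- The representation underlying `modOf` is the one it came from. -/
theorem exists_modOf_equiv (k G W : Type) [Field k] [Group G] [AddCommGroup W] [Module k W]
    [DistribMulAction G W] [SMulCommClass G k W] :
    ∃ e : modOf k G W ≃ₗ[k] W, Eqv G e.toLinearMap := by
  let ρ := Representation.ofDistribMulAction k G W
  have hs : ∀ (a : MonoidAlgebra k G) (x : modOf k G W), ρ.asModuleEquiv (a • x) =
      ρ.asAlgebraHom a (ρ.asModuleEquiv x) := fun a x => ρ.asModuleEquiv_map_smul a x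
  refine ⟨{ ρ.asModuleEquiv with
    map_smul' := fun c x => ?_ }, fun s x => ?_⟩
  · refine (hs (algebraMap _ _ c) x).trans ?_
    rw [AlgHom.commutes]
    rfl
  · refine (hs (MonoidAlgebra.of k G s) x).trans ?_
    rw [Representation.asAlgebraHom_of]
    rfl

omit [Finite G] in
theorem exists_triv_equiv :
    Nonempty (triv k G ≃ₗ[k] k) ∧ ∀ (s : G) (x : triv k G), s • x = x := by
  let ρ := Representation.trivial k (G := G) (V := k)
  have hs : ∀ (a : MonoidAlgebra k G) (x : triv k G), ρ.asModuleEquiv (a • x) =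
      ρ.asAlgebraHom a (ρ.asModuleEquiv x) := fun a x => ρ.asModuleEquiv_map_smul a x
  refine ⟨⟨{ ρ.asModuleEquiv with
    map_smul' := fun c x => ?_ }⟩, fun s x => ρ.asModuleEquiv.injective ?_⟩
  · refine (hs (algebraMap _ _ c) x).trans ?_
    rw [AlgHom.commutes]
    rfl
  · refine (hs (MonoidAlgebra.of k G s) x).trans ?_
    rw [Representation.asAlgebraHom_of]
    rfl

end GroupAlgebra

section PeriodicExactness

variable {R : Type} [Ring R]

/-- The part of `M` on which the idempotent `e` vanishes has no homology with respect to the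
operators `a` and `b`. -/
def ExactOff (a b e : R) (M : ModuleCat.{0} R) : Prop :=
  ∀ m : M, e • m = 0 →
    (a • m = 0 → ∃ n : M, e • n = 0 ∧ m = b • n) ∧ (b • m = 0 → ∃ n : M, e • n = 0 ∧ m = a • n)

theorem exists_annihilated_lift {e : R} (he : e * e = e) {M N : ModuleCat.{0} R} {f : M ⟶ N}
    (hf : Function.Surjective f) {n : N} (hn : e • n = 0) : ∃ m : M, e • m = 0 ∧ f m = n := by
  obtain ⟨m, rfl⟩ := hf n
  refine ⟨m - e • m, by rw [smul_sub, smul_smul, he, sub_self], ?_⟩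
  have : f (e • m) = e • f m := f.hom.map_smul e m
  rw [map_sub, this, hn, sub_zero]

variable {a b e : R}

theorem ExactOff.of_weak (he : e * e = e) (hea : e * a = a * e) (heb : e * b = b * e)
    {M : ModuleCat.{0} R}
    (h : ∀ m : M, e • m = 0 →
      (a • m = 0 → ∃ n : M, m = b • n) ∧ (b • m = 0 → ∃ n : M, m = a • n)) :
    ExactOff a b e M := by
  have key : ∀ (c : R), e * c = c * e → ∀ m n : M, e • m = 0 → m = c • n →
      ∃ n : M, e • n = 0 ∧ m = c • n := fun c hc m n hm hmn =>
    ⟨n - e • n, by rw [smul_sub, smul_smul, he, sub_self], by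
      rw [smul_sub, ← hmn, smul_smul, ← hc, mul_smul, ← hmn, hm, sub_zero]⟩
  exact fun m hm => ⟨fun ha => let ⟨n, hn⟩ := (h m hm).1 ha; key b heb m n hm hn,
    fun hb => let ⟨n, hn⟩ := (h m hm).2 hb; key a hea m n hm hn⟩

theorem StablyZero.exists_eq_smul
    (hproj : ∀ P : ModuleCat.{0} R, Projective P → ∀ m : P, a • m = 0 → ∃ n : P, m = b • n)
    {M N : ModuleCat.{0} R} {f : M ⟶ N} (hf : StablyZero f) {m : M} (hm : a • m = 0) :
    ∃ n : N, f m = b • n := by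
  obtain ⟨P, hP, g, h, rfl⟩ := hf
  obtain ⟨n, hn⟩ := hproj P hP (g m) (by
    rw [show a • g m = g (a • m) from (g.hom.map_smul a m).symm, hm, map_zero])
  refine ⟨h n, ?_⟩
  rw [ConcreteCategory.comp_apply, hn]
  exact h.hom.map_smul b n

theorem exactOff_of_inThick (hab : a * b = 0) (hba : b * a = 0) (he : e * e = e)
    (hea : e * a = a * e) (heb : e * b = b * e)
    (hpa : ∀ P : ModuleCat.{0} R, Projective P → ∀ m : P, a • m = 0 → ∃ n : P, m = b • n)
    (hpb : ∀ P : ModuleCat.{0} R, Projective P → ∀ m : P, b • m = 0 → ∃ n : P, m = a • n)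
    {T : ModuleCat.{0} R} (hT : ∀ m : T, e • m = m) {M : ModuleCat.{0} R} (hM : InThick T M) :
    ExactOff a b e M := by
  have ms : ∀ {M N : ModuleCat.{0} R} (f : M ⟶ N) (r : R) (m : M), f (r • m) = r • f m :=
    fun f r m => f.hom.map_smul r m
  have ext1 : ∀ {a b : R}, b * a = 0 → e * a = a * e → ∀ {X Y Z : ModuleCat.{0} R}, SES X Y Z →
      (∀ x : X, e • x = 0 → b • x = 0 → ∃ n : X, e • n = 0 ∧ x = a • n) →
      (∀ x : Y, e • x = 0 → a • x = 0 → ∃ n : Y, e • n = 0 ∧ x = b • n) →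
      ∀ z : Z, e • z = 0 → a • z = 0 → ∃ n : Z, z = b • n := by
    intro a b hba hea X Y Z s hX hY z hez haz
    obtain ⟨y, hey, rfl⟩ := exists_annihilated_lift he s.surj hez
    obtain ⟨x, hx⟩ := (s.exact (a • y)).1 (by rw [ms, haz])
    have hex : e • x = 0 := s.inj (by
      rw [ms, hx, map_zero, smul_smul, hea, mul_smul, hey, smul_zero])
    have hbx : b • x = 0 := s.inj (by rw [ms, hx, map_zero, smul_smul, hba, zero_smul])
    obtain ⟨x', hex', rfl⟩ := hX x hex hbx
    obtain ⟨n, -, hn⟩ := hY (y - s.i x') (by rw [smul_sub, hey, ← ms, hex', map_zero, sub_zero])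
      (by rw [smul_sub, ← hx, ← ms, sub_self])
    refine ⟨s.p n, ?_⟩
    rw [← ms, ← hn, map_sub, (s.exact (s.i x')).2 ⟨x', rfl⟩, sub_zero]
  have ext2 : ∀ {a b : R}, a * b = 0 → e * b = b * e → ∀ {X Y Z : ModuleCat.{0} R}, SES X Y Z →
      (∀ x : X, e • x = 0 → a • x = 0 → ∃ n : X, e • n = 0 ∧ x = b • n) →
      (∀ x : Z, e • x = 0 → a • x = 0 → ∃ n : Z, e • n = 0 ∧ x = b • n) →
      ∀ z : Y, e • z = 0 → a • z = 0 → ∃ n : Y, z = b • n := by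
    intro a b hab heb X Y Z s hX hZ y hey hay
    obtain ⟨z, hez, hz⟩ := hZ (s.p y) (by rw [← ms, hey, map_zero]) (by rw [← ms, hay, map_zero])
    obtain ⟨y', hey', rfl⟩ := exists_annihilated_lift he s.surj hez
    obtain ⟨x, hx⟩ := (s.exact (y - b • y')).1 (by rw [map_sub, hz, ms, sub_self])
    have hex : e • x = 0 := s.inj (by
      rw [ms, hx, map_zero, smul_sub, hey, smul_smul, heb, mul_smul, hey', smul_zero, sub_zero])
    have hax : a • x = 0 := s.inj (by
      rw [ms, hx, map_zero, smul_sub, hay, smul_smul, hab, zero_smul, sub_zero])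
    obtain ⟨x', -, rfl⟩ := hX x hex hax
    refine ⟨y' + s.i x', ?_⟩
    rw [smul_add, ← ms, hx, add_sub_cancel]
  have ext3 : ∀ {a b : R}, b * a = 0 → ∀ {X Y Z : ModuleCat.{0} R}, SES X Y Z →
      (∀ x : Y, e • x = 0 → a • x = 0 → ∃ n : Y, e • n = 0 ∧ x = b • n) →
      (∀ x : Z, e • x = 0 → b • x = 0 → ∃ n : Z, e • n = 0 ∧ x = a • n) →
      ∀ z : X, e • z = 0 → a • z = 0 → ∃ n : X, z = b • n := by
    intro a b hba X Y Z s hY hZ x hex hax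
    obtain ⟨y, hey, hy⟩ := hY (s.i x) (by rw [← ms, hex, map_zero]) (by rw [← ms, hax, map_zero])
    obtain ⟨z, hez, hz⟩ := hZ (s.p y) (by rw [← ms, hey, map_zero])
      (by rw [← ms, ← hy]; exact (s.exact _).2 ⟨x, rfl⟩)
    obtain ⟨y', hey', rfl⟩ := exists_annihilated_lift he s.surj hez
    obtain ⟨x', hx'⟩ := (s.exact (y - a • y')).1 (by rw [map_sub, hz, ms, sub_self])
    refine ⟨x', s.inj ?_⟩
    rw [ms, hx', smul_sub, smul_smul, hba, zero_smul, sub_zero, hy]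
  have iso : ∀ {a b : R},
      (∀ P : ModuleCat.{0} R, Projective P → ∀ m : P, a • m = 0 → ∃ n : P, m = b • n) →
      ∀ {M N : ModuleCat.{0} R}, StablyIso M N →
      (∀ x : M, e • x = 0 → a • x = 0 → ∃ n : M, e • n = 0 ∧ x = b • n) →
      ∀ z : N, e • z = 0 → a • z = 0 → ∃ n : N, z = b • n := by
    rintro a b hp M N ⟨f, g, -, hgf⟩ hM n hen han
    obtain ⟨m, -, hm⟩ := hM (g n) (by rw [← ms, hen, map_zero]) (by rw [← ms, han, map_zero])
    obtain ⟨n', hn'⟩ := hgf.exists_eq_smul hp han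
    refine ⟨f m - n', ?_⟩
    rw [smul_sub, ← hn', ← ms, ← hm]
    change n = f (g n) - (f (g n) - n)
    abel
  induction hM with
  | gen =>
    intro m hm
    rw [hT] at hm
    subst hm
    exact ⟨fun _ => ⟨0, by simp⟩, fun _ => ⟨0, by simp⟩⟩
  | proj P hP => exact .of_weak he hea heb fun m _ => ⟨hpa P hP m, hpb P hP m⟩
  | iso h _ ih =>
    exact .of_weak he hea heb fun m hm => ⟨iso hpa h (fun x hx => (ih x hx).1) m hm,
      iso hpb h (fun x hx => (ih x hx).2) m hm⟩
  | ext₁ s _ _ ihX ihY =>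
    exact .of_weak he hea heb fun m hm =>
      ⟨ext1 hba hea s (fun x hx => (ihX x hx).2) (fun x hx => (ihY x hx).1) m hm,
      ext1 hab heb s (fun x hx => (ihX x hx).1) (fun x hx => (ihY x hx).2) m hm⟩
  | ext₂ s _ _ ihX ihZ =>
    exact .of_weak he hea heb fun m hm =>
      ⟨ext2 hab heb s (fun x hx => (ihX x hx).1) (fun x hx => (ihZ x hx).1) m hm,
      ext2 hba hea s (fun x hx => (ihX x hx).2) (fun x hx => (ihZ x hx).2) m hm⟩
  | ext₃ s _ _ ihY ihZ =>
    exact .of_weak he hea heb fun m hm =>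
      ⟨ext3 hba s (fun x hx => (ihY x hx).1) (fun x hx => (ihZ x hx).2) m hm,
      ext3 hab s (fun x hx => (ihY x hx).2) (fun x hx => (ihZ x hx).1) m hm⟩
  | summand h _ ih =>
    obtain ⟨s, r, hsr⟩ := h
    have hr : ∀ m, r (s m) = m := fun m => congrArg (fun t => t.hom m) hsr
    refine .of_weak he hea heb fun m hm => ⟨fun ha => ?_, fun hb => ?_⟩
    · obtain ⟨n, -, hn⟩ := (ih (s m) (by rw [← ms, hm, map_zero])).1 (by rw [← ms, ha, map_zero])
      exact ⟨r n, by rw [← ms, ← hn, hr]⟩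
    · obtain ⟨n, -, hn⟩ := (ih (s m) (by rw [← ms, hm, map_zero])).2 (by rw [← ms, hb, map_zero])
      exact ⟨r n, by rw [← ms, ← hn, hr]⟩

end PeriodicExactness

section Ghosts

open scoped ModuleCat

variable {k G : Type} [Field k] [Group G] [Finite G]

/-- A ghost: a map annihilated stably by all maps from the given family. -/
def Ghost {R : Type} [Ring R] (Ω : ℤ → ModuleCat.{0} R) {M Y : ModuleCat.{0} R} (f : M ⟶ Y) :
    Prop :=
  ∀ (i : ℤ) (g : Ω i ⟶ M), StablyZero (g ≫ f)

/-- A map of the quotients lifts to a map of short exact sequences with projective middle terms,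
and the induced map of the kernels is a ghost if the original map is. -/
theorem Ghost.exists_shift {Ω : ℤ → ModuleCat.{0} (MonoidAlgebra k G)}
    {T : ModuleCat.{0} (MonoidAlgebra k G)} (hΩ : IsSyzygyFamily T Ω)
    {M₁ Q M Y₁ S Y : ModuleCat.{0} (MonoidAlgebra k G)} (s : SES M₁ Q M) (s' : SES Y₁ S Y)
    (hQ : Projective Q) {f : M ⟶ Y} (hf : Ghost Ω f) :
    ∃ (b : Q ⟶ S) (f₁ : M₁ ⟶ Y₁), (∀ y, s'.p (b y) = f (s.p y)) ∧
      (∀ x, s'.i (f₁ x) = b (s.i x)) ∧ Ghost Ω f₁ := by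
  have hQ' := rel_id_of_projective hQ
  obtain ⟨b, hb, hb'⟩ := s'.shortEx.exists_lift hQ' (toLin_eqv (s.p ≫ f))
  obtain ⟨f₁, hf₁, hf₁'⟩ := s'.shortEx.exists_factor_ker (b ∘ₗ toLin s.i) (by
    rw [← LinearMap.comp_assoc, hb', toLin_comp, LinearMap.comp_assoc]
    ext x
    simp [(s.exact (s.i x)).2 ⟨x, rfl⟩])
  have hf₁e := hf₁' (hb.comp (toLin_eqv _))
  refine ⟨homOfEqv b hb, homOfEqv f₁ hf₁e, LinearMap.congr_fun hb', LinearMap.congr_fun hf₁,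
    fun i g₁ => ?_⟩
  obtain ⟨j, rfl⟩ : ∃ j, i = j + 1 := ⟨i - 1, by ring⟩
  obtain ⟨P, hP, ⟨t⟩⟩ := hΩ.2.2 j
  have hP' := rel_id_of_projective hP
  obtain ⟨β, hβ, hβ'⟩ := t.shortEx.exists_extension hQ' (toLin_eqv (g₁ ≫ s.i))
  obtain ⟨g, hg, hg'⟩ := t.shortEx.exists_factor_coker (toLin s.p ∘ₗ β) (by
    rw [LinearMap.comp_assoc, hβ', toLin_comp]
    ext x
    simp [(s.exact (s.i (g₁ x))).2 ⟨_, rfl⟩])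
  have hge := hg' ((toLin_eqv _).comp hβ)
  have h0 := (stablyZero_iff_rel _).1 (hf j (homOfEqv g hge))
  rw [stablyZero_iff_rel]
  refine ShortEx.rel_left t.shortEx s'.shortEx hP' (hb.comp hβ) ?_ ?_ h0
  · rw [toLin_comp, toLin_homOfEqv, ← LinearMap.comp_assoc, hf₁, LinearMap.comp_assoc,
      LinearMap.comp_assoc, hβ', toLin_comp]
  · rw [← LinearMap.comp_assoc, hb', toLin_comp, toLin_comp, toLin_homOfEqv,
      LinearMap.comp_assoc, LinearMap.comp_assoc, hg]

end Ghosts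

section GhostsOnKernels

open scoped ModuleCat

theorem hom_smul {R : Type} [Ring R] {M N : ModuleCat.{0} R} (f : M ⟶ N) (r : R) (m : M) :
    f (r • m) = r • f m := f.hom.map_smul r m

theorem SES.p_i {R : Type} [Ring R] {M N L : ModuleCat.{0} R} (s : SES M N L) (x : M) :
    s.p (s.i x) = 0 := (s.exact _).2 ⟨x, rfl⟩

theorem mem_image_of_ladder {R : Type} [Ring R] {a b : R}
    (hp : ∀ P : ModuleCat.{0} R, Projective P → ∀ m : P, a • m = 0 → ∃ n : P, m = b • n)
    {M₁ Q M Y₁ S Y : ModuleCat.{0} R} (s : SES M₁ Q M) (s' : SES Y₁ S Y) (hS : Projective S)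
    {f : M ⟶ Y} {β : Q ⟶ S} {f₁ : M₁ ⟶ Y₁} (hβ : ∀ y, s'.p (β y) = f (s.p y))
    (hf₁ : ∀ x, s'.i (f₁ x) = β (s.i x)) {y : Q} {w : M₁} (hw : s.i w = a • y)
    (hx : ∃ x, f₁ w = a • x) : ∃ x, f (s.p y) = b • x := by
  obtain ⟨x, hx⟩ := hx
  obtain ⟨r, hr⟩ := hp S hS (β y - s'.i x) (by
    rw [smul_sub, ← hom_smul, ← hom_smul, ← hx, hf₁, hw, sub_self])
  exact ⟨s'.p r, by rw [← hom_smul, ← hr, map_sub, s'.p_i, sub_zero, hβ]⟩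

variable {k G : Type} [Field k] [Group G] [Finite G]

theorem Ghost.map_kernels {Ω : ℤ → ModuleCat.{0} (MonoidAlgebra k G)}
    {T : ModuleCat.{0} (MonoidAlgebra k G)} (hΩ : IsSyzygyFamily T Ω)
    {a b ep em e : MonoidAlgebra k G} (hab : a * b = 0) (hba : b * a = 0)
    (hpa : ∀ P : ModuleCat.{0} (MonoidAlgebra k G), Projective P →
      ∀ m : P, a • m = 0 → ∃ n : P, m = b • n)
    (hpb : ∀ P : ModuleCat.{0} (MonoidAlgebra k G), Projective P →
      ∀ m : P, b • m = 0 → ∃ n : P, m = a • n)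
    (hep : ep * ep = ep) (hem : em * em = em) (haem : a * em = ep * a) (haep : a * ep = em * a)
    (hbep : b * ep = ep * b) (he : e = ep ∨ e = ep + em)
    (hee : e * e = e) (hea : e * a = a * e) (heb : e * b = b * e) (hT : ∀ m : T, e • m = m)
    (hfix : ∀ (M Y : ModuleCat.{0} (MonoidAlgebra k G)) (f : M ⟶ Y), Ghost Ω f →
      ∀ w : M, a • w = 0 → ep • w = w → ∃ x, f w = b • x)
    {M Y : ModuleCat.{0} (MonoidAlgebra k G)} (hM : InThick T M) {f : M ⟶ Y} (hf : Ghost Ω f) :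
    (∀ z : M, a • z = 0 → ∃ x, f z = b • x) ∧ (∀ z : M, b • z = 0 → ∃ x, f z = a • x) := by
  have minus : ∀ {M Y : ModuleCat.{0} (MonoidAlgebra k G)} {f : M ⟶ Y}, Ghost Ω f →
      ∀ z : M, a • z = 0 → em • z = z → ∃ x, f z = b • x := by
    intro M Y f hf z haz hez
    obtain ⟨Q, π, hQ, hπ⟩ := exists_projective_cover M
    obtain ⟨M₁, s, rfl⟩ := exists_kernel_ses π hπ
    obtain ⟨S, π', hS, hπ'⟩ := exists_projective_cover Y
    obtain ⟨Y₁, s', rfl⟩ := exists_kernel_ses π' hπ'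
    obtain ⟨β, f₁, hβ, hβ', hf₁⟩ := hf.exists_shift hΩ s s' hQ
    obtain ⟨Q₁, π₁, hQ₁, hπ₁⟩ := exists_projective_cover M₁
    obtain ⟨M₂, s₁, rfl⟩ := exists_kernel_ses π₁ hπ₁
    obtain ⟨S₁, π₁', hS₁, hπ₁'⟩ := exists_projective_cover Y₁
    obtain ⟨Y₂, s₁', rfl⟩ := exists_kernel_ses π₁' hπ₁'
    obtain ⟨β₁, f₂, hβ₁, hβ₁', hf₂⟩ := hf₁.exists_shift hΩ s₁ s₁' hQ₁
    obtain ⟨y, rfl⟩ := s.surj z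
    rw [← hez, ← hom_smul]
    obtain ⟨v, hv⟩ := (s.exact (a • em • y)).1 (by rw [hom_smul, hom_smul, hez, haz])
    have hev : ep • v = v := s.inj (by
      rw [hom_smul, hv, smul_smul, smul_smul, ← haem, mul_assoc, hem, mul_smul])
    have hbv : b • v = 0 := s.inj (by
      rw [hom_smul, hv, smul_smul, hba, zero_smul, map_zero])
    refine mem_image_of_ladder hpa s s' hS hβ hβ' hv ?_
    obtain ⟨y₁, rfl⟩ := s₁.surj v
    rw [← hev, ← hom_smul]
    obtain ⟨w, hw⟩ := (s₁.exact (b • ep • y₁)).1 (by rw [hom_smul, hom_smul, hev, hbv])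
    refine mem_image_of_ladder hpb s₁ s₁' hS₁ hβ₁ hβ₁' hw ?_
    refine hfix _ _ f₂ hf₂ w (s₁.inj ?_) (s₁.inj ?_)
    · rw [hom_smul, hw, smul_smul, hab, zero_smul, map_zero]
    · rw [hom_smul, hw, smul_smul, smul_smul, ← hbep, mul_assoc, hep, mul_smul]
  have first : ∀ {M Y : ModuleCat.{0} (MonoidAlgebra k G)}, InThick T M → ∀ {f : M ⟶ Y},
      Ghost Ω f → ∀ z : M, a • z = 0 → ∃ x, f z = b • x := by
    intro M Y hM f hf z haz
    obtain ⟨n, -, hn⟩ := (exactOff_of_inThick hab hba hee hea heb hpa hpb hT hM (z - e • z)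
      (by rw [smul_sub, smul_smul, hee, sub_self])).1
      (by rw [smul_sub, smul_smul, ← hea, mul_smul, haz, smul_zero, sub_zero])
    obtain ⟨x, hx⟩ := hfix M Y f hf (ep • z) (by rw [smul_smul, haep, mul_smul, haz, smul_zero])
      (by rw [smul_smul, hep])
    obtain ⟨x', hx'⟩ := minus hf (em • z) (by rw [smul_smul, haem, mul_smul, haz, smul_zero])
      (by rw [smul_smul, hem])
    have hz : f z = f (z - e • z) + f (e • z) := by rw [← map_add, sub_add_cancel]
    rcases he with rfl | rfl
    · exact ⟨f n + x, by rw [hz, hn, hx, hom_smul, smul_add]⟩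
    · exact ⟨f n + (x + x'), by
        rw [hz, hn, add_smul, map_add, hx, hx', hom_smul, smul_add, smul_add]⟩
  refine ⟨first hM hf, fun z hbz => ?_⟩
  obtain ⟨Q, π, hQ, hπ⟩ := exists_projective_cover M
  obtain ⟨M₁, s, rfl⟩ := exists_kernel_ses π hπ
  obtain ⟨S, π', hS, hπ'⟩ := exists_projective_cover Y
  obtain ⟨Y₁, s', rfl⟩ := exists_kernel_ses π' hπ'
  obtain ⟨β, f₁, hβ, hβ', hf₁⟩ := hf.exists_shift hΩ s s' hQ
  obtain ⟨y, rfl⟩ := s.surj z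
  obtain ⟨v, hv⟩ := (s.exact (b • y)).1 (by rw [hom_smul, hbz])
  refine mem_image_of_ladder hpb s s' hS hβ hβ' hv ?_
  refine first (.ext₃ s (.proj Q hQ) hM) hf₁ v (s.inj ?_)
  rw [hom_smul, hv, smul_smul, hab, zero_smul, map_zero]

end GhostsOnKernels

section Fixed

open scoped ModuleCat

theorem exists_sum_eq_norm {C S M : Type} [Group C] [Fintype C] (hC : (Nat.card C).Prime)
    [AddCommGroup M] [DistribMulAction C M] [MulAction C S] [DecidableEq S] {F : S → M}
    (hF : ∀ (s : C) x, F (s • x) = s • F x) (T : Finset S) (hT : ∀ (s : C), ∀ x ∈ T, s • x ∈ T)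
    (hfree : ∀ x ∈ T, ∃ s : C, s • x ≠ x) : ∃ m : M, ∑ x ∈ T, F x = ∑ s : C, s • m := by
  induction T using Finset.strongInduction with
  | H T ih =>
    rcases T.eq_empty_or_nonempty with rfl | ⟨x, hx⟩
    · exact ⟨0, by simp⟩
    have : Fact (Nat.card C).Prime := ⟨hC⟩
    have hst : MulAction.stabilizer C x = ⊥ := by
      refine (MulAction.stabilizer C x).eq_bot_or_eq_top_of_prime_card.resolve_right fun h => ?_
      obtain ⟨s, hs⟩ := hfree x hx
      have : s ∈ MulAction.stabilizer C x := h ▸ Subgroup.mem_top s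
      exact hs this
    have hinj : Function.Injective fun s : C => s • x := fun s t hst' => by
      have : t⁻¹ * s ∈ MulAction.stabilizer C x := by
        rw [MulAction.mem_stabilizer_iff, mul_smul]
        exact inv_smul_eq_iff.2 hst'
      rw [hst, Subgroup.mem_bot] at this
      exact (inv_mul_eq_one.1 this).symm
    let O : Finset S := Finset.univ.image fun s : C => s • x
    have hO : O ⊆ T := fun y hy => by
      obtain ⟨s, -, rfl⟩ := Finset.mem_image.1 hy
      exact hT s x hx
    have hxO : x ∈ O := Finset.mem_image.2 ⟨1, Finset.mem_univ _, one_smul C x⟩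
    obtain ⟨m, hm⟩ := ih (T \ O) (Finset.sdiff_ssubset hO ⟨x, hxO⟩)
      (fun s y hy => by
        rw [Finset.mem_sdiff] at hy ⊢
        refine ⟨hT s y hy.1, fun h => hy.2 ?_⟩
        obtain ⟨t, -, ht⟩ := Finset.mem_image.1 h
        refine Finset.mem_image.2 ⟨s⁻¹ * t, Finset.mem_univ _, ?_⟩
        rw [mul_smul]
        exact inv_smul_eq_iff.2 ht)
      (fun y hy => hfree y (Finset.mem_sdiff.1 hy).1)
    refine ⟨m + F x, ?_⟩
    rw [← Finset.sum_sdiff hO, hm, Finset.sum_image fun _ _ _ _ h => hinj h]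
    simp [hF, Finset.sum_add_distrib]

theorem exists_complement_in_normalizer {G : Type} [Group G] [Finite G] {p : ℕ} [Fact p.Prime]
    (P : Sylow p G) : ∃ H : Subgroup G, ¬ p ∣ Nat.card H ∧
      H ≤ Subgroup.normalizer (P : Set G) ∧
      ∀ n ∈ Subgroup.normalizer (P : Set G), ∃ s ∈ P, ∃ h ∈ H, n = s * h := by
  set N := Subgroup.normalizer (P : Set G)
  let P' : Subgroup N := (P : Subgroup G).subgroupOf N
  have hPN : (P : Subgroup G) ≤ N := Subgroup.le_normalizer
  have hn : P'.Normal := Subgroup.normal_in_normalizer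
  have hidx : ¬ p ∣ P'.index := fun h =>
    P.not_dvd_index ((Subgroup.relIndex_mul_index hPN) ▸ h.mul_right N.index)
  have hcard : Nat.card P' = Nat.card P :=
    Nat.card_congr (Subgroup.subgroupOfEquivOfLe hPN).toEquiv
  obtain ⟨n, hn'⟩ := P.2.exists_card_eq
  have hco : Nat.Coprime (Nat.card P') P'.index := by
    rw [hcard, hn']
    exact Nat.Coprime.pow_left _ ((Nat.Prime.coprime_iff_not_dvd Fact.out).2 hidx)
  obtain ⟨K, hK⟩ := Subgroup.exists_right_complement'_of_coprime hco
  refine ⟨K.map N.subtype, ?_, Subgroup.map_subtype_le K, fun n hn => ?_⟩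
  · rw [Nat.card_congr (K.equivMapOfInjective _ N.subtype_injective).toEquiv.symm]
    rwa [← hK.symm.index_eq_card]
  · obtain ⟨⟨s, h⟩, hsh⟩ := hK.2 (⟨n, hn⟩ : N)
    exact ⟨s, s.2, h, Subgroup.mem_map_of_mem _ h.2, congrArg Subtype.val hsh.symm⟩

theorem mem_normalizer_of_forall_conj {G : Type} [Group G] [Finite G] {p : ℕ} [Fact p.Prime]
    (P : Sylow p G) {g : G}
    (h : ∀ s ∈ P, g⁻¹ * s * g ∈ Subgroup.normalizer (P : Set G)) :
    g ∈ Subgroup.normalizer (P : Set G) := by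
  have h1 : ((g⁻¹ • P : Sylow p G) : Subgroup G) ≤ Subgroup.normalizer (P : Set G) := by
    rw [Sylow.coe_subgroup_smul]
    rintro _ ⟨s, hs, rfl⟩
    simpa using h s hs
  have h2 : ((g⁻¹ • P : Sylow p G) : Subgroup G) ≤ P := by
    have := (g⁻¹ • P).2.inf_normalizer_sylow P
    rw [inf_eq_left.2 h1] at this
    exact inf_eq_left.1 this.symm
  have h3 : g⁻¹ • P = P := Sylow.ext ((g⁻¹ • P).3 P.2 h2).symm
  rw [Sylow.smul_eq_iff_mem_normalizer] at h3
  simpa using inv_mem h3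

variable {k G : Type} [Field k] [Group G] [Finite G]

theorem Ghost.map_invariant {Ω : ℤ → ModuleCat.{0} (MonoidAlgebra k G)}
    (hΩ : IsSyzygyFamily (triv k G) Ω) {M Y : ModuleCat.{0} (MonoidAlgebra k G)} {f : M ⟶ Y}
    (hf : Ghost Ω f) (P : Subgroup G) [Fintype P] {w : M} (hw : ∀ g : G, g • w = w) :
    ∃ y : Y, f w = ∑ s : P, s • y := by
  obtain ⟨⟨e⟩, ht⟩ := exists_triv_equiv (k := k) (G := G)
  obtain ⟨α, β, -, hβα⟩ := hΩ.2.1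
  let t : triv k G ⟶ M := homOfEqv ((LinearMap.toSpanSingleton k M w) ∘ₗ e.toLinearMap)
    (fun s x => by simp [ht, smul_comm s (e x) w, hw])
  have h1 : Rel G (toLin (t ≫ f)) := by
    have h2 := (stablyZero_iff_rel _).1 (hf 0 (α ≫ t))
    have h3 := (stablyZero_iff_rel _).1 hβα
    have h4 := (h2.comp_right (toLin_eqv β)).sub (h3.comp_left (toLin_eqv (t ≫ f)))
    convert h4 using 1
    ext x
    simp
  obtain ⟨φ, hφ⟩ := h1.subgroup P
  refine ⟨φ (e.symm 1), ?_⟩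
  have h5 := LinearMap.congr_fun hφ (e.symm 1)
  rw [tr_apply] at h5
  have h6 : toLin (t ≫ f) (e.symm 1) = f w := by
    change f (e (e.symm 1) • w) = f w
    rw [e.apply_symm_apply, one_smul]
  rw [← h6, ← h5]
  refine Finset.sum_congr rfl fun s _ => ?_
  rw [Subgroup.smul_def s⁻¹, ht]

theorem Ghost.map_normalizer_invariant {p : ℕ} [Fact p.Prime] (P : Sylow p G) [Fintype P]
    (hP : (Nat.card P).Prime) {Ω : ℤ → ModuleCat.{0} (MonoidAlgebra k G)}
    (hΩ : IsSyzygyFamily (triv k G) Ω) {M Y : ModuleCat.{0} (MonoidAlgebra k G)} {f : M ⟶ Y}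
    (hf : Ghost Ω f) {w : M} (hw : ∀ n ∈ Subgroup.normalizer (P : Set G), n • w = w) :
    ∃ y : Y, f w = ∑ s : P, s • y := by
  classical
  set N := Subgroup.normalizer (P : Set G)
  let := Fintype.ofFinite (G ⧸ N)
  let F : G ⧸ N → M := fun q => q.out • w
  have hF1 : ∀ g : G, F (g : G ⧸ N) = g • w := fun g => by
    obtain ⟨h, hh⟩ := QuotientGroup.mk_out_eq_mul N g
    simp only [F, hh, mul_smul, hw h h.2]
  have hF : ∀ (g : G) q, F (g • q) = g • F q := fun g q => by
    induction q using QuotientGroup.induction_on with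
    | H q => rw [hF1, MulAction.Quotient.smul_coe, hF1, smul_eq_mul, mul_smul]
  obtain ⟨y, hy⟩ := hf.map_invariant hΩ (P : Subgroup G) (w := ∑ q, F q) (fun g => by
    rw [Finset.smul_sum]
    simp_rw [← hF]
    exact Equiv.sum_comp (MulAction.toPerm g) F)
  obtain ⟨m, hm⟩ := exists_sum_eq_norm (C := P) hP (F := F) (fun s x => hF s x)
    (Finset.univ.erase ((1 : G) : G ⧸ N))
    (fun s x hx => by
      rw [Finset.mem_erase] at hx ⊢
      refine ⟨fun h => hx.1 ?_, Finset.mem_univ _⟩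
      rw [← inv_smul_eq_iff.2 h.symm]
      change ((s⁻¹ : G) • (1 : G) : G ⧸ N) = _
      rw [MulAction.Quotient.smul_coe, QuotientGroup.eq]
      simpa using Subgroup.le_normalizer s.2)
    (fun x hx => by
      by_contra! hfix
      refine (Finset.mem_erase.1 hx).1 ?_
      induction x using QuotientGroup.induction_on with
      | H g =>
        rw [eq_comm, QuotientGroup.eq, inv_one, one_mul]
        refine mem_normalizer_of_forall_conj P fun s hs => ?_
        have := hfix ⟨s, hs⟩
        change (s • (g : G ⧸ N)) = _ at this
        rw [MulAction.Quotient.smul_coe, eq_comm, QuotientGroup.eq] at this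
        simpa [mul_assoc] using this)
  have hw' : w = ∑ q, F q - ∑ s : P, s • m := by
    rw [← hm, ← Finset.add_sum_erase Finset.univ F (Finset.mem_univ ((1 : G) : G ⧸ N)), hF1,
      one_smul, add_sub_cancel_right]
  refine ⟨y - f m, ?_⟩
  rw [hw', map_sub, hy, map_sum]
  simp only [smul_sub, Finset.sum_sub_distrib]
  congr 1
  exact Finset.sum_congr rfl fun s _ => toLin_eqv f s m

end Fixed

section CharacterIdempotents

variable {k G : Type} [Field k] [Group G]

/-- The idempotent of the group algebra attached to a linear character of a subgroup. -/
noncomputable def charIdem (H : Subgroup G) [Fintype H] (χ : H →* k) : MonoidAlgebra k G :=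
  (Nat.card H : k)⁻¹ • ∑ h : H, χ h⁻¹ • MonoidAlgebra.of k G h

variable (H : Subgroup G) [Fintype H] (χ ψ : H →* k)

theorem of_mul_charIdem (g : H) : MonoidAlgebra.of k G g * charIdem H χ = χ g • charIdem H χ := by
  rw [charIdem, mul_smul_comm, smul_comm, Finset.mul_sum]
  congr 1
  rw [Finset.smul_sum]
  refine (Equiv.sum_comp (Equiv.mulLeft g⁻¹) fun h : H => MonoidAlgebra.of k G g *
    (χ h⁻¹ • MonoidAlgebra.of k G h)).symm.trans ?_
  refine Finset.sum_congr rfl fun h _ => ?_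
  simp only [Equiv.coe_mulLeft, mul_smul_comm, ← map_mul, Subgroup.coe_mul, Subgroup.coe_inv,
    mul_inv_cancel_left, mul_inv_rev, inv_inv, smul_smul]
  rw [map_mul, mul_comm, map_mul]

theorem charIdem_mul_of (g : H) : charIdem H χ * MonoidAlgebra.of k G g = χ g • charIdem H χ := by
  rw [charIdem, smul_mul_assoc, smul_comm, Finset.sum_mul]
  congr 1
  rw [Finset.smul_sum]
  refine (Equiv.sum_comp (Equiv.mulRight g⁻¹) fun h : H =>
    (χ h⁻¹ • MonoidAlgebra.of k G h) * MonoidAlgebra.of k G g).symm.trans ?_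
  refine Finset.sum_congr rfl fun h _ => ?_
  simp only [Equiv.coe_mulRight, smul_mul_assoc, ← map_mul, Subgroup.coe_mul, Subgroup.coe_inv,
    inv_mul_cancel_right, mul_inv_rev, inv_inv, smul_smul]

theorem charIdem_mul_self (hH : (Nat.card H : k) ≠ 0) :
    charIdem H χ * charIdem H χ = charIdem H χ := by
  nth_rw 1 [charIdem]
  simp only [smul_mul_assoc, Finset.sum_mul, of_mul_charIdem, smul_smul, ← map_mul,
    inv_mul_cancel, map_one, one_smul]
  rw [Finset.sum_const, Finset.card_univ, ← Nat.card_eq_fintype_card, ← Nat.cast_smul_eq_nsmul k,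
    smul_smul, inv_mul_cancel₀ hH, one_smul]

theorem charIdem_mul_of_ne (h : χ ≠ ψ) : charIdem H χ * charIdem H ψ = 0 := by
  obtain ⟨g, hg⟩ := DFunLike.ne_iff.1 h
  have h1 : χ g • (charIdem H χ * charIdem H ψ) = ψ g • (charIdem H χ * charIdem H ψ) := by
    rw [← smul_mul_assoc, ← charIdem_mul_of, mul_assoc, of_mul_charIdem, mul_smul_comm]
  rw [← sub_eq_zero, ← sub_smul] at h1
  exact (smul_eq_zero.1 h1).resolve_left (sub_ne_zero.2 hg)

theorem mul_charIdem {a : MonoidAlgebra k G} (hχ : ∀ h, χ h * χ h = 1)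
    (ha : ∀ h : H, a * MonoidAlgebra.of k G h = χ h • (MonoidAlgebra.of k G h * a)) :
    a * charIdem H ψ = charIdem H (χ * ψ) * a := by
  have hχ' : ∀ h, χ h⁻¹ = χ h := fun h => by
    rw [← mul_one (χ h⁻¹), ← hχ h, ← mul_assoc, ← map_mul, inv_mul_cancel, map_one, one_mul]
  simp only [charIdem, mul_smul_comm, smul_mul_assoc, Finset.mul_sum, Finset.sum_mul, ha,
    smul_smul, MonoidHom.mul_apply, hχ']
  congr 1
  exact Finset.sum_congr rfl fun h _ => by rw [mul_comm]

end CharacterIdempotents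

section SylowKernels

open scoped ModuleCat

variable {k G : Type} [Field k] [Group G]

theorem charIdem_one_smul (H : Subgroup G) [Fintype H] (hH : (Nat.card H : k) ≠ 0)
    {M : ModuleCat.{0} (MonoidAlgebra k G)} {m : M} (hm : ∀ h ∈ H, h • m = m) :
    charIdem H (1 : H →* k) • m = m := by
  have h1 : ∀ h : H, MonoidAlgebra.of k G h • m = m := fun h => hm h h.2
  simp only [charIdem, MonoidHom.one_apply, one_smul]
  rw [smul_assoc, Finset.sum_smul, Finset.sum_congr rfl fun h _ => h1 h, Finset.sum_const,
    Finset.card_univ, ← Nat.card_eq_fintype_card, ← Nat.cast_smul_eq_nsmul k, smul_smul,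
    inv_mul_cancel₀ hH, one_smul]

variable [Finite G]

theorem Ghost.map_kernels_of_sylow {p : ℕ} [Fact p.Prime] [CharP k p] (P : Sylow p G) [Fintype P]
    (hP : (Nat.card P).Prime) {Ω : ℤ → ModuleCat.{0} (MonoidAlgebra k G)}
    (hΩ : IsSyzygyFamily (triv k G) Ω) {a b : MonoidAlgebra k G}
    (hb : b = ∑ s : P, MonoidAlgebra.of k G s) (ha : a ≠ 0) (hab : a * b = 0) (hba : b * a = 0)
    (hpa : ∀ P : ModuleCat.{0} (MonoidAlgebra k G), Projective P →
      ∀ m : P, a • m = 0 → ∃ n : P, m = b • n)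
    (hpb : ∀ P : ModuleCat.{0} (MonoidAlgebra k G), Projective P →
      ∀ m : P, b • m = 0 → ∃ n : P, m = a • n)
    (hfix : ∀ (M : ModuleCat.{0} (MonoidAlgebra k G)) (w : M), a • w = 0 → ∀ s ∈ P, s • w = w)
    (hχ : ∀ n ∈ Subgroup.normalizer (P : Set G), ∃ ε : k, ε * ε = 1 ∧
      a * MonoidAlgebra.of k G n = ε • (MonoidAlgebra.of k G n * a))
    {M Y : ModuleCat.{0} (MonoidAlgebra k G)} (hM : InThick (triv k G) M) {f : M ⟶ Y}
    (hf : Ghost Ω f) :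
    (∀ z : M, a • z = 0 → ∃ x, f z = b • x) ∧ (∀ z : M, b • z = 0 → ∃ x, f z = a • x) := by
  classical
  obtain ⟨H, hH, hHN, hN⟩ := exists_complement_in_normalizer P
  have hHk : (Nat.card H : k) ≠ 0 := by rwa [Ne, CharP.cast_eq_zero_iff k p]
  let := Fintype.ofFinite H
  choose ε hε using fun h : H => hχ h (hHN h.2)
  have hcancel : ∀ (g : G) (c d : k), c • (MonoidAlgebra.of k G g * a) =
      d • (MonoidAlgebra.of k G g * a) → c = d := fun g c d h => by
    rw [← sub_eq_zero, ← sub_smul] at h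
    refine sub_eq_zero.1 ((smul_eq_zero.1 h).resolve_right fun h0 => ha ?_)
    have := congrArg (MonoidAlgebra.of k G g⁻¹ * ·) h0
    simpa only [← mul_assoc, ← map_mul, inv_mul_cancel, map_one, one_mul, mul_zero] using this
  let χ : H →* k :=
    { toFun := ε
      map_one' := hcancel 1 _ _ (by
        have := (hε 1).2
        rw [Subgroup.coe_one, map_one, mul_one, one_mul] at this
        rw [map_one, one_mul, one_smul]
        exact this.symm)
      map_mul' := fun g h => hcancel (g * h) _ _ (by
        have := (hε (g * h)).2
        rw [Subgroup.coe_mul] at this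
        rw [← this, map_mul, ← mul_assoc, (hε g).2, smul_mul_assoc, mul_assoc, (hε h).2,
          mul_smul_comm, smul_smul, mul_assoc]) }
  have hχ1 : ∀ h, χ h * χ h = 1 := fun h => (hε h).1
  have hχ2 : χ * χ = 1 := MonoidHom.ext hχ1
  have haχ : ∀ h : H, a * MonoidAlgebra.of k G h = χ h • (MonoidAlgebra.of k G h * a) :=
    fun h => (hε h).2
  have hbH : ∀ h : H, b * MonoidAlgebra.of k G h =
      (1 : H →* k) h • (MonoidAlgebra.of k G h * b) := fun h => by
    rw [MonoidHom.one_apply, one_smul, hb, Finset.sum_mul, Finset.mul_sum]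
    have hh := hHN h.2
    refine Finset.sum_bij (fun s _ => ⟨(h : G)⁻¹ * s * h, ?_⟩) (fun _ _ => Finset.mem_univ _)
      ?_ ?_ ?_
    · exact (Subgroup.mem_normalizer_iff''.1 hh s).1 s.2
    · intro s _ t _ hst
      exact Subtype.ext (by simpa using congrArg Subtype.val hst)
    · intro s _
      exact ⟨⟨h * s * (h : G)⁻¹, (Subgroup.mem_normalizer_iff.1 hh s).1 s.2⟩, Finset.mem_univ _,
        Subtype.ext (by simp [mul_assoc])⟩
    · intro s _
      simp [mul_assoc]
  have hbψ : ∀ ψ : H →* k, b * charIdem H ψ = charIdem H ψ * b := fun ψ => by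
    rw [mul_charIdem H 1 ψ (fun _ => by simp) hbH, one_mul]
  have hap : a * charIdem H 1 = charIdem H χ * a := by
    rw [mul_charIdem H χ 1 hχ1 haχ, mul_one]
  have hax : a * charIdem H χ = charIdem H 1 * a := by
    rw [mul_charIdem H χ χ hχ1 haχ, hχ2]
  have hep := charIdem_mul_self H (1 : H →* k) hHk
  have hem := charIdem_mul_self H χ hHk
  have hT : ∀ m : triv k G, charIdem H (1 : H →* k) • m = m := fun m =>
    charIdem_one_smul H hHk fun h _ => exists_triv_equiv.2 h m
  have hfix' : ∀ (M Y : ModuleCat.{0} (MonoidAlgebra k G)) (f : M ⟶ Y), Ghost Ω f →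
      ∀ w : M, a • w = 0 → charIdem H (1 : H →* k) • w = w → ∃ x, f w = b • x := by
    intro M Y f hf w haw hew
    obtain ⟨y, hy⟩ := hf.map_normalizer_invariant P hP hΩ (w := w) (fun n hn => by
      obtain ⟨s, hs, h, hh, rfl⟩ := hN n hn
      rw [mul_smul]
      have : h • w = w := by
        rw [← hew, group_smul_def, smul_smul, of_mul_charIdem H 1 ⟨h, hh⟩, MonoidHom.one_apply,
          one_smul]
      rw [this, hfix M w haw s hs])
    refine ⟨y, hy.trans ?_⟩
    rw [hb, Finset.sum_smul]
    rfl
  by_cases h1 : χ = 1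
  · rw [h1] at hap
    exact Ghost.map_kernels hΩ hab hba hpa hpb hep hep hap hap (hbψ 1) (Or.inl rfl) hep hap.symm
      (hbψ 1).symm hT hfix' hM hf
  · have h2 := charIdem_mul_of_ne H _ _ h1
    have h3 := charIdem_mul_of_ne H _ _ (Ne.symm h1)
    refine Ghost.map_kernels hΩ hab hba hpa hpb hep hem hax hap (hbψ 1) (Or.inr rfl) ?_ ?_ ?_ ?_
      hfix' hM hf
    · rw [add_mul, mul_add, mul_add, hep, hem, h2, h3, add_zero, zero_add]
    · rw [add_mul, mul_add, hap, hax, add_comm]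
    · rw [add_mul, mul_add, hbψ, hbψ]
    · intro m
      rw [add_smul, hT m, add_eq_left, ← hT m, smul_smul, h2, zero_smul]

end SylowKernels

section LinearFactorisations

variable {k X Y Z : Type} [Field k] [AddCommGroup X] [Module k X] [AddCommGroup Y] [Module k Y]
  [AddCommGroup Z] [Module k Z]

theorem exists_comp_eq_of_forall_exists (h : Y →ₗ[k] Z) (g : X →ₗ[k] Z)
    (H : ∀ x, ∃ y, h y = g x) : ∃ φ : X →ₗ[k] Y, ∀ x, h (φ x) = g x := by
  obtain ⟨φ, hφ⟩ := Module.projective_lifting_property h.rangeRestrict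
    (g.codRestrict (LinearMap.range h) H) h.surjective_rangeRestrict
  exact ⟨φ, fun x => congrArg Subtype.val (LinearMap.congr_fun hφ x)⟩

theorem exists_comp_eq_of_ker_le (h : X →ₗ[k] Y) (g : X →ₗ[k] Z)
    (H : ∀ x, h x = 0 → g x = 0) : ∃ φ : Y →ₗ[k] Z, ∀ x, φ (h x) = g x := by
  obtain ⟨σ, hσ⟩ := h.rangeRestrict.exists_rightInverse_of_surjective h.range_rangeRestrict
  obtain ⟨φ, hφ⟩ := LinearMap.exists_extend (g ∘ₗ σ)
  refine ⟨φ, fun x => ?_⟩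
  have h1 := LinearMap.congr_fun hφ (h.rangeRestrict x)
  have h2 := congrArg Subtype.val (LinearMap.congr_fun hσ (h.rangeRestrict x))
  change φ (h x) = g (σ (h.rangeRestrict x)) at h1
  change h (σ (h.rangeRestrict x)) = h x at h2
  rw [h1, ← sub_eq_zero, ← map_sub]
  exact H _ (by rw [map_sub, h2, sub_self])

end LinearFactorisations

section SmallCyclic

variable {k : Type} [Field k] {Γ : Type} [Group Γ] [Fintype Γ]
variable {X Y : Type} [AddCommGroup X] [Module k X] [DistribMulAction Γ X] [SMulCommClass Γ k X]
  [AddCommGroup Y] [Module k Y] [DistribMulAction Γ Y] [SMulCommClass Γ k Y]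

variable (k Γ X) in
/-- The action of the norm element of `Γ` on a representation. -/
def normMap : X →ₗ[k] X := ∑ s : Γ, DistribSMul.toLinearMap k X s

theorem normMap_apply (x : X) : normMap k Γ X x = ∑ s : Γ, s • x := by
  simp [normMap, LinearMap.sum_apply]

theorem normMap_smul (g : Γ) (x : X) : normMap k Γ X (g • x) = normMap k Γ X x := by
  simp only [normMap_apply, smul_smul]
  exact Equiv.sum_comp (Equiv.mulRight g) fun s => s • x

variable (k Γ X) in
/-- The subspace of vectors fixed by `Γ`. -/
def fixedSub : Submodule k X where
  carrier := {x | ∀ s : Γ, s • x = x}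
  add_mem' := fun hx hy s => by rw [smul_add, hx, hy]
  zero_mem' := fun s => smul_zero s
  smul_mem' := fun c x hx s => by rw [smul_comm, hx]

theorem exists_rel_eq_on_fixed {f : X →ₗ[k] Y}
    (h : ∀ z, (∀ s : Γ, s • z = z) → ∃ x, f z = ∑ s : Γ, s • x) :
    ∃ g : X →ₗ[k] Y, Rel Γ g ∧ ∀ z, (∀ s : Γ, s • z = z) → g z = f z := by
  obtain ⟨φ, hφ⟩ := exists_comp_eq_of_forall_exists (normMap k Γ Y)
    (f ∘ₗ (fixedSub k Γ X).subtype) (fun z => by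
      obtain ⟨x, hx⟩ := h z z.2
      exact ⟨x, by rw [normMap_apply]; exact hx.symm⟩)
  obtain ⟨ψ, hψ⟩ := LinearMap.exists_extend φ
  refine ⟨tr Γ ψ, ⟨ψ, rfl⟩, fun z hz => ?_⟩
  have h1 := hφ ⟨z, hz⟩
  rw [← hψ] at h1
  rw [tr_apply]
  simp only [hz]
  rw [← normMap_apply (k := k)]
  exact h1

theorem rel_of_ker_norm {f : X →ₗ[k] Y} (hf : Eqv Γ f)
    (h : ∀ z, ∑ s : Γ, s • z = 0 → f z = 0) : Rel Γ f := by
  have hfix : ∀ x, f x ∈ fixedSub k Γ Y := fun x s => by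
    rw [← hf s x, ← sub_eq_zero, ← map_sub]
    exact h _ (by rw [← normMap_apply (k := k), map_sub, normMap_smul, sub_self])
  obtain ⟨ψ, hψ⟩ := exists_comp_eq_of_ker_le (normMap k Γ X)
    (f.codRestrict (fixedSub k Γ Y) hfix)
    (fun x hx => Subtype.ext (h x (by rwa [normMap_apply] at hx)))
  refine ⟨(fixedSub k Γ Y).subtype ∘ₗ ψ, LinearMap.ext fun x => ?_⟩
  have h1 : ∀ (s : Γ) y, s • ((ψ y : fixedSub k Γ Y) : Y) = ψ y := fun s y => (ψ y).2 s
  rw [tr_apply]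
  simp only [LinearMap.comp_apply, Submodule.subtype_apply, h1]
  rw [← show ((ψ (normMap k Γ X x) : fixedSub k Γ Y) : Y) = f x from
    congrArg Subtype.val (hψ x), normMap_apply, map_sum, Submodule.coe_sum]
  exact Equiv.sum_comp (Equiv.inv Γ) fun s => ((ψ (s • x) : fixedSub k Γ Y) : Y)

theorem exists_sum_of_card_two (h : Nat.card Γ = 2) : ∃ c : Γ, c * c = 1 ∧ c ≠ 1 ∧
    (∀ s : Γ, s = 1 ∨ s = c) ∧ ∀ {M : Type} [AddCommMonoid M] (F : Γ → M), ∑ s, F s = F 1 + F c := by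
  classical
  rw [Nat.card_eq_fintype_card] at h
  have : Nontrivial Γ := Fintype.one_lt_card_iff_nontrivial.1 (by omega)
  obtain ⟨c, hc⟩ := exists_ne (1 : Γ)
  refine ⟨c, by rw [← pow_two, ← h, pow_card_eq_one], hc, ?_⟩
  have hu : (Finset.univ : Finset Γ) = {1, c} := (Finset.eq_univ_of_card _ (by
    rw [h, Finset.card_pair hc.symm])).symm
  refine ⟨fun s => ?_, fun F => ?_⟩
  · have := Finset.mem_univ s
    rwa [hu, Finset.mem_insert, Finset.mem_singleton] at this
  rw [hu, Finset.sum_pair hc.symm]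

theorem exists_sum_of_card_three (h : Nat.card Γ = 3) : ∃ c : Γ, c * c * c = 1 ∧ c ≠ c⁻¹ ∧
    (∀ s : Γ, s = 1 ∨ s = c ∨ s = c⁻¹) ∧
    ∀ {M : Type} [AddCommMonoid M] (F : Γ → M), ∑ s, F s = F 1 + F c + F c⁻¹ := by
  classical
  rw [Nat.card_eq_fintype_card] at h
  have : Nontrivial Γ := Fintype.one_lt_card_iff_nontrivial.1 (by omega)
  obtain ⟨c, hc⟩ := exists_ne (1 : Γ)
  have h3 : c * c * c = 1 := by rw [← pow_three', ← h, pow_card_eq_one]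
  have hcc : c ≠ c⁻¹ := fun h' => hc (by
    have : c * c = 1 := by nth_rw 2 [h']; simp
    rwa [this, one_mul] at h3)
  have hu : (Finset.univ : Finset Γ) = {1, c, c⁻¹} := (Finset.eq_univ_of_card _ (by
    rw [h, Finset.card_eq_three]
    exact ⟨1, c, c⁻¹, hc.symm, by simpa using hc, hcc, rfl⟩)).symm
  refine ⟨c, h3, hcc, fun s => by
    have := Finset.mem_univ s
    rwa [hu, Finset.mem_insert, Finset.mem_insert, Finset.mem_singleton] at this, fun F => ?_⟩
  rw [hu, Finset.sum_insert (by simp [hc, hc.symm]), Finset.sum_pair hcc, add_assoc]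

theorem rel_of_card_two [CharP k 2] (hΓ : Nat.card Γ = 2) {f : X →ₗ[k] Y} (hf : Eqv Γ f)
    (h : ∀ z, ∑ s : Γ, s • z = 0 → ∃ x, f z = ∑ s : Γ, s • x) : Rel Γ f := by
  obtain ⟨c, hc, -, hmem, hsum⟩ := exists_sum_of_card_two hΓ
  have h2 : ∀ x : X, x + x = 0 := fun x => by
    rw [← two_smul k, CharTwo.two_eq_zero, zero_smul]
  have h0 : ∀ z : X, (∑ s : Γ, s • z = 0) ↔ ∀ s : Γ, s • z = z := by
    refine fun z => ⟨fun hz => ?_, fun hz => ?_⟩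
    · have hcz : c • z = z := by
        rw [hsum, one_smul] at hz
        rw [← add_right_inj z, hz, h2]
      intro s
      rcases hmem s with rfl | rfl
      · exact one_smul _ _
      · exact hcz
    · rw [hsum, hz, hz, h2]
  obtain ⟨g, hg, hgf⟩ := exists_rel_eq_on_fixed fun z hz => h z ((h0 z).2 hz)
  have := hg.add (rel_of_ker_norm (hf.sub hg.eqv) fun z hz => by
    rw [LinearMap.sub_apply, hgf z ((h0 z).1 hz), sub_self])
  rwa [add_sub_cancel] at this

theorem exists_tr_eq_of_norm_eq_zero {c : Γ} (hc : c * c * c = 1)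
    (hsum : ∀ {M : Type} [AddCommMonoid M] (F : Γ → M), ∑ s, F s = F 1 + F c + F c⁻¹)
    (φ : X →ₗ[k] Y) {z : X} (hz : ∑ s : Γ, s • z = 0) :
    ∃ y, tr Γ φ z = c • y - c⁻¹ • y := by
  rw [hsum, one_smul] at hz
  have hcc : c * c = c⁻¹ := mul_eq_one_iff_eq_inv.1 hc
  have hcc' : c⁻¹ * c⁻¹ = c := by rw [← mul_inv_rev, hcc, inv_inv]
  refine ⟨c⁻¹ • φ z - φ (c • z), ?_⟩
  have h1 : z = -(c • z) - c⁻¹ • z := by rw [← sub_eq_zero, ← hz]; abel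
  have h2 : φ (c⁻¹ • z) = - φ z - φ (c • z) := by
    rw [h1, map_sub, map_neg, ← h1]; abel
  rw [tr_apply, hsum]
  simp only [inv_one, one_smul, inv_inv, h2, smul_sub, smul_neg, smul_smul, mul_inv_cancel, hcc']
  abel

omit [Fintype Γ] in
theorem smul_eq_of_smul_sub_inv_smul {M : Type} [AddCommGroup M] [DistribMulAction Γ M] {c : Γ}
    (hc : c * c * c = 1) (hmem : ∀ s : Γ, s = 1 ∨ s = c ∨ s = c⁻¹) {z : M}
    (hz : c • z - c⁻¹ • z = 0) (s : Γ) : s • z = z := by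
  have h1 : c • z = z := by
    rw [sub_eq_zero] at hz
    calc c • z = c • c • c • z := by rw [hz, smul_inv_smul, ← hz]
      _ = z := by rw [smul_smul, smul_smul, hc, one_smul]
  rcases hmem s with rfl | rfl | rfl
  · exact one_smul _ _
  · exact h1
  · rw [inv_smul_eq_iff, h1]

theorem rel_of_card_three [CharP k 3] {c : Γ} (hc : c * c * c = 1)
    (hmem : ∀ s : Γ, s = 1 ∨ s = c ∨ s = c⁻¹)
    (hsum : ∀ {M : Type} [AddCommMonoid M] (F : Γ → M), ∑ s, F s = F 1 + F c + F c⁻¹)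
    {f : X →ₗ[k] Y} (hf : Eqv Γ f)
    (h : ∀ z, (∀ s : Γ, s • z = z) → ∃ x, f z = ∑ s : Γ, s • x)
    (h' : ∀ z, ∑ s : Γ, s • z = 0 → ∃ x, f z = c • x - c⁻¹ • x) : Rel Γ f := by
  have hcc : c * c = c⁻¹ := mul_eq_one_iff_eq_inv.1 hc
  have hcc' : c⁻¹ * c⁻¹ = c := by rw [← mul_inv_rev, hcc, inv_inv]
  have h3 : ∀ (y : Y), y + y + y = 0 := fun y => by
    have : (3 : k) = 0 := by exact_mod_cast CharP.cast_eq_zero k 3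
    linear_combination (norm := module) this • y
  have h3X : ∀ (y : X), y + y + y = 0 := fun y => by
    have : (3 : k) = 0 := by exact_mod_cast CharP.cast_eq_zero k 3
    linear_combination (norm := module) this • y
  have hfix : ∀ z : X, c • z - c⁻¹ • z = 0 → ∀ s : Γ, s • z = z :=
    fun z hz => smul_eq_of_smul_sub_inv_smul hc hmem hz
  obtain ⟨g, ⟨φ, rfl⟩, hgf⟩ := exists_rel_eq_on_fixed h
  set f₁ := f - tr Γ φ with hf₁
  have hf₁e : Eqv Γ f₁ := hf.sub (tr_eqv φ)
  have hf₁0 : ∀ z, (∀ s : Γ, s • z = z) → f₁ z = 0 := fun z hz => by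
    rw [hf₁, LinearMap.sub_apply, hgf z hz, sub_self]
  let τX : X →ₗ[k] X := DistribSMul.toLinearMap k X c - DistribSMul.toLinearMap k X c⁻¹
  let τY : Y →ₗ[k] Y := DistribSMul.toLinearMap k Y c - DistribSMul.toLinearMap k Y c⁻¹
  have hτX : ∀ x, τX x = c • x - c⁻¹ • x := fun _ => rfl
  have hτY : ∀ x, τY x = c • x - c⁻¹ • x := fun _ => rfl
  have hτ2 : ∀ x, τY (τY x) = ∑ s : Γ, s • x := fun x => by
    rw [hτY, hτY, hsum]
    simp only [smul_sub, smul_smul, hcc, hcc', mul_inv_cancel, inv_mul_cancel, one_smul]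
    rw [← sub_eq_zero, ← neg_eq_zero, ← h3 x]
    abel
  have hτ2X : ∀ x, τX (τX x) = ∑ s : Γ, s • x := fun x => by
    rw [hτX, hτX, hsum]
    simp only [smul_sub, smul_smul, hcc, hcc', mul_inv_cancel, inv_mul_cancel, one_smul]
    rw [← sub_eq_zero, ← neg_eq_zero, ← h3X x]
    abel
  have hτf : ∀ x, f₁ (τX x) = τY (f₁ x) := fun x => by
    rw [hτX, hτY, map_sub, hf₁e, hf₁e]
  let L := LinearMap.ker (normMap k Γ X)
  have hL : ∀ z : L, ∑ s : Γ, s • (z : X) = 0 := fun z => by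
    rw [← normMap_apply (k := k)]; exact z.2
  let hh : LinearMap.ker (normMap k Γ Y) →ₗ[k] Y :=
    τY ∘ₗ (LinearMap.ker (normMap k Γ Y)).subtype
  have hF : ∀ z : L, f₁ z ∈ LinearMap.range hh := fun z => by
    obtain ⟨x, hx⟩ := h' z (hL z)
    obtain ⟨y, hy⟩ := exists_tr_eq_of_norm_eq_zero hc hsum φ (hL z)
    have h1 : τY (x - y) = f₁ z := by
      rw [map_sub, hτY, hτY, ← hx, ← hy]; rfl
    refine ⟨⟨x - y, ?_⟩, h1⟩
    rw [LinearMap.mem_ker, normMap_apply, ← hτ2, h1, ← hτf]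
    exact hf₁0 _ (hfix _ (by rw [← hτX, hτ2X, hL]))
  obtain ⟨g, hg⟩ := exists_comp_eq_of_ker_le (τX ∘ₗ L.subtype)
    ((f₁ ∘ₗ L.subtype).codRestrict (LinearMap.range hh) hF)
    (fun z hz => Subtype.ext (hf₁0 _ (hfix _ hz)))
  obtain ⟨ψ, hψ⟩ := exists_comp_eq_of_forall_exists hh ((LinearMap.range hh).subtype ∘ₗ g)
    (fun x => (g x).2)
  let θ : X →ₗ[k] Y := (LinearMap.ker (normMap k Γ Y)).subtype ∘ₗ ψ
  have hθ : ∀ x, θ x + c • θ x + c⁻¹ • θ x = 0 := fun x => by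
    have := (ψ x).2
    rwa [LinearMap.mem_ker, normMap_apply, hsum, one_smul] at this
  have hθf : ∀ z, ∑ s : Γ, s • z = 0 → f₁ z = τY (θ (τX z)) := fun z hz => by
    have hz' : z ∈ L := by rwa [LinearMap.mem_ker, normMap_apply]
    have h1 := hψ (τX z)
    have h2 : ((g (τX z) : LinearMap.range hh) : Y) = f₁ z := congrArg Subtype.val (hg ⟨z, hz'⟩)
    rw [← h2]
    exact h1.symm
  have h4 : Rel Γ (f₁ - tr Γ θ) := by
    refine rel_of_ker_norm (hf₁e.sub (tr_eqv θ)) fun z hz => ?_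
    rw [LinearMap.sub_apply, hθf z hz, sub_eq_zero, tr_apply, hsum, hτX, hτY]
    rw [hsum, one_smul] at hz
    have h1 : z = -(c • z) - c⁻¹ • z := by rw [← sub_eq_zero, ← hz]; abel
    have h2 : θ z = -θ (c • z) - θ (c⁻¹ • z) := by
      conv_lhs => rw [h1, map_sub, map_neg]
    have h5 := hθ (c • z)
    have h6 := hθ (c⁻¹ • z)
    simp only [inv_one, one_smul, inv_inv, h2, smul_sub, map_sub]
    generalize θ (c • z) = u at *
    generalize θ (c⁻¹ • z) = v at *
    have h7 := h3 (c⁻¹ • u)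
    have h8 := h3 (c • v)
    generalize c • u = cu at *
    generalize c⁻¹ • u = cu' at *
    generalize c • v = cv at *
    generalize c⁻¹ • v = cv' at *
    linear_combination (norm := module) h5 + h6 - h7 - h8
  have h5 := (h4.add ⟨θ, rfl⟩).add ⟨φ, rfl⟩
  rwa [sub_add_cancel, hf₁, sub_add_cancel] at h5

end SmallCyclic

section SylowTwoThree

open scoped ModuleCat

variable {k G : Type} [Field k] [Group G] [Finite G]

theorem exists_tr_eq_of_projective (H : Subgroup G) {M : ModuleCat.{0} (MonoidAlgebra k G)}
    (hM : Projective M) : ∃ φ : M →ₗ[k] M, ∀ m, tr H φ m = m := by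
  obtain ⟨φ, hφ⟩ := (rel_id_of_projective hM).subgroup H
  exact ⟨φ, fun m => LinearMap.congr_fun hφ m⟩

theorem Ghost.rel_of_card_two {p : ℕ} [Fact p.Prime] [CharP k p] (P : Sylow p G)
    (hp : p = 2) (hP : Nat.card P = 2) {Ω : ℤ → ModuleCat.{0} (MonoidAlgebra k G)}
    (hΩ : IsSyzygyFamily (triv k G) Ω) {M Y : ModuleCat.{0} (MonoidAlgebra k G)}
    (hM : InThick (triv k G) M) {f : M ⟶ Y} (hf : Ghost Ω f) :
    Rel (P : Subgroup G) (toLin f) := by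
  subst hp
  let := Fintype.ofFinite P
  obtain ⟨c, hc, hc1, hmem, hsum⟩ := exists_sum_of_card_two hP
  have hb : MonoidAlgebra.of k G 1 + MonoidAlgebra.of k G c = ∑ s : P, MonoidAlgebra.of k G s := by
    rw [hsum]; rfl
  have hbM : ∀ {M : ModuleCat.{0} (MonoidAlgebra k G)} (m : M),
      (MonoidAlgebra.of k G 1 + MonoidAlgebra.of k G c) • m = ∑ s : P, s • m := fun m => by
    rw [hb, Finset.sum_smul]; rfl
  have h2 : ∀ {M : ModuleCat.{0} (MonoidAlgebra k G)} (m : M), m + m = 0 := fun m => by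
    rw [← two_smul k, CharTwo.two_eq_zero, zero_smul]
  have h2A : ∀ a : MonoidAlgebra k G, a + a = 0 := fun a => by
    rw [← two_smul k, CharTwo.two_eq_zero, zero_smul]
  have hcc : (c : G) * c = 1 := congrArg Subtype.val hc
  have hab : (MonoidAlgebra.of k G 1 + MonoidAlgebra.of k G c) *
      (MonoidAlgebra.of k G 1 + MonoidAlgebra.of k G c) = 0 := by
    rw [add_mul, mul_add, mul_add, ← map_mul, ← map_mul, ← map_mul, ← map_mul, hcc, mul_one,
      one_mul, mul_one, add_comm (MonoidAlgebra.of k G c), h2A]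
  have hcw : ∀ {M : ModuleCat.{0} (MonoidAlgebra k G)} (m : M),
      (MonoidAlgebra.of k G 1 + MonoidAlgebra.of k G c) • m = 0 → c • m = m := fun m hm => by
    rw [hbM, hsum, one_smul] at hm
    rw [← add_right_inj m, hm, h2]
  have hfix : ∀ (M : ModuleCat.{0} (MonoidAlgebra k G)) (w : M),
      (MonoidAlgebra.of k G 1 + MonoidAlgebra.of k G c) • w = 0 → ∀ s ∈ P, s • w = w := by
    intro M w hw s hs
    rcases hmem ⟨s, hs⟩ with h | h
    · rw [show s = 1 from congrArg Subtype.val h, one_smul]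
    · rw [show s = c from congrArg Subtype.val h]
      exact hcw w hw
  have hpa : ∀ Q : ModuleCat.{0} (MonoidAlgebra k G), Projective Q → ∀ m : Q,
      (MonoidAlgebra.of k G 1 + MonoidAlgebra.of k G c) • m = 0 →
      ∃ n : Q, m = (MonoidAlgebra.of k G 1 + MonoidAlgebra.of k G c) • n := by
    intro Q hQ m hm
    obtain ⟨φ, hφ⟩ := exists_tr_eq_of_projective (P : Subgroup G) hQ
    refine ⟨φ m, (hφ m).symm.trans ?_⟩
    rw [hbM, tr_apply]
    refine Finset.sum_congr rfl fun s _ => ?_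
    congr 2
    exact hfix Q m hm _ (inv_mem s.2)
  have hn : ∀ n ∈ Subgroup.normalizer (P : Set G),
      (MonoidAlgebra.of k G 1 + MonoidAlgebra.of k G c) * MonoidAlgebra.of k G n =
      (1 : k) • (MonoidAlgebra.of k G n *
        (MonoidAlgebra.of k G 1 + MonoidAlgebra.of k G c)) := by
    intro n hn
    have h1 : (c : G) * n = n * c := by
      have h3 := (Subgroup.mem_normalizer_iff.1 hn c).1 c.2
      rcases hmem ⟨_, h3⟩ with h | h
      · exact absurd (Subtype.ext (conj_eq_one_iff.1 (congrArg Subtype.val h))) hc1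
      · have h4 : n * c * n⁻¹ = c := congrArg Subtype.val h
        rw [← h4, inv_mul_cancel_right, h4]
    rw [one_smul, add_mul, mul_add, ← map_mul, ← map_mul, ← map_mul, ← map_mul, h1, one_mul,
      mul_one]
  have ha0 : MonoidAlgebra.of k G 1 + MonoidAlgebra.of k G c ≠ 0 := fun h => hc1 (by
    rw [← h2A (MonoidAlgebra.of k G c), add_left_inj] at h
    exact Subtype.ext (MonoidAlgebra.of_injective h).symm)
  refine StmodGH.rel_of_card_two hP ((toLin_eqv f).subgroup P) fun z hz => ?_
  obtain ⟨x, hx⟩ := (hf.map_kernels_of_sylow P (by rw [hP]; exact Nat.prime_two) hΩ hb ha0 hab hab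
    hpa hpa hfix (fun n h => ⟨1, one_mul 1, hn n h⟩) hM).1 z (by rw [hbM]; exact hz)
  exact ⟨x, by rw [toLin_apply, hx, hbM]⟩

theorem Ghost.rel_of_card_three {p : ℕ} [Fact p.Prime] [CharP k p] (P : Sylow p G)
    (hp : p = 3) (hP : Nat.card P = 3) {Ω : ℤ → ModuleCat.{0} (MonoidAlgebra k G)}
    (hΩ : IsSyzygyFamily (triv k G) Ω) {M Y : ModuleCat.{0} (MonoidAlgebra k G)}
    (hM : InThick (triv k G) M) {f : M ⟶ Y} (hf : Ghost Ω f) :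
    Rel (P : Subgroup G) (toLin f) := by
  subst hp
  let := Fintype.ofFinite P
  obtain ⟨c, hc, hc1, hmem, hsum⟩ := exists_sum_of_card_three hP
  set b : MonoidAlgebra k G := ∑ s : P, MonoidAlgebra.of k G s with hb
  set a : MonoidAlgebra k G := MonoidAlgebra.of k G c - MonoidAlgebra.of k G (c : G)⁻¹ with ha
  have hbM : ∀ {M : ModuleCat.{0} (MonoidAlgebra k G)} (m : M),
      b • m = ∑ s : P, s • m := fun m => by
    rw [hb, Finset.sum_smul]; rfl
  have haM : ∀ {M : ModuleCat.{0} (MonoidAlgebra k G)} (m : M),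
      a • m = c • m - c⁻¹ • m := fun m => by
    rw [ha, sub_smul]; rfl
  have hb' : b = 1 + MonoidAlgebra.of k G c + MonoidAlgebra.of k G (c : G)⁻¹ := by
    rw [hb, hsum, Subgroup.coe_one, map_one]; rfl
  have hc' : (c : G) * c * c = 1 := congrArg Subtype.val hc
  have hcc : (c : G) * c = (c : G)⁻¹ := mul_eq_one_iff_eq_inv.1 hc'
  have hcc' : (c : G)⁻¹ * (c : G)⁻¹ = c := by rw [← mul_inv_rev, hcc, inv_inv]
  have hab : a * b = 0 := by
    rw [hb', ha]
    simp only [sub_mul, mul_add, ← map_mul, hcc, hcc', mul_one, mul_inv_cancel, inv_mul_cancel,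
      map_one]
    abel
  have hba : b * a = 0 := by
    rw [hb', ha]
    simp only [mul_sub, add_mul, ← map_mul, hcc, hcc', one_mul, mul_inv_cancel, inv_mul_cancel,
      map_one]
    abel
  have hfix : ∀ (M : ModuleCat.{0} (MonoidAlgebra k G)) (w : M),
      a • w = 0 → ∀ s ∈ P, s • w = w := fun M w hw s hs =>
    smul_eq_of_smul_sub_inv_smul hc hmem ((haM w).symm.trans hw) ⟨s, hs⟩
  have hpa : ∀ Q : ModuleCat.{0} (MonoidAlgebra k G), Projective Q → ∀ m : Q,
      a • m = 0 → ∃ n : Q, m = b • n := by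
    intro Q hQ m hm
    obtain ⟨φ, hφ⟩ := exists_tr_eq_of_projective (P : Subgroup G) hQ
    refine ⟨φ m, (hφ m).symm.trans ?_⟩
    rw [hbM, tr_apply]
    refine Finset.sum_congr rfl fun s _ => ?_
    congr 2
    exact hfix Q m hm _ (inv_mem s.2)
  have hpb : ∀ Q : ModuleCat.{0} (MonoidAlgebra k G), Projective Q → ∀ m : Q,
      b • m = 0 → ∃ n : Q, m = a • n := by
    intro Q hQ m hm
    obtain ⟨φ, hφ⟩ := exists_tr_eq_of_projective (P : Subgroup G) hQ
    obtain ⟨y, hy⟩ := exists_tr_eq_of_norm_eq_zero hc hsum φ ((hbM m).symm.trans hm)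
    exact ⟨y, (hφ m).symm.trans (hy.trans (haM y).symm)⟩
  have hn : ∀ n ∈ Subgroup.normalizer (P : Set G), ∃ ε : k, ε * ε = 1 ∧
      a * MonoidAlgebra.of k G n = ε • (MonoidAlgebra.of k G n * a) := by
    intro n hn
    have h3 := (Subgroup.mem_normalizer_iff''.1 hn c).1 c.2
    rcases hmem ⟨_, h3⟩ with h | h | h
    · refine absurd ?_ hc1
      have h4 : n⁻¹ * c * n = 1 := congrArg Subtype.val h
      have h5 : (c : G) = 1 := by
        rw [mul_assoc, inv_mul_eq_one] at h4
        exact (right_eq_mul.1 h4)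
      rw [show c = 1 from Subtype.ext h5, inv_one]
    · have h4 : n⁻¹ * c * n = c := congrArg Subtype.val h
      have h5 : (c : G) * n = n * c := by rwa [mul_assoc, inv_mul_eq_iff_eq_mul] at h4
      have h6 : (c : G)⁻¹ * n = n * (c : G)⁻¹ := by
        rw [inv_mul_eq_iff_eq_mul, ← mul_assoc, h5, mul_inv_cancel_right]
      refine ⟨1, one_mul 1, ?_⟩
      rw [one_smul, ha, sub_mul, mul_sub, ← map_mul, ← map_mul, ← map_mul, ← map_mul, h5, h6]
    · have h4 : n⁻¹ * c * n = (c : G)⁻¹ := congrArg Subtype.val h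
      have h5 : (c : G) * n = n * (c : G)⁻¹ := by rwa [mul_assoc, inv_mul_eq_iff_eq_mul] at h4
      have h6 : (c : G)⁻¹ * n = n * c := by
        rw [inv_mul_eq_iff_eq_mul, ← mul_assoc, h5, inv_mul_cancel_right]
      refine ⟨-1, by ring, ?_⟩
      rw [neg_one_smul, ha, sub_mul, mul_sub, ← map_mul, ← map_mul, ← map_mul, ← map_mul, h5, h6,
        neg_sub]
  have ha0 : a ≠ 0 := fun h =>
    hc1 (Subtype.ext (MonoidAlgebra.of_injective (sub_eq_zero.1 h)))
  have key := hf.map_kernels_of_sylow P (by rw [hP]; exact Nat.prime_three) hΩ hb ha0 hab hba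
    hpa hpb hfix hn hM
  refine StmodGH.rel_of_card_three hc hmem hsum ((toLin_eqv f).subgroup P) (fun z hz => ?_)
    (fun z hz => ?_)
  · obtain ⟨x, hx⟩ := key.1 z (by rw [haM, hz, hz, sub_self])
    exact ⟨x, by rw [toLin_apply, hx, hbM]⟩
  · obtain ⟨x, hx⟩ := key.2 z (by rw [hbM]; exact hz)
    exact ⟨x, by rw [toLin_apply, hx, haM]⟩

theorem gHolds_of_sylow {k G : Type} [Field k] [Group G] [Fintype G] {p : ℕ} [Fact p.Prime]
    [CharP k p] (P : Sylow p G) (hP : Nat.card P = 2 ∨ Nat.card P = 3) : GHolds k G := by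
  intro Ω hΩ M N hM _ f hf
  have hf' : Ghost Ω f := hf
  have hpP : p = Nat.card P := by
    obtain ⟨n, hn⟩ := P.2.exists_card_eq
    have hq : (Nat.card P).Prime := by
      rcases hP with h | h <;> rw [h]
      exacts [Nat.prime_two, Nat.prime_three]
    have : n ≠ 0 := fun h => by
      rw [h, pow_zero] at hn
      rw [hn] at hq
      exact Nat.not_prime_one hq
    exact (Nat.prime_dvd_prime_iff_eq Fact.out hq).1 (hn ▸ dvd_pow_self p this)
  rw [stablyZero_iff_rel]
  refine Rel.of_subgroup (P : Subgroup G) ?_ (toLin_eqv f) ?_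
  · rw [Ne, CharP.cast_eq_zero_iff k p]
    exact P.not_dvd_index
  · rcases hP with h | h
    · exact hf'.rel_of_card_two P (hpP.trans h) h hΩ hM
    · exact hf'.rel_of_card_three P (hpP.trans h) h hΩ hM

end SylowTwoThree

section SyzygyExistence

open scoped ModuleCat

variable {k G : Type} [Field k] [Group G] [Finite G]

theorem exists_finite_projective_hull (X : ModuleCat.{0} (MonoidAlgebra k G))
    [Module.Finite (MonoidAlgebra k G) X] :
    ∃ (F : ModuleCat.{0} (MonoidAlgebra k G)) (i : X ⟶ F), Projective F ∧
      Function.Injective i ∧ Module.Finite (MonoidAlgebra k G) F := by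
  let := Fintype.ofFinite G
  have : FiniteDimensional k X := finiteDimensional_of_finite
  let B := Module.finBasis k X
  let f : X →ₗ[MonoidAlgebra k G] (Fin (Module.finrank k X) → MonoidAlgebra k G) :=
    { toFun := fun x i => ∑ h : G, MonoidAlgebra.single h (B.coord i (h⁻¹ • x))
      map_add' := fun x y => by
        ext1 i
        simp only [smul_add, map_add, MonoidAlgebra.single_add, Finset.sum_add_distrib,
          Pi.add_apply]
      map_smul' := fun a x => by
        induction a using MonoidAlgebra.induction_linear with
        | zero => ext1 i; simp
        | add a b ha hb =>
          rw [RingHom.id_apply] at ha hb ⊢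
          rw [add_smul a b (_ : Fin _ → MonoidAlgebra k G), ← ha, ← hb]
          ext1 i
          simp only [add_smul, smul_add, map_add, MonoidAlgebra.single_add,
            Finset.sum_add_distrib, Pi.add_apply]
        | single g c =>
          ext1 i
          simp only [RingHom.id_apply, Pi.smul_apply, smul_eq_mul, Finset.mul_sum,
            MonoidAlgebra.single_mul_single, single_smul_eq]
          refine (Equiv.sum_comp (Equiv.mulLeft g) _).symm.trans ?_
          refine Finset.sum_congr rfl fun h _ => ?_
          simp only [Equiv.coe_mulLeft, mul_inv_rev]
          rw [smul_comm, map_smul, smul_smul, inv_mul_cancel_right, smul_eq_mul] }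
  refine ⟨ModuleCat.of _ (Fin (Module.finrank k X) → MonoidAlgebra k G), ModuleCat.ofHom f,
    (IsProjective.iff_projective _).1 inferInstance, ?_,
    inferInstanceAs (Module.Finite (MonoidAlgebra k G) (Fin _ → MonoidAlgebra k G))⟩
  change Function.Injective f
  rw [injective_iff_map_eq_zero]
  intro x hx
  refine B.ext_elem fun i => ?_
  classical
  have h1 : (f x i).coeff 1 = 0 := by rw [hx]; rfl
  have h2 : (f x i).coeff 1 = B.coord i x := by
    change (∑ h : G, MonoidAlgebra.single h (B.coord i (h⁻¹ • x)) : MonoidAlgebra k G).coeff 1 = _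
    rw [MonoidAlgebra.coeff_sum, Finsupp.finsetSum_apply, Finset.sum_eq_single 1]
    · simp
    · intro h _ hh
      simp [hh]
    · simp
  simpa using h2.symm.trans h1

theorem exists_syzygy (X : ModuleCat.{0} (MonoidAlgebra k G))
    [Module.Finite (MonoidAlgebra k G) X] :
    ∃ K : ModuleCat.{0} (MonoidAlgebra k G), Module.Finite (MonoidAlgebra k G) K ∧
      ∃ P : ModuleCat.{0} (MonoidAlgebra k G), Projective P ∧ Nonempty (SES K P X) := by
  obtain ⟨F, π, hF, hπ, hfin⟩ := exists_finite_projective_cover X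
  obtain ⟨K, s, -⟩ := exists_kernel_ses π hπ
  have := finiteDimensional_of_finite (k := k) (G := G) (M := F)
  have : FiniteDimensional k K := Module.Finite.of_injective (toLin s.i) s.inj
  exact ⟨K, finite_of_finiteDimensional, F, hF, ⟨s⟩⟩

theorem exists_cosyzygy (X : ModuleCat.{0} (MonoidAlgebra k G))
    [Module.Finite (MonoidAlgebra k G) X] :
    ∃ C : ModuleCat.{0} (MonoidAlgebra k G), Module.Finite (MonoidAlgebra k G) C ∧
      ∃ P : ModuleCat.{0} (MonoidAlgebra k G), Projective P ∧ Nonempty (SES X P C) := by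
  obtain ⟨F, i, hF, hi, hfin⟩ := exists_finite_projective_hull X
  obtain ⟨C, s, -⟩ := exists_cokernel_ses i hi
  exact ⟨C, Module.Finite.of_surjective s.p.hom s.surj, F, hF, ⟨s⟩⟩

theorem StablyZero.zero {R : Type} [Ring R] {M N : ModuleCat.{0} R} : StablyZero (0 : M ⟶ N) :=
  ⟨ModuleCat.of R PUnit, (IsProjective.iff_projective _).1 inferInstance, 0, 0, by simp⟩

theorem StablyIso.refl {R : Type} [Ring R] (M : ModuleCat.{0} R) : StablyIso M M :=
  ⟨𝟙 M, 𝟙 M, by simpa using StablyZero.zero, by simpa using StablyZero.zero⟩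

theorem exists_isSyzygyFamily (T : ModuleCat.{0} (MonoidAlgebra k G))
    [hT : Module.Finite (MonoidAlgebra k G) T] :
    ∃ Ω : ℤ → ModuleCat.{0} (MonoidAlgebra k G), IsSyzygyFamily T Ω ∧ Ω 0 = T := by
  let S := {M : ModuleCat.{0} (MonoidAlgebra k G) // Module.Finite (MonoidAlgebra k G) M}
  have hup : ∀ X : S, ∃ K : S, ∃ P : ModuleCat.{0} (MonoidAlgebra k G), Projective P ∧
      Nonempty (SES K.1 P X.1) := fun ⟨X, hX⟩ => by
    obtain ⟨K, hK, h⟩ := exists_syzygy X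
    exact ⟨⟨K, hK⟩, h⟩
  have hdown : ∀ X : S, ∃ K : S, ∃ P : ModuleCat.{0} (MonoidAlgebra k G), Projective P ∧
      Nonempty (SES X.1 P K.1) := fun ⟨X, hX⟩ => by
    obtain ⟨K, hK, h⟩ := exists_cosyzygy X
    exact ⟨⟨K, hK⟩, h⟩
  choose up hup using hup
  choose down hdown using hdown
  let Ω : ℤ → S := fun i => match i with
    | Int.ofNat n => up^[n] ⟨T, hT⟩
    | Int.negSucc n => down^[n + 1] ⟨T, hT⟩
  refine ⟨fun i => (Ω i).1, ⟨fun i => (Ω i).2, StablyIso.refl T, fun i => ?_⟩, rfl⟩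
  match i with
  | Int.ofNat n =>
    have h1 : Ω (Int.ofNat n + 1) = up (Ω (Int.ofNat n)) := Function.iterate_succ_apply' up n _
    beta_reduce
    rw [h1]
    exact hup _
  | Int.negSucc 0 => exact hdown _
  | Int.negSucc (n + 1) =>
    have h1 : Ω (Int.negSucc (n + 1)) = down (Ω (Int.negSucc n)) :=
      Function.iterate_succ_apply' down (n + 1) _
    have h2 : Int.negSucc (n + 1) + 1 = Int.negSucc n := by omega
    beta_reduce
    rw [h1, h2]
    exact hdown _

omit [Finite G] in
theorem finite_triv : Module.Finite (MonoidAlgebra k G) (triv k G) := by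
  obtain ⟨⟨e⟩, -⟩ := exists_triv_equiv (k := k) (G := G)
  have : FiniteDimensional k (triv k G) := Module.Finite.equiv e.symm
  exact finite_of_finiteDimensional

end SyzygyExistence

section TraceDuality

variable {k : Type} [Field k] {X Y : Type} [AddCommGroup X] [Module k X] [AddCommGroup Y]
  [Module k Y]

theorem eq_zero_of_trace_comp_eq_zero [FiniteDimensional k X] (h : Y →ₗ[k] X)
    (H : ∀ φ : X →ₗ[k] Y, LinearMap.trace k X (h ∘ₗ φ) = 0) : h = 0 := by
  ext y
  rw [LinearMap.zero_apply, ← Module.forall_dual_apply_eq_zero_iff k]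
  intro ξ
  have := H (ξ.smulRight y)
  rwa [show h ∘ₗ ξ.smulRight y = ξ.smulRight (h y) from LinearMap.ext fun x => by simp,
    LinearMap.trace_smulRight] at this

theorem exists_eq_trace_comp [FiniteDimensional k X] [FiniteDimensional k Y]
    (μ : Module.Dual k (X →ₗ[k] Y)) :
    ∃ h : Y →ₗ[k] X, ∀ φ, μ φ = LinearMap.trace k X (h ∘ₗ φ) := by
  let T : (Y →ₗ[k] X) →ₗ[k] Module.Dual k (X →ₗ[k] Y) :=
    (LinearMap.llcomp k X Y X).compr₂ (LinearMap.trace k X)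
  have hT : Function.Injective T := by
    rw [injective_iff_map_eq_zero]
    exact fun h hh => eq_zero_of_trace_comp_eq_zero h fun φ => LinearMap.congr_fun hh φ
  obtain ⟨h, rfl⟩ := (LinearMap.injective_iff_surjective_of_finrank_eq_finrank (by
    rw [Subspace.dual_finrank_eq, Module.finrank_linearMap, Module.finrank_linearMap,
      mul_comm])).1 hT μ
  exact ⟨h, fun φ => rfl⟩

variable {Γ : Type} [Group Γ] [DistribMulAction Γ X] [SMulCommClass Γ k X]
  [DistribMulAction Γ Y] [SMulCommClass Γ k Y]

/-- Conjugation of a linear map by a group element. -/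
def conj (s : Γ) : (X →ₗ[k] Y) →ₗ[k] (X →ₗ[k] Y) :=
  (LinearMap.lcomp k Y (DistribSMul.toLinearMap k X s⁻¹)) ∘ₗ
    (LinearMap.llcomp k X Y Y (DistribSMul.toLinearMap k Y s))

@[simp] theorem conj_apply (s : Γ) (φ : X →ₗ[k] Y) (x : X) : conj s φ x = s • φ (s⁻¹ • x) := rfl

theorem trace_comp_conj (s : Γ) (f : Y →ₗ[k] X) (φ : X →ₗ[k] Y) :
    LinearMap.trace k X (f ∘ₗ conj s φ) = LinearMap.trace k X (conj s⁻¹ f ∘ₗ φ) := by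
  have h1 : f ∘ₗ conj s φ = (f ∘ₗ DistribSMul.toLinearMap k Y s ∘ₗ φ) *
    DistribSMul.toLinearMap k X s⁻¹ := rfl
  have h2 : conj s⁻¹ f ∘ₗ φ = DistribSMul.toLinearMap k X s⁻¹ *
      (f ∘ₗ DistribSMul.toLinearMap k Y s ∘ₗ φ) := by
    ext x; simp
  rw [h1, h2, LinearMap.trace_mul_comm]

theorem tr_eq_sum_conj [Fintype Γ] (φ : X →ₗ[k] Y) : tr Γ φ = ∑ s : Γ, conj s φ := by
  ext x
  simp [tr_apply]

theorem trace_comp_tr [Finite Γ] (f : Y →ₗ[k] X) (φ : X →ₗ[k] Y) :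
    LinearMap.trace k X (f ∘ₗ tr Γ φ) = LinearMap.trace k X (tr Γ f ∘ₗ φ) := by
  let := Fintype.ofFinite Γ
  have h1 : f ∘ₗ ∑ s : Γ, conj s φ = ∑ s : Γ, f ∘ₗ conj s φ := LinearMap.ext fun x => by
    simp [LinearMap.sum_apply]
  have h2 : (∑ s : Γ, conj s f) ∘ₗ φ = ∑ s : Γ, conj s f ∘ₗ φ := LinearMap.ext fun x => by
    simp [LinearMap.sum_apply]
  rw [tr_eq_sum_conj, tr_eq_sum_conj, h1, h2, map_sum, map_sum,
    ← Equiv.sum_comp (Equiv.inv Γ) fun s => LinearMap.trace k X (conj s f ∘ₗ φ)]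
  exact Finset.sum_congr rfl fun s _ => trace_comp_conj s f φ

variable (Γ) in
theorem mem_span_conj_sub [FiniteDimensional k X] [FiniteDimensional k Y] (u : X →ₗ[k] Y)
    (hu : ∀ h : Y →ₗ[k] X, Eqv Γ h → LinearMap.trace k X (h ∘ₗ u) = 0) :
    u ∈ Submodule.span k (Set.range fun a : Γ × (X →ₗ[k] Y) => conj a.1 a.2 - a.2) := by
  by_contra hu'
  obtain ⟨μ, hμ, hμ'⟩ := Submodule.exists_le_ker_of_notMem hu'
  obtain ⟨h, hh⟩ := exists_eq_trace_comp μ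
  refine hμ ((hh u).trans (hu h fun s y => ?_))
  have h1 : conj s⁻¹ h - h = 0 := eq_zero_of_trace_comp_eq_zero _ fun φ => by
    rw [LinearMap.sub_comp, map_sub, ← trace_comp_conj, ← map_sub, ← LinearMap.comp_sub, ← hh]
    exact hμ' (Submodule.subset_span ⟨(s, φ), rfl⟩)
  have h2 := LinearMap.congr_fun h1 y
  rw [LinearMap.sub_apply, LinearMap.zero_apply, conj_apply, inv_inv, sub_eq_zero,
    inv_smul_eq_iff] at h2
  exact h2

theorem tr_comp_conj [Finite Γ] {Z : Type} [AddCommGroup Z] [Module k Z] [DistribMulAction Γ Z]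
    [SMulCommClass Γ k Z] (s : Γ) (σ : Y →ₗ[k] Z) (ξ : X →ₗ[k] Y) :
    tr Γ (σ ∘ₗ conj s ξ) = tr Γ (conj s⁻¹ σ ∘ₗ ξ) := by
  let := Fintype.ofFinite Γ
  ext x
  rw [tr_apply, tr_apply, ← Equiv.sum_comp (Equiv.mulRight s⁻¹) fun t : Γ => t •
    (σ ∘ₗ conj s ξ) (t⁻¹ • x)]
  refine Finset.sum_congr rfl fun t _ => ?_
  simp [mul_smul]

end TraceDuality

section Generation

open scoped ModuleCat

variable {k G : Type} [Field k] [Group G] [Fintype G]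

/-- The endomorphisms of `M` that are sums of maps factoring through the members of `Ω` and of
traces. -/
noncomputable def factorSpan (Ω : ℤ → ModuleCat.{0} (MonoidAlgebra k G)) (M : ModuleCat.{0} (MonoidAlgebra k G)) :
    Submodule k (M →ₗ[k] M) :=
  Submodule.span k ({f | ∃ (i : ℤ) (h : M ⟶ Ω i) (g : Ω i ⟶ M), f = toLin g ∘ₗ toLin h} ∪
    {f | Rel G f})

theorem GHolds.id_mem_factorSpan (hG : GHolds k G) {Ω : ℤ → ModuleCat.{0} (MonoidAlgebra k G)}
    (hΩ : IsSyzygyFamily (triv k G) Ω) {M : ModuleCat.{0} (MonoidAlgebra k G)}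
    [Module.Finite (MonoidAlgebra k G) M] (hM : InThick (triv k G) M) :
    LinearMap.id ∈ factorSpan Ω M := by
  by_contra hid
  obtain ⟨μ, hμ, hμ'⟩ := Submodule.exists_le_ker_of_notMem hid
  have hMf : FiniteDimensional k M := finiteDimensional_of_finite
  obtain ⟨ψ, hψ⟩ := exists_eq_trace_comp μ
  have hψ0 : tr G ψ = 0 := eq_zero_of_trace_comp_eq_zero _ fun φ => by
    rw [← trace_comp_tr, ← hψ]
    exact hμ' (Submodule.subset_span (Or.inr ⟨φ, rfl⟩))
  obtain ⟨Q, π, hQ, hπ⟩ := exists_projective_cover M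
  obtain ⟨M₁, s, rfl⟩ := exists_kernel_ses π hπ
  have hs := s.shortEx
  obtain ⟨σ, hσ⟩ := hs.exists_section
  obtain ⟨f, hf, hfe⟩ := hs.exists_factor_ker (tr G (σ ∘ₗ ψ)) (by
    rw [comp_tr hs.eqv_p, ← LinearMap.comp_assoc, hσ, LinearMap.id_comp, hψ0])
  have hfe := hfe (tr_eqv _)
  have hstab : StablyZero (homOfEqv f hfe) := by
    refine hG Ω hΩ M M₁ hM (.ext₃ s (.proj Q hQ) hM) _ fun i g => ?_
    have : Module.Finite (MonoidAlgebra k G) (Ω i) := hΩ.1 i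
    have : FiniteDimensional k (Ω i) := finiteDimensional_of_finite
    rw [stablyZero_iff_rel, toLin_comp, toLin_homOfEqv]
    have hu := mem_span_conj_sub G (ψ ∘ₗ toLin g) fun h hh => by
      have h1 : μ (toLin g ∘ₗ h) = 0 :=
        hμ' (Submodule.subset_span (Or.inl ⟨i, homOfEqv h hh, g, rfl⟩))
      rw [hψ, ← LinearMap.comp_assoc, LinearMap.trace_comp_comm'] at h1
      exact h1
    have key : ∀ u ∈ Submodule.span k
        (Set.range fun a : G × (Ω i →ₗ[k] M) => conj a.1 a.2 - a.2),
        ∃ θ : Ω i →ₗ[k] M₁, tr G (σ ∘ₗ u) = toLin s.i ∘ₗ tr G θ := by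
      intro u hu
      induction hu using Submodule.span_induction with
      | mem u hu =>
        obtain ⟨⟨t, ξ⟩, rfl⟩ := hu
        obtain ⟨θ, hθ, -⟩ := hs.exists_factor_ker ((conj t⁻¹ σ - σ) ∘ₗ ξ) (by
          ext x
          have h1 : ∀ y, s.p (σ y) = y := LinearMap.congr_fun hσ
          have h2 : ∀ (t : G) y, s.p (t • y) = t • s.p y := toLin_eqv s.p
          simp [h1, h2])
        refine ⟨θ, ?_⟩
        rw [LinearMap.comp_sub, map_sub, tr_comp_conj, ← map_sub, ← LinearMap.sub_comp, ← hθ,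
          comp_tr hs.eqv_i]
      | zero => exact ⟨0, by simp⟩
      | add u v _ _ hu hv =>
        obtain ⟨θ, hθ⟩ := hu
        obtain ⟨θ', hθ'⟩ := hv
        exact ⟨θ + θ', by rw [LinearMap.comp_add, map_add, hθ, hθ', map_add, LinearMap.comp_add]⟩
      | smul c u _ hu =>
        obtain ⟨θ, hθ⟩ := hu
        exact ⟨c • θ, by rw [LinearMap.comp_smul, map_smul, hθ, map_smul, LinearMap.comp_smul]⟩
    obtain ⟨θ, hθ⟩ := key _ hu
    refine ⟨θ, LinearMap.ext fun x => hs.inj ?_⟩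
    have h1 := LinearMap.congr_fun hθ x
    rw [← LinearMap.comp_assoc, ← tr_comp (toLin_eqv g), ← hf] at h1
    exact h1.symm
  obtain ⟨χ, hχ⟩ := (stablyZero_iff_rel _).1 hstab
  rw [toLin_homOfEqv] at hχ
  let ω := σ ∘ₗ ψ - toLin s.i ∘ₗ χ
  have hω : tr G ω = 0 := by
    rw [map_sub, ← hf, ← hχ, comp_tr hs.eqv_i, sub_self]
  have hpω : toLin s.p ∘ₗ ω = ψ := by
    rw [LinearMap.comp_sub, ← LinearMap.comp_assoc, hσ, LinearMap.id_comp,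
      show toLin s.p ∘ₗ toLin s.i ∘ₗ χ = 0 from LinearMap.ext fun x => hs.p_i _, sub_zero]
  obtain ⟨Φ, hΦ⟩ := rel_id_of_projective hQ
  refine hμ ?_
  rw [hψ, LinearMap.comp_id, ← hpω, ← LinearMap.comp_id (toLin s.p), ← hΦ, comp_tr hs.eqv_p,
    ← trace_comp_tr, hω, LinearMap.comp_zero, map_zero]

end Generation

section FixedVectors

variable {k : Type} [Field k] {Γ : Type} [Group Γ] [Finite Γ] {p : ℕ} [Fact p.Prime] [CharP k p]

theorem exists_fixed_vector (hΓ : IsPGroup p Γ) {V : Type} [AddCommGroup V] [Module k V]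
    (ρ : Γ →* (V →ₗ[k] V)) (U : Submodule k V) (hU : ∀ s, ∀ u ∈ U, ρ s u ∈ U) (hne : U ≠ ⊥) :
    ∃ u ∈ U, u ≠ 0 ∧ ∀ s, ρ s u = u := by
  obtain ⟨v, hvU, hv⟩ := U.ne_bot_iff.1 hne
  have hp : ∀ x : V, p • x = 0 := fun x => by
    rw [← Nat.cast_smul_eq_nsmul k, CharP.cast_eq_zero, zero_smul]
  have : Module (ZMod p) V := AddCommGroup.zmodModule hp
  let S : Submodule (ZMod p) V := Submodule.span (ZMod p) (Set.range fun s : Γ => ρ s v)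
  have hvS : v ∈ S := by
    refine Submodule.subset_span (Set.mem_range.2 ⟨1, ?_⟩)
    rw [map_one]; rfl
  have hSfin : Module.Finite (ZMod p) S := Module.Finite.span_of_finite _ (Set.finite_range _)
  have hSfin : Finite S := Module.finite_of_finite (ZMod p)
  have hSU : ∀ x ∈ S, x ∈ U := fun x hx => by
    induction hx using Submodule.span_induction with
    | mem x hx => obtain ⟨s, rfl⟩ := hx; exact hU s v hvU
    | zero => exact U.zero_mem
    | add x y _ _ hx hy => exact U.add_mem hx hy
    | smul c x _ hx =>
      obtain ⟨n, rfl⟩ := ZMod.natCast_zmod_surjective c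
      rw [Nat.cast_smul_eq_nsmul]; exact U.nsmul_mem hx n
  have hS : ∀ (s : Γ), ∀ x ∈ S, ρ s x ∈ S := fun s x hx => by
    induction hx using Submodule.span_induction with
    | mem x hx =>
      obtain ⟨t, rfl⟩ := hx
      exact Submodule.subset_span (Set.mem_range.2 ⟨s * t, by simp⟩)
    | zero => simp
    | add x y _ _ hx hy => rw [map_add]; exact S.add_mem hx hy
    | smul c x _ hx =>
      obtain ⟨n, rfl⟩ := ZMod.natCast_zmod_surjective c
      rw [Nat.cast_smul_eq_nsmul, map_nsmul]; exact S.nsmul_mem hx n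
  let : MulAction Γ S :=
    { smul := fun s x => ⟨ρ s x, hS s x x.2⟩
      one_smul := fun x => Subtype.ext (by change ρ 1 (x : V) = x; simp)
      mul_smul := fun s t x => Subtype.ext (by
        change ρ (s * t) (x : V) = ρ s (ρ t x); simp) }
  have hcard : p ∣ Nat.card S := by
    have h1 : addOrderOf (⟨v, hvS⟩ : S) = p :=
      addOrderOf_eq_prime (Subtype.ext (hp v)) fun h => hv (congrArg Subtype.val h)
    exact h1.symm.dvd.trans (addOrderOf_dvd_natCard _)
  obtain ⟨b, hb, hb0⟩ := hΓ.exists_fixed_point_of_prime_dvd_card_of_fixed_point S hcard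
    (a := 0) (fun s => Subtype.ext (by change ρ s 0 = 0; simp))
  exact ⟨b, hSU b b.2, fun h => hb0 (Subtype.ext h.symm), fun s => congrArg Subtype.val (hb s)⟩

theorem ker_eq_bot_of_fixed (hΓ : IsPGroup p Γ) {V W : Type} [AddCommGroup V] [Module k V]
    [AddCommGroup W] [Module k W] (ρ : Γ →* (V →ₗ[k] V)) (f : V →ₗ[k] W)
    (hf : ∀ s v, f v = 0 → f (ρ s v) = 0) (h : ∀ v, (∀ s, ρ s v = v) → f v = 0 → v = 0) :
    Function.Injective f := by
  rw [← LinearMap.ker_eq_bot]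
  by_contra hne
  obtain ⟨u, hu, hu0, hfix⟩ := exists_fixed_vector hΓ ρ f.ker hf hne
  exact hu0 (h u hfix hu)

variable {V : Type} [AddCommGroup V] [Module k V] [DistribMulAction Γ V] [SMulCommClass Γ k V]
  [FiniteDimensional k V]

theorem card_dvd_finrank_of_rel_id (hΓ : IsPGroup p Γ)
    (hV : Rel Γ (LinearMap.id : V →ₗ[k] V)) : Nat.card Γ ∣ Module.finrank k V := by
  let := Fintype.ofFinite Γ
  obtain ⟨Φ, hΦ⟩ := hV
  let W := fixedSub k Γ V
  obtain ⟨ρ, hρ⟩ := W.subtype.exists_leftInverse_of_injective W.ker_subtype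
  have hN : ∀ w : W, ∑ s : Γ, s • Φ w = w := fun w => by
    have h1 := LinearMap.congr_fun hΦ (w : V)
    rw [tr_apply] at h1
    simpa [w.2 _] using h1
  let Ψ : (Γ → W) →ₗ[k] V := ∑ s : Γ, DistribSMul.toLinearMap k V s ∘ₗ Φ ∘ₗ W.subtype ∘ₗ
    LinearMap.proj s
  have hΨ : ∀ F : Γ → W, Ψ F = ∑ s : Γ, s • Φ (F s) := fun F => by
    simp [Ψ, LinearMap.sum_apply]
  let tau : Γ →* ((Γ → W) →ₗ[k] (Γ → W)) :=
    { toFun := fun s => LinearMap.funLeft k W (s⁻¹ * ·)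
      map_one' := by ext; simp [LinearMap.funLeft]
      map_mul' := fun s t => by
        ext F x
        simp [LinearMap.funLeft, mul_assoc] }
  have htau : ∀ s F x, tau s F x = F (s⁻¹ * x) := fun s F x => rfl
  have h1 : Function.Injective Ψ := by
    refine ker_eq_bot_of_fixed hΓ tau Ψ (fun s F hF => ?_) fun F hF h0 => ?_
    · have : Ψ (tau s F) = s • Ψ F := by
        rw [hΨ, hΨ, ← Equiv.sum_comp (Equiv.mulLeft s) fun t => t • Φ (tau s F t),
          Finset.smul_sum]
        simp [htau, mul_smul]
      rw [this, hF, smul_zero]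
    · have hc : ∀ s, F s = F 1 := fun s => by
        have := congrFun (hF s⁻¹) 1
        rw [htau] at this
        simpa using this
      rw [hΨ] at h0
      simp only [hc] at h0
      rw [hN] at h0
      ext s
      rw [hc, h0]; rfl
  let Θ : V →ₗ[k] (Γ → W) := LinearMap.pi fun s => ρ ∘ₗ DistribSMul.toLinearMap k V s
  have hΘ : ∀ v s, Θ v s = ρ (s • v) := fun v s => rfl
  have h2 : Function.Injective Θ := by
    refine ker_eq_bot_of_fixed hΓ (Representation.ofDistribMulAction k Γ V) Θ
      (fun s v hv => ?_) fun v hv h0 => ?_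
    · ext t
      have := congrFun hv (t * s)
      rw [hΘ] at this ⊢
      rw [Representation.ofDistribMulAction_apply_apply, smul_smul, this]; rfl
    · have h3 := congrFun h0 1
      rw [hΘ, one_smul] at h3
      have h4 : ρ v = (⟨v, hv⟩ : W) := LinearMap.congr_fun hρ (⟨v, hv⟩ : W)
      rw [h4] at h3
      exact congrArg Subtype.val h3
  have h3 := LinearMap.finrank_le_finrank_of_injective h1
  have h4 := LinearMap.finrank_le_finrank_of_injective h2
  rw [← le_antisymm h3 h4, Module.finrank_pi_fintype, Finset.sum_const, Finset.card_univ,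
    Nat.card_eq_fintype_card, smul_eq_mul]
  exact dvd_mul_right _ _

/-- Idempotents that are traces have rank divisible by the order of the `p`-group. -/
theorem card_dvd_finrank_range_of_rel (hΓ : IsPGroup p Γ) {e : V →ₗ[k] V} (he : e ∘ₗ e = e)
    (h : Rel Γ e) : Nat.card Γ ∣ Module.finrank k (LinearMap.range e) := by
  have hee := h.eqv
  let act : DistribMulAction Γ (LinearMap.range e) :=
    { smul := fun s x => ⟨s • (x : V), by
        obtain ⟨_, ⟨y, rfl⟩⟩ := x
        exact ⟨s • y, hee s y⟩⟩
      one_smul := fun x => Subtype.ext (one_smul Γ (x : V))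
      mul_smul := fun s t x => Subtype.ext (mul_smul s t (x : V))
      smul_zero := fun s => Subtype.ext (smul_zero (A := V) s)
      smul_add := fun s x y => Subtype.ext (smul_add s (x : V) (y : V)) }
  have hact : ∀ (s : Γ) (x : LinearMap.range e), ((s • x : LinearMap.range e) : V) = s • (x : V) :=
    fun s x => rfl
  have : SMulCommClass Γ k (LinearMap.range e) := ⟨fun s c x => Subtype.ext (by
    rw [hact, Submodule.coe_smul, Submodule.coe_smul, hact, smul_comm])⟩
  refine card_dvd_finrank_of_rel_id hΓ ?_
  have h1 : Eqv Γ e.rangeRestrict := fun s x => Subtype.ext (hee s x)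
  have h2 : Eqv Γ (LinearMap.range e).subtype := fun s x => rfl
  have h3 : e.rangeRestrict ∘ₗ (e ∘ₗ (LinearMap.range e).subtype) = LinearMap.id := by
    ext ⟨_, ⟨y, rfl⟩⟩
    have := LinearMap.congr_fun he
    simp only [LinearMap.comp_apply] at this
    simp [this]
  rw [← h3]
  exact (h.comp_right h2).comp_left h1

end FixedVectors

section Fitting

set_option linter.unusedSectionVars false

variable {k : Type} [Field k] {Γ : Type} [Group Γ] [Finite Γ]
variable {X Y : Type} [AddCommGroup X] [Module k X] [DistribMulAction Γ X] [SMulCommClass Γ k X]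
  [AddCommGroup Y] [Module k Y] [DistribMulAction Γ Y] [SMulCommClass Γ k Y]

theorem Eqv.aeval {θ : X →ₗ[k] X} (hθ : Eqv Γ θ) (f : Polynomial k) :
    Eqv Γ (Polynomial.aeval θ f : X →ₗ[k] X) := by
  induction f using Polynomial.induction_on' with
  | add f g hf hg => rw [map_add]; exact hf.add hg
  | monomial n a =>
    rw [Polynomial.aeval_monomial]
    exact fun s x => by
      rw [Module.End.mul_apply, hθ.pow n, Module.End.mul_apply, Module.algebraMap_end_apply,
        Module.algebraMap_end_apply,
        smul_comm s a]

/-- The Fitting idempotents of an equivariant endomorphism. -/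
theorem exists_fitting [FiniteDimensional k X] {θ : X →ₗ[k] X} (hθ : Eqv Γ θ) :
    ∃ e e' φ : X →ₗ[k] X, Eqv Γ e ∧ Eqv Γ e' ∧ Eqv Γ φ ∧ e + e' = LinearMap.id ∧ e ∘ₗ e = e ∧
      e' ∘ₗ e' = e' ∧ e' ∘ₗ e = 0 ∧ e = θ ∘ₗ φ ∧ (e = 0 → IsNilpotent (θ : Module.End k X)) := by
  have hθi : IsIntegral k (θ : Module.End k X) := Algebra.IsIntegral.isIntegral _
  obtain ⟨n, m, hm, hmin⟩ : ∃ (n : ℕ) (m : Polynomial k), IsCoprime (Polynomial.X ^ (n + 1)) m ∧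
      minpoly k (θ : Module.End k X) = Polynomial.X ^ n * m := by
    obtain ⟨m, hm, hm'⟩ := Polynomial.exists_eq_pow_rootMultiplicity_mul_and_not_dvd _
      (minpoly.ne_zero hθi) 0
    rw [Polynomial.C_0, sub_zero] at hm hm'
    exact ⟨_, m, ((Polynomial.irreducible_X.coprime_iff_not_dvd).2 hm').pow_left, hm⟩
  obtain ⟨u, v, huv⟩ := hm
  let T : Polynomial k →ₐ[k] Module.End k X := Polynomial.aeval (θ : Module.End k X)
  have hT : T (Polynomial.X ^ n * m) = 0 := by rw [← hmin]; exact minpoly.aeval _ _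
  have hTX : T Polynomial.X = θ := Polynomial.aeval_X _
  have hsum : T (u * Polynomial.X ^ (n + 1)) + T (v * m) = 1 := by rw [← map_add, huv, map_one]
  have h0 : T (v * m) * T (u * Polynomial.X ^ (n + 1)) = 0 := by
    rw [← map_mul, show v * m * (u * Polynomial.X ^ (n + 1)) =
      v * u * Polynomial.X * (Polynomial.X ^ n * m) by ring, map_mul, hT, mul_zero]
  have h0' : T (u * Polynomial.X ^ (n + 1)) * T (v * m) = 0 := by
    rw [← map_mul, mul_comm, map_mul, h0]
  refine ⟨T (u * Polynomial.X ^ (n + 1)), T (v * m), T (u * Polynomial.X ^ n), hθ.aeval _, hθ.aeval _,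
    hθ.aeval _, hsum, ?_, ?_, h0, ?_, fun he => ⟨n, ?_⟩⟩
  · have := congrArg (T (u * Polynomial.X ^ (n + 1)) * ·) hsum
    simp only [mul_add, h0', add_zero, mul_one] at this
    exact this
  · have := congrArg (T (v * m) * ·) hsum
    simp only [mul_add, h0, zero_add, mul_one] at this
    exact this
  · change _ = θ * _
    rw [← hTX, ← map_mul]
    congr 1
    ring
  · rw [he, zero_add] at hsum
    have h1 : T (Polynomial.X ^ n * m) * T v = θ ^ n := by
      rw [← hTX, ← map_pow, ← mul_one (T (Polynomial.X ^ n)), ← hsum, ← map_mul, ← map_mul]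
      congr 1
      ring
    rw [← h1, hT, zero_mul]

variable {p : ℕ} [Fact p.Prime] [CharP k p]

theorem eq_zero_of_finrank_range_eq_zero [FiniteDimensional k X] {e : X →ₗ[k] X}
    (h : Module.finrank k (LinearMap.range e) = 0) : e = 0 := by
  rw [Submodule.finrank_eq_zero] at h
  exact LinearMap.range_eq_bot.1 h

theorem Rel.isNilpotent (hΓ : IsPGroup p Γ) [FiniteDimensional k X] {θ : X →ₗ[k] X}
    (hθ : Rel Γ θ) (hX : Module.finrank k X < Nat.card Γ) :
    IsNilpotent (θ : Module.End k X) := by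
  obtain ⟨e, e', φ, he, he', hφ, -, hee, -, -, heq, hnil⟩ := exists_fitting hθ.eqv
  refine hnil (eq_zero_of_finrank_range_eq_zero ?_)
  exact Nat.eq_zero_of_dvd_of_lt
    (card_dvd_finrank_range_of_rel hΓ hee (heq ▸ hθ.comp_right hφ))
    ((Submodule.finrank_le _).trans_lt hX)

variable (k Γ X) in
/-- Every equivariant endomorphism of `X` is stably a scalar. -/
def StablyScalar : Prop :=
  ∀ θ : X →ₗ[k] X, Eqv Γ θ → ∃ c : k, Rel Γ (θ - c • LinearMap.id)

variable (k Γ X) in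
/-- The trivial representation is a stably invertible direct summand of `X`. -/
def StablyTriv : Prop :=
  ∃ (α : X →ₗ[k] k) (w : X), (∀ (s : Γ) x, α (s • x) = α x) ∧ (∀ s : Γ, s • w = w) ∧ α w = 1 ∧
    Rel Γ (LinearMap.id - α.smulRight w)

variable (k Γ X) in
/-- The dimension of `X` is `1` or `-1` modulo the order of `Γ`. -/
def EndotrivialRank : Prop :=
  (Nat.card Γ : ℤ) ∣ Module.finrank k X - 1 ∨ (Nat.card Γ : ℤ) ∣ Module.finrank k X + 1

theorem stablyTriv_of_not_isNilpotent (hΓ : IsPGroup p Γ) [FiniteDimensional k X]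
    [FiniteDimensional k Y] (hs : StablyScalar k Γ X) (hr : EndotrivialRank k Γ X)
    {a : Y →ₗ[k] X} {b : X →ₗ[k] Y} (ha : Eqv Γ a) (hb : Eqv Γ b)
    (hY : Module.finrank k Y + 2 ≤ Nat.card Γ)
    (h : ¬ IsNilpotent (b ∘ₗ a : Module.End k Y)) : StablyTriv k Γ X := by
  obtain ⟨e, e', φ, he, he', hφ, hsum, hee, hee', he'e, heq, hnil⟩ := exists_fitting (ha.comp hb)
  have he0 : e ≠ 0 := fun h0 => by
    obtain ⟨n, hn⟩ := hnil h0
    refine h ⟨n + 1, ?_⟩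
    have key : ∀ n : ℕ, ∀ y, (b ∘ₗ a : Module.End k Y) ^ (n + 1) • y =
        b (((a ∘ₗ b : Module.End k X) ^ n) (a y)) := by
      intro n
      induction n with
      | zero => intro y; simp
      | succ n ih =>
        intro y
        rw [pow_succ, mul_smul, ih, pow_succ]
        rfl
    ext y
    have := key n y
    rw [hn] at this
    simpa using this
  have hrank : Module.finrank k (LinearMap.range e) ≤ Module.finrank k Y := by
    rw [heq, LinearMap.comp_assoc]
    exact ((Submodule.finrank_mono (LinearMap.range_comp_le_range _ _))).trans
      (LinearMap.finrank_range_le a)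
  have hrank0 : Module.finrank k (LinearMap.range e) ≠ 0 := fun h0 =>
    he0 (eq_zero_of_finrank_range_eq_zero h0)
  obtain ⟨c, hc⟩ := hs e he
  have hc0 : c ≠ 0 := by
    rintro rfl
    rw [zero_smul, sub_zero] at hc
    exact hrank0 (Nat.eq_zero_of_dvd_of_lt (card_dvd_finrank_range_of_rel hΓ hee hc) (by omega))
  have hrel : Rel Γ e' := by
    have h1 := (hc.comp_left he').smul (-c⁻¹)
    rwa [LinearMap.comp_sub, he'e, zero_sub, LinearMap.comp_smul, LinearMap.comp_id, smul_neg,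
      neg_smul, neg_neg, smul_smul, inv_mul_cancel₀ hc0, one_smul] at h1
  have hdvd := card_dvd_finrank_range_of_rel hΓ hee' hrel
  have hker : LinearMap.range e = LinearMap.ker e' := by
    ext x
    constructor
    · rintro ⟨y, rfl⟩
      exact LinearMap.congr_fun he'e y
    · intro hx
      have h1 := LinearMap.congr_fun hsum x
      rw [LinearMap.add_apply, LinearMap.mem_ker.1 hx, add_zero] at h1
      exact ⟨x, h1⟩
  have hdim := LinearMap.finrank_range_add_finrank_ker e'
  rw [← hker] at hdim
  have hone : Module.finrank k (LinearMap.range e) = 1 := by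
    have hq : 2 ≤ Nat.card Γ := by omega
    generalize Module.finrank k (LinearMap.range e) = r at *
    unfold EndotrivialRank at hr
    rw [← hdim] at hr
    obtain ⟨d, hd⟩ := hdvd
    have hd' : (Nat.card Γ : ℤ) ∣ (Module.finrank k (LinearMap.range e') : ℤ) :=
      ⟨d, by exact_mod_cast hd⟩
    rcases hr with hr | hr
    · have h1 := (Int.dvd_add_right hd').1 (by
        rwa [Nat.cast_add, add_sub_assoc] at hr)
      have h2 : ((r : ℤ) - 1) = 0 := Int.eq_zero_of_dvd_of_nonneg_of_lt (by omega) (by omega) h1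
      omega
    · have h1 := (Int.dvd_add_right hd').1 (by
        rwa [Nat.cast_add, add_assoc] at hr)
      have h2 : ((r : ℤ) + 1) = 0 := Int.eq_zero_of_dvd_of_nonneg_of_lt (by omega) (by omega) h1
      omega
  obtain ⟨w, hw, hw0, hfix⟩ := exists_fixed_vector hΓ (Representation.ofDistribMulAction k Γ X)
    (LinearMap.range e) (by rintro s _ ⟨y, rfl⟩; exact ⟨s • y, he s y⟩)
    (fun h0 => hrank0 (by rw [h0, finrank_bot]))
  have hfix' : ∀ s : Γ, s • w = w := hfix
  have hew : e w = w := by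
    obtain ⟨y, rfl⟩ := hw
    exact LinearMap.congr_fun hee y
  have hspan : ∀ x, ∃ c : k, c • w = e x := fun x => by
    obtain ⟨c, hc⟩ := (finrank_eq_one_iff_of_nonzero' (⟨w, hw⟩ : LinearMap.range e)
      (fun h0 => hw0 (congrArg Subtype.val h0))).1 hone ⟨e x, x, rfl⟩
    exact ⟨c, congrArg Subtype.val hc⟩
  obtain ⟨α, hα⟩ := exists_comp_eq_of_forall_exists (LinearMap.toSpanSingleton k X w) e hspan
  have hα' : ∀ x, α x • w = e x := hα
  have hinj : ∀ c d : k, c • w = d • w → c = d := fun c d hcd => smul_left_injective k hw0 hcd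
  refine ⟨α, w, fun s x => hinj _ _ ?_, hfix', hinj _ _ ?_, ?_⟩
  · rw [hα', he, ← hα', smul_comm, hfix']
  · rw [hα', hew, one_smul]
  · rw [show α.smulRight w = e from LinearMap.ext fun x => hα' x, ← hsum, add_sub_cancel_left]
    exact hrel

namespace ShortEx

variable {Q Z : Type} [AddCommGroup Q] [Module k Q] [DistribMulAction Γ Q] [SMulCommClass Γ k Q]
  [AddCommGroup Z] [Module k Z] [DistribMulAction Γ Z] [SMulCommClass Γ k Z]
  {i : X →ₗ[k] Q} {π : Q →ₗ[k] Z}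

theorem stablyScalar_left (h : ShortEx Γ i π) (hQ : Rel Γ (LinearMap.id : Q →ₗ[k] Q))
    (hZ : StablyScalar k Γ Z) : StablyScalar k Γ X := fun θ hθ => by
  obtain ⟨b, hb, hbi⟩ := h.exists_extension hQ (h.eqv_i.comp hθ)
  obtain ⟨c, hc, hce⟩ := h.exists_factor_coker (π ∘ₗ b) (by
    rw [LinearMap.comp_assoc, hbi]; ext x; exact h.p_i _)
  obtain ⟨d, hd⟩ := hZ c (hce (h.eqv_p.comp hb))
  refine ⟨d, h.rel_left h hQ (hb.sub (Eqv.id.smul d)) ?_ ?_ hd⟩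
  · rw [LinearMap.comp_sub, LinearMap.sub_comp, hbi]; ext x; simp
  · rw [LinearMap.comp_sub, LinearMap.sub_comp, hc]; ext x; simp

theorem stablyScalar_right (h : ShortEx Γ i π) (hQ : Rel Γ (LinearMap.id : Q →ₗ[k] Q))
    (hX : StablyScalar k Γ X) : StablyScalar k Γ Z := fun θ hθ => by
  obtain ⟨b, hb, hbi⟩ := h.exists_lift hQ (hθ.comp h.eqv_p)
  obtain ⟨a, ha, hae⟩ := h.exists_factor_ker (b ∘ₗ i) (by
    rw [← LinearMap.comp_assoc, hbi]; ext x; simp [h.p_i])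
  obtain ⟨d, hd⟩ := hX a (hae (hb.comp h.eqv_i))
  refine ⟨d, h.rel_right h hQ (hb.sub (Eqv.id.smul d)) ?_ ?_ hd⟩
  · rw [LinearMap.comp_sub, LinearMap.sub_comp, ha]; ext x; simp
  · rw [LinearMap.comp_sub, LinearMap.sub_comp, hbi]; ext x; simp

theorem endotrivialRank_iff (hΓ : IsPGroup p Γ) [FiniteDimensional k Q] (h : ShortEx Γ i π)
    (hQ : Rel Γ (LinearMap.id : Q →ₗ[k] Q)) :
    EndotrivialRank k Γ X ↔ EndotrivialRank k Γ Z := by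
  have h1 : (Nat.card Γ : ℤ) ∣ (Module.finrank k X : ℤ) + Module.finrank k Z := by
    exact_mod_cast h.finrank_eq ▸ card_dvd_finrank_of_rel_id hΓ hQ
  unfold EndotrivialRank
  generalize (Module.finrank k X : ℤ) = x at *
  generalize (Module.finrank k Z : ℤ) = z at *
  generalize (Nat.card Γ : ℤ) = q at *
  obtain ⟨d, hd⟩ := h1
  constructor
  · rintro (⟨c, hc⟩ | ⟨c, hc⟩)
    · exact Or.inr ⟨d - c, by linear_combination hd - hc⟩
    · exact Or.inl ⟨d - c, by linear_combination hd - hc⟩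
  · rintro (⟨c, hc⟩ | ⟨c, hc⟩)
    · exact Or.inr ⟨d - c, by linear_combination hd - hc⟩
    · exact Or.inl ⟨d - c, by linear_combination hd - hc⟩

end ShortEx

end Fitting

section Radical

set_option linter.unusedSectionVars false

variable {k : Type} [Field k] {Γ : Type} [Group Γ]
variable (K : Type) [AddCommGroup K] [Module k K] [DistribMulAction Γ K] [SMulCommClass Γ k K]

variable (k Γ) in
/-- The algebra of equivariant endomorphisms. -/
def eqvEnd : Subalgebra k (Module.End k K) where
  carrier := {f | Eqv Γ f}
  mul_mem' := fun hf hg => hf.comp hg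
  add_mem' := fun hf hg => hf.add hg
  algebraMap_mem' := fun c s x => (smul_comm s c x).symm

variable {K}

theorem mem_jacobson_of_forall_isNilpotent {R : Type} [Ring R] {x : R}
    (h : ∀ y, IsNilpotent (y * x)) : x ∈ (⊥ : Ideal R).jacobson :=
  Ideal.mem_jacobson_iff.2 fun y => by
    obtain ⟨u, hu⟩ := (h y).isUnit_one_add
    refine ⟨(u⁻¹ : Rˣ), ?_⟩
    rw [Ideal.mem_bot, mul_assoc, ← mul_add_one, add_comm, ← hu, Units.inv_mul, sub_self]

theorem mem_jacobson_eqvEnd (x : eqvEnd k Γ K)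
    (h : ∀ y : K →ₗ[k] K, Eqv Γ y → IsNilpotent (y ∘ₗ (x : Module.End k K) : Module.End k K)) :
    x ∈ (⊥ : Ideal (eqvEnd k Γ K)).jacobson :=
  mem_jacobson_of_forall_isNilpotent fun y => by
    obtain ⟨n, hn⟩ := h y y.2
    exact ⟨n, Subtype.ext hn⟩

end Radical

section FactorSpan

open scoped ModuleCat

variable {k G : Type} [Field k] [Group G] [Fintype G] {p : ℕ} [Fact p.Prime] [CharP k p]
  {H : Subgroup G}

theorem stablyScalar_of_isSyzygyFamily {Ω : ℤ → ModuleCat.{0} (MonoidAlgebra k G)}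
    (hΩ : IsSyzygyFamily (triv k G) Ω) (h0 : Ω 0 = triv k G) (i : ℤ) :
    StablyScalar k H (Ω i) := by
  have key : ∀ i : ℤ, StablyScalar k H (Ω (i + 1)) ↔ StablyScalar k H (Ω i) := fun i => by
    obtain ⟨Q, hQ, ⟨s⟩⟩ := hΩ.2.2 i
    have hQ' := (rel_id_of_projective hQ).subgroup H
    have hs := s.shortEx.subgroup H
    exact ⟨hs.stablyScalar_right hQ', hs.stablyScalar_left hQ'⟩
  induction i using Int.induction_on with
  | zero =>
    rw [h0]
    obtain ⟨⟨e⟩, -⟩ := exists_triv_equiv (k := k) (G := G)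
    intro θ _
    suffices h : θ - e (θ (e.symm 1)) • LinearMap.id = 0 from ⟨_, h ▸ Rel.zero⟩
    ext x
    apply e.injective
    have hx : x = e x • e.symm 1 := e.injective (by simp)
    have h1 : e (θ x) = e x * e (θ (e.symm 1)) := by
      conv_lhs => rw [hx, map_smul, map_smul, smul_eq_mul]
    rw [LinearMap.sub_apply, map_sub, h1]
    simp [mul_comm]
  | succ n ih => exact (key _).2 ih
  | pred n ih => exact (key _).1 (by rwa [sub_add_cancel])

theorem endotrivialRank_of_isSyzygyFamily (hH : IsPGroup p H)
    {Ω : ℤ → ModuleCat.{0} (MonoidAlgebra k G)}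
    (hΩ : IsSyzygyFamily (triv k G) Ω) (h0 : Ω 0 = triv k G) (i : ℤ) :
    EndotrivialRank k H (Ω i) := by
  have key : ∀ i : ℤ, EndotrivialRank k H (Ω (i + 1)) ↔ EndotrivialRank k H (Ω i) := fun i => by
    obtain ⟨Q, hQ, ⟨s⟩⟩ := hΩ.2.2 i
    have := hΩ.1 i
    have := hΩ.1 (i + 1)
    have h1 : FiniteDimensional k (Ω i) := finiteDimensional_of_finite
    have h2 : FiniteDimensional k (Ω (i + 1)) := finiteDimensional_of_finite
    have hs := s.shortEx
    have hQf : FiniteDimensional k Q := by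
      have hr : FiniteDimensional k (LinearMap.ker (toLin s.p)) := by
        refine Module.Finite.of_surjective ((toLin s.i).codRestrict _ hs.p_i) ?_
        rintro ⟨y, hy⟩
        obtain ⟨x, hx⟩ := (hs.exact y).1 hy
        exact ⟨x, Subtype.ext hx⟩
      have hr' : FiniteDimensional k (Q ⧸ LinearMap.ker (toLin s.p)) :=
        Module.Finite.equiv (toLin s.p).quotKerEquivRange.symm
      exact Module.Finite.of_submodule_quotient (LinearMap.ker (toLin s.p))
    exact (hs.subgroup H).endotrivialRank_iff hH ((rel_id_of_projective hQ).subgroup H)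
  induction i using Int.induction_on with
  | zero =>
    rw [h0]
    obtain ⟨⟨e⟩, -⟩ := exists_triv_equiv (k := k) (G := G)
    left
    rw [e.finrank_eq, Module.finrank_self]
    simp
  | succ n ih => exact (key _).2 ih
  | pred n ih => exact (key _).1 (by rwa [sub_add_cancel])

theorem eq_zero_of_id_mem_factorSpan (hH : IsPGroup p H)
    {Ω : ℤ → ModuleCat.{0} (MonoidAlgebra k G)}
    (hΩ : IsSyzygyFamily (triv k G) Ω) (h0 : Ω 0 = triv k G)
    {M : ModuleCat.{0} (MonoidAlgebra k G)} (hM : LinearMap.id ∈ factorSpan Ω M)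
    {K : Type} [AddCommGroup K] [Module k K] [DistribMulAction H K] [SMulCommClass H k K]
    [FiniteDimensional k K] (hK : Module.finrank k K + 2 ≤ Nat.card H)
    {ι : K →ₗ[k] M} {r : M →ₗ[k] K} (hι : Eqv H ι) (hr : Eqv H r) (hrι : r ∘ₗ ι = LinearMap.id)
    (v : K) (hv : ∀ (i : ℤ) (g : Ω i ⟶ M), g ≠ 0 → StablyTriv k H (Ω i) →
      ∀ ξ : K →ₗ[k] k, (∀ (s : H) x, ξ (s • x) = ξ x) → ξ v = 0) : v = 0 := by
  let J : Ideal (eqvEnd k H K) := (⊥ : Ideal (eqvEnd k H K)).jacobson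
  have hrel : ∀ x : K →ₗ[k] K, (hx : Rel H x) → (⟨x, hx.eqv⟩ : eqvEnd k H K) ∈ J := fun x hx =>
    mem_jacobson_eqvEnd _ fun y hy => (hx.comp_left hy).isNilpotent hH (by omega)
  have key : ∀ f ∈ factorSpan Ω M, ∃ j ∈ J, (j : Module.End k K) v = r (f (ι v)) := by
    intro f hf
    induction hf using Submodule.span_induction with
    | mem f hf =>
      rcases hf with ⟨i, h, g, rfl⟩ | hf
      · by_cases hg : g = 0
        · exact ⟨0, J.zero_mem, by simp [hg, toLin]⟩
        have : Module.Finite (MonoidAlgebra k G) (Ω i) := hΩ.1 i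
        have : FiniteDimensional k (Ω i) := finiteDimensional_of_finite
        have ha : Eqv H (toLin h ∘ₗ ι) := ((toLin_eqv h).subgroup H).comp hι
        have hb : Eqv H (r ∘ₗ toLin g) := hr.comp ((toLin_eqv g).subgroup H)
        by_cases hi : StablyTriv k H (Ω i)
        · obtain ⟨α, w, hα, hw, hw1, hid⟩ := hi
          have hr1 := (hid.comp_left hb).comp_right ha
          refine ⟨_, hrel _ hr1, ?_⟩
          have h1 : α (h (ι v)) = 0 := hv i g hg ⟨α, w, hα, hw, hw1, hid⟩ (α ∘ₗ toLin h ∘ₗ ι)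
            fun s x => by
              have := ha s x
              simp only [LinearMap.comp_apply] at this ⊢
              rw [this, hα]
          simp [h1]
        · refine ⟨⟨(r ∘ₗ toLin g) ∘ₗ (toLin h ∘ₗ ι), hb.comp ha⟩, mem_jacobson_eqvEnd _
            fun y hy => ?_, rfl⟩
          by_contra hn
          exact hi (stablyTriv_of_not_isNilpotent hH (stablyScalar_of_isSyzygyFamily hΩ h0 i)
            (endotrivialRank_of_isSyzygyFamily hH hΩ h0 i) ha (hy.comp hb) hK hn)
      · exact ⟨_, hrel _ (((hf.subgroup H).comp_left hr).comp_right hι), rfl⟩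
    | zero => exact ⟨0, J.zero_mem, by simp⟩
    | add f g _ _ hf hg =>
      obtain ⟨j, hj, hjv⟩ := hf
      obtain ⟨j', hj', hjv'⟩ := hg
      exact ⟨j + j', J.add_mem hj hj', by simp [hjv, hjv']⟩
    | smul c f _ hf =>
      obtain ⟨j, hj, hjv⟩ := hf
      exact ⟨algebraMap k _ c * j, J.mul_mem_left _ hj, by simp [hjv]⟩
  obtain ⟨j, hj, hjv⟩ := key _ hM
  rw [LinearMap.id_apply, show r (ι v) = v from LinearMap.congr_fun hrι v] at hjv
  obtain ⟨z, hz⟩ := Ideal.mem_jacobson_iff.1 hj (-1)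
  have h1 := LinearMap.congr_fun (congrArg Subtype.val ((Ideal.mem_bot).1 hz)) v
  simpa [hjv] using h1

end FactorSpan

section AdditiveCharacters

open scoped ModuleCat

/-- The self-extension of the trivial representation defined by an additive character. -/
theorem exists_unipotent_module {k Γ : Type} [Field k] [Group Γ] (χ : Γ → k)
    (hχ : ∀ s t, χ (s * t) = χ s + χ t) :
    ∃ (E : ModuleCat.{0} (MonoidAlgebra k Γ)) (i : k →ₗ[k] E) (π : E →ₗ[k] k),
      Function.Injective i ∧ Function.Surjective π ∧ (∀ y, π y = 0 ↔ ∃ x, i x = y) ∧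
      (∀ (s : Γ) (x : E), s • x = x + i (χ s * π x)) ∧ Module.finrank k E = 2 := by
  have h1 : χ 1 = 0 := by simpa using hχ 1 1
  let act : DistribMulAction Γ (k × k) :=
    { smul := fun s x => (x.1 + χ s * x.2, x.2)
      one_smul := fun x => by
        change (x.1 + χ 1 * x.2, x.2) = x
        simp [h1]
      mul_smul := fun s t x => by
        change (x.1 + χ (s * t) * x.2, x.2) = (x.1 + χ t * x.2 + χ s * x.2, x.2)
        rw [hχ]
        congr 1
        ring
      smul_zero := fun s => by
        change ((0 : k) + χ s * 0, (0 : k)) = 0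
        simp
      smul_add := fun s x y => by
        change (x.1 + y.1 + χ s * (x.2 + y.2), x.2 + y.2) =
          (x.1 + χ s * x.2 + (y.1 + χ s * y.2), x.2 + y.2)
        congr 1
        ring }
  have hact : ∀ (s : Γ) (x : k × k), s • x = (x.1 + χ s * x.2, x.2) := fun _ _ => rfl
  have : SMulCommClass Γ k (k × k) := ⟨fun s c x => by
    rw [hact, hact]
    ext
    · simp only [Prod.smul_fst, Prod.smul_snd, smul_eq_mul]; ring
    · rfl⟩
  obtain ⟨e, he⟩ := exists_modOf_equiv k Γ (k × k)
  refine ⟨modOf k Γ (k × k), e.symm.toLinearMap ∘ₗ LinearMap.inl k k k,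
    LinearMap.snd k k k ∘ₗ e.toLinearMap, ?_, ?_, fun y => ⟨fun h => ⟨(e y).1, ?_⟩, ?_⟩,
    fun s x => ?_, ?_⟩
  · exact e.symm.injective.comp (LinearMap.inl_injective (R := k) (M := k) (M₂ := k))
  · exact (LinearMap.snd_surjective (R := k) (M := k) (M₂ := k)).comp e.surjective
  · apply e.injective
    have h' : (e y).2 = 0 := h
    ext <;> simp [h']
  · rintro ⟨x, rfl⟩
    simp
  · apply e.injective
    have h2 : e (s • x) = s • e x := he s x
    rw [h2, hact, map_add]
    ext <;> simp
  · rw [e.finrank_eq, Module.finrank_prod, Module.finrank_self]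

theorem shortEx_of_unipotent {k Γ : Type} [Field k] [Group Γ] {χ : Γ → k}
    {E : ModuleCat.{0} (MonoidAlgebra k Γ)} {i : k →ₗ[k] E} {π : E →ₗ[k] k}
    (hi : Function.Injective i) (hπ : Function.Surjective π)
    (hex : ∀ y, π y = 0 ↔ ∃ x, i x = y) (hact : ∀ (s : Γ) (x : E), s • x = x + i (χ s * π x))
    (e : triv k Γ ≃ₗ[k] k) : ShortEx Γ (i ∘ₗ e.toLinearMap) (e.symm.toLinearMap ∘ₗ π) := by
  have htriv := (exists_triv_equiv (k := k) (G := Γ)).2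
  have h0 : ∀ x, π (i x) = 0 := fun x => (hex _).2 ⟨x, rfl⟩
  refine ⟨fun s x => ?_, fun s x => ?_, hi.comp e.injective, e.symm.surjective.comp hπ,
    fun y => ?_⟩
  · simp [htriv, hact, h0]
  · simp [htriv, hact, h0]
  · rw [LinearMap.comp_apply, LinearEquiv.coe_coe, LinearEquiv.map_eq_zero_iff, hex]
    exact e.surjective.exists (p := fun c => i c = y)

theorem char_eq_zero_of_forall_mem_sylow {k G : Type} [Field k] [Group G] [Finite G] {p : ℕ}
    [Fact p.Prime] [CharP k p] (P : Sylow p G) (χ : G → k) (hχ : ∀ s t, χ (s * t) = χ s + χ t)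
    (h : ∀ s ∈ P, χ s = 0) (s : G) : χ s = 0 := by
  have h1 : χ 1 = 0 := by simpa using hχ 1 1
  let f : G →* Multiplicative k :=
    { toFun := fun s => Multiplicative.ofAdd (χ s)
      map_one' := congrArg _ h1
      map_mul' := fun s t => congrArg _ (hχ s t) }
  have hker : ∀ s, s ∈ f.ker ↔ χ s = 0 := fun s => Iff.rfl
  have hpow : ∀ n : ℕ, χ (s ^ n) = n * χ s := fun n => by
    induction n with
    | zero => simp [h1]
    | succ n ih => rw [pow_succ, hχ, ih]; push_cast; ring
  have hmem := (hker _).1 (f.ker.pow_index_mem s)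
  rw [hpow] at hmem
  refine (mul_eq_zero.1 hmem).resolve_left fun h0 => ?_
  rw [CharP.cast_eq_zero_iff k p] at h0
  exact P.not_dvd_index (h0.trans (Subgroup.index_dvd_of_le fun s hs => (hker s).2 (h s hs)))

variable {k G : Type} [Field k] [Group G] [Fintype G] {p : ℕ} [Fact p.Prime] [CharP k p]

theorem GHolds.char_eq_zero (hG : GHolds k G) (P : Sylow p G) (hq : 4 ≤ Nat.card P)
    (χ : G → k) (hχ : ∀ s t, χ (s * t) = χ s + χ t) (s : G) : χ s = 0 := by
  obtain ⟨E, i, π, hi, hπ, hex, hact, hrank⟩ := exists_unipotent_module χ hχ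
  obtain ⟨⟨e⟩, -⟩ := exists_triv_equiv (k := k) (G := G)
  have hses := shortEx_of_unipotent hi hπ hex hact e
  have hthick : InThick (triv k G) E := .ext₂ hses.ses .gen .gen
  have hfd : FiniteDimensional k E := Module.finite_of_finrank_pos (by omega)
  have hfin : Module.Finite (MonoidAlgebra k G) E := finite_of_finiteDimensional
  have := finite_triv (k := k) (G := G)
  obtain ⟨Ω, hΩ, h0⟩ := exists_isSyzygyFamily (triv k G)
  refine char_eq_zero_of_forall_mem_sylow P χ hχ (fun s hs => ?_) s
  obtain ⟨y, hy⟩ := hπ 1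
  have hv := eq_zero_of_id_mem_factorSpan P.isPGroup' hΩ h0 (hG.id_mem_factorSpan hΩ hthick)
    (K := E) (ι := LinearMap.id) (r := LinearMap.id) (by rw [hrank]; exact hq) Eqv.id Eqv.id rfl
    ((⟨s, hs⟩ : P) • y - y) fun _ _ _ _ ξ hξ => by
      rw [map_sub, hξ, sub_self]
  have hsy : (⟨s, hs⟩ : P) • y = s • y := rfl
  rw [hsy, hact, hy, mul_one, add_sub_cancel_left] at hv
  exact hi (hv.trans (map_zero i).symm)

end AdditiveCharacters

section Heart

open scoped ModuleCat

/-- `M` is the quotient of the augmentation ideal by the norm element: here `j` realises `I` as the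
functions on `Γ` with zero sum, and `q` is the quotient of `I` by the constants. -/
structure IsHeart {k Γ : Type} [Field k] [Group Γ] [Fintype Γ]
    {I M : ModuleCat.{0} (MonoidAlgebra k Γ)} (j : I →ₗ[k] (Γ → k)) (q : I →ₗ[k] M) : Prop where
  inj : Function.Injective j
  range : ∀ F, (∃ x, j x = F) ↔ ∑ g, F g = 0
  trans : ∀ (s : Γ) x g, j (s • x) g = j x (s⁻¹ * g)
  eqv : Eqv Γ q
  surj : Function.Surjective q
  ker : ∀ x, q x = 0 ↔ ∃ c, ∀ g, j x g = c

theorem exists_regular_module (k Γ : Type) [Field k] [Group Γ] [Finite Γ] :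
    ∃ (A : ModuleCat.{0} (MonoidAlgebra k Γ)) (e : A ≃ₗ[k] (Γ → k)), Projective A ∧
      ∀ (s : Γ) (x : A) (g : Γ), e (s • x) g = e x (s⁻¹ * g) := by
  classical
  let := Fintype.ofFinite Γ
  let act : DistribMulAction Γ (Γ → k) :=
    { smul := fun s F g => F (s⁻¹ * g)
      one_smul := fun F => funext fun g => by
        change F (1⁻¹ * g) = F g
        simp
      mul_smul := fun s t F => funext fun g => by
        change F ((s * t)⁻¹ * g) = F (t⁻¹ * (s⁻¹ * g))
        simp [mul_assoc]
      smul_zero := fun s => rfl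
      smul_add := fun s F F' => rfl }
  have hact : ∀ (s : Γ) (F : Γ → k) (g : Γ), (s • F) g = F (s⁻¹ * g) := fun _ _ _ => rfl
  have : SMulCommClass Γ k (Γ → k) := ⟨fun s c F => rfl⟩
  obtain ⟨e, he⟩ := exists_modOf_equiv k Γ (Γ → k)
  have htrans : ∀ (s : Γ) x (g : Γ), e (s • x) g = e x (s⁻¹ * g) := fun s x g =>
    congrFun (he s x) g
  refine ⟨modOf k Γ (Γ → k), e, projective_iff_rel_id.2 ?_, htrans⟩
  refine ⟨e.symm.toLinearMap ∘ₗ LinearMap.single k (fun _ : Γ => k) 1 ∘ₗ LinearMap.proj 1 ∘ₗ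
    e.toLinearMap, LinearMap.ext fun x => e.injective (funext fun g => ?_)⟩
  rw [tr_apply, map_sum, Finset.sum_apply, Finset.sum_eq_single g]
  · simp [htrans]
  · intro s _ hs
    rw [htrans]
    simp [inv_mul_eq_one, hs]
  · simp

theorem exists_heart (k Γ : Type) [Field k] [Group Γ] [Fintype Γ] (h : (Fintype.card Γ : k) = 0) :
    ∃ (I M : ModuleCat.{0} (MonoidAlgebra k Γ)) (j : I →ₗ[k] (Γ → k)) (q : I →ₗ[k] M),
      IsHeart j q ∧ InThick (triv k Γ) M ∧ Module.finrank k M + 2 = Fintype.card Γ ∧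
      FiniteDimensional k M := by
  obtain ⟨A, e, hA, he⟩ := exists_regular_module k Γ
  obtain ⟨⟨ε⟩, htriv⟩ := exists_triv_equiv (k := k) (G := Γ)
  have hsum : Eqv Γ (ε.symm.toLinearMap ∘ₗ (∑ g : Γ, LinearMap.proj g) ∘ₗ e.toLinearMap) :=
    fun s x => by
      rw [htriv]
      simp only [LinearMap.comp_apply, LinearMap.sum_apply, LinearMap.proj_apply,
        LinearEquiv.coe_coe, he]
      congr 1
      exact Equiv.sum_comp (Equiv.mulLeft s⁻¹) fun g => e x g
  obtain ⟨I, S, hS⟩ := exists_kernel_ses (homOfEqv _ hsum) (by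
    intro y
    classical
    refine ⟨e.symm (Pi.single 1 (ε y)), ?_⟩
    change ε.symm ((∑ g : Γ, LinearMap.proj g) (e (e.symm (Pi.single 1 (ε y))))) = y
    simp [LinearMap.sum_apply])
  have hSx := S.shortEx
  have hSp : ∀ x, S.p x = ε.symm (∑ g, e x g) := fun x => by
    rw [hS]
    change ε.symm ((∑ g : Γ, LinearMap.proj g) (e x)) = _
    simp [LinearMap.sum_apply]
  obtain ⟨c, hc, hce⟩ := hSx.exists_factor_ker
    (e.symm.toLinearMap ∘ₗ (LinearMap.pi fun _ => LinearMap.id) ∘ₗ ε.toLinearMap) (by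
      ext x
      have := hSp (e.symm fun _ => ε x)
      simp [h] at this
      exact this)
  have hc' : ∀ x, S.i (c x) = e.symm fun _ => ε x := fun x => LinearMap.congr_fun hc x
  obtain ⟨M, T, hT⟩ := exists_cokernel_ses (homOfEqv c (hce fun s x => by
    apply e.injective
    ext g
    simp [he, htriv])) (by
      intro x y hxy
      have h1 : S.i (c x) = S.i (c y) := congrArg S.i hxy
      rw [hc', hc'] at h1
      exact ε.injective (congrFun (e.symm.injective h1) 1))
  have hTx := T.shortEx
  have hTi : ∀ x, T.i x = c x := fun x => by rw [hT]; rfl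
  have hA' : FiniteDimensional k A := Module.Finite.equiv e.symm
  have hI : FiniteDimensional k I := Module.Finite.of_injective (toLin S.i) hSx.inj
  have h1 := hSx.finrank_eq
  have h2 := hTx.finrank_eq
  rw [ε.finrank_eq, Module.finrank_self] at h1 h2
  rw [e.finrank_eq, Module.finrank_pi] at h1
  refine ⟨I, M, e.toLinearMap ∘ₗ toLin S.i, toLin T.p, ⟨e.injective.comp hSx.inj, fun F => ?_,
    fun s x g => ?_, hTx.eqv_p, hTx.surj, fun x => ?_⟩,
    .ext₁ T .gen (.ext₃ S (.proj A hA) .gen), by omega,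
    Module.Finite.of_surjective (toLin T.p) hTx.surj⟩
  · have h3 : ∑ g, F g = 0 ↔ S.p (e.symm F) = 0 := by
      rw [hSp, LinearEquiv.map_eq_zero_iff]; simp
    rw [h3, S.exact]
    exact exists_congr fun x => by simp [LinearEquiv.eq_symm_apply]
  · have h3 : S.i (s • x) = s • S.i x := hSx.eqv_i s x
    simp [h3, he]
  · rw [hTx.exact]
    constructor
    · rintro ⟨y, rfl⟩
      exact ⟨ε y, fun g => by simp [hTi, hc']⟩
    · rintro ⟨d, hd⟩
      refine ⟨ε.symm d, S.inj ?_⟩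
      rw [toLin_apply, hTi, hc']
      apply e.injective
      ext g
      simpa using (hd g).symm

namespace IsHeart

variable {k Γ : Type} [Field k] [Group Γ] [Fintype Γ] {I M : ModuleCat.{0} (MonoidAlgebra k Γ)}
  {j : I →ₗ[k] (Γ → k)} {q : I →ₗ[k] M}

/-- Fixed vectors of the heart come from additive characters. -/
theorem eq_zero_of_fixed (h : IsHeart j q)
    (hχ : ∀ χ : Γ → k, (∀ s t, χ (s * t) = χ s + χ t) → ∀ s, χ s = 0) (m : M)
    (hm : ∀ s : Γ, s • m = m) : m = 0 := by
  obtain ⟨x, rfl⟩ := h.surj m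
  have h1 : ∀ s : Γ, ∃ c, ∀ g, j x (s⁻¹ * g) - j x g = c := fun s => by
    obtain ⟨c, hc⟩ := (h.ker (s • x - x)).1 (by rw [map_sub, h.eqv, hm, sub_self])
    exact ⟨c, fun g => by rw [← hc g, map_sub, Pi.sub_apply, h.trans]⟩
  choose χ hχ' using h1
  have h2 := hχ χ fun s t => by
    rw [← hχ' (s * t) 1, ← hχ' s 1, ← hχ' t (s⁻¹ * 1)]
    simp
  exact (h.ker x).2 ⟨j x 1, fun g => by
    have := hχ' g g
    rw [h2, sub_eq_zero, inv_mul_cancel] at this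
    exact this.symm⟩

/-- A group of order at least four acting trivially on the heart of its group algebra is a Klein
four-group, in characteristic two. -/
theorem klein_of_trivial (h : IsHeart j q) (hq : 4 ≤ Fintype.card Γ)
    (htriv : ∀ (s : Γ) (m : M), s • m = m) :
    (2 : k) = 0 ∧ (∀ s : Γ, s * s = 1) ∧ Fintype.card Γ = 4 := by
  classical
  have key : ∀ s t : Γ, ∃ c : k, ∀ g, (if g = s * t then 1 else 0) - (if g = s then 1 else 0) -
      (if g = t then 1 else 0) + (if g = 1 then 1 else 0) = c := fun s t => by
    obtain ⟨x, hx⟩ := (h.range fun g => (if g = t then 1 else 0) - if g = 1 then 1 else 0).2 (by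
      rw [Finset.sum_sub_distrib]; simp)
    obtain ⟨c, hc⟩ := (h.ker (s • x - x)).1 (by rw [map_sub, h.eqv, htriv, sub_self])
    refine ⟨c, fun g => ?_⟩
    rw [← hc g, map_sub, Pi.sub_apply, h.trans, hx]
    simp only [inv_mul_eq_iff_eq_mul, mul_one]
    ring
  have hex : ∀ S : Finset Γ, S.card < Fintype.card Γ → ∃ g, g ∉ S := fun S hS => by
    by_contra! hall
    rw [Finset.eq_univ_of_forall hall, Finset.card_univ] at hS
    exact lt_irrefl _ hS
  have hsq : ∀ s : Γ, s ≠ 1 → (2 : k) = 0 ∧ s * s = 1 := fun s hs => by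
    obtain ⟨c, hc⟩ := key s s
    obtain ⟨g, hg⟩ := hex {s * s, s, 1} ((Finset.card_le_three).trans_lt hq)
    simp only [Finset.mem_insert, Finset.mem_singleton, not_or] at hg
    have hc0 := hc g
    simp only [hg.1, hg.2.1, hg.2.2, if_false] at hc0
    have hcs := hc s
    have hss : s ≠ s * s := fun h => hs (by simpa using h)
    simp only [hss, hs, if_false, if_true] at hcs
    have hc1 := hc 1
    refine ⟨by linear_combination hc0 - hcs, ?_⟩
    by_contra hne
    simp only [Ne.symm hne, Ne.symm hs, if_false, if_true] at hc1
    exact one_ne_zero (α := k) (by linear_combination hc1 - hc0)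
  obtain ⟨s, hs⟩ := hex {1} (by simp; omega)
  obtain ⟨t, ht⟩ := hex {1, s} ((Finset.card_le_two).trans_lt (by omega))
  simp only [Finset.mem_insert, Finset.mem_singleton, not_or] at hs ht
  refine ⟨(hsq s hs).1, fun s => ?_, ?_⟩
  · by_cases hs : s = 1
    · simp [hs]
    · exact (hsq s hs).2
  · by_contra hne
    obtain ⟨c, hc⟩ := key s t
    obtain ⟨g, hg⟩ := hex {s * t, s, t, 1} ((Finset.card_le_four).trans_lt (by omega))
    simp only [Finset.mem_insert, Finset.mem_singleton, not_or] at hg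
    have hc0 := hc g
    simp only [hg.1, hg.2.1, hg.2.2.1, hg.2.2.2, if_false] at hc0
    have hc1 := hc 1
    have hst : 1 ≠ s * t := fun h => ht.2 (by
      rw [← mul_right_inj s, ← h, (hsq s hs).2])
    simp only [hst, Ne.symm hs, Ne.symm ht.1, if_false, if_true] at hc1
    exact one_ne_zero (α := k) (by linear_combination hc1 - hc0)

end IsHeart

end Heart

section KleinFour

set_option linter.unusedSectionVars false

open scoped ModuleCat

theorem Rel.eq_zero_of_trivial {k Γ X Y : Type} [Field k] [Group Γ] [Finite Γ]
    [AddCommGroup X] [Module k X] [DistribMulAction Γ X] [SMulCommClass Γ k X]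
    [AddCommGroup Y] [Module k Y] [DistribMulAction Γ Y] [SMulCommClass Γ k Y]
    (hX : ∀ (s : Γ) (x : X), s • x = x) (hY : ∀ (s : Γ) (y : Y), s • y = y)
    (hΓ : (Nat.card Γ : k) = 0) {f : X →ₗ[k] Y} (hf : Rel Γ f) : f = 0 := by
  obtain ⟨φ, rfl⟩ := hf
  rw [tr_of_eqv fun s x => by rw [hX, hY], hΓ, zero_smul]

/-- A self-extension of the trivial representation of the Klein four group which is free over one
subgroup of order two and trivial over another. -/
theorem exists_klein_extension (k Γ : Type) [Field k] [Group Γ] [Finite Γ] (h2 : (2 : k) = 0)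
    (hc : Nat.card Γ = 4) (hsq : ∀ s : Γ, s * s = 1) :
    ∃ (A B : Subgroup Γ) (E : ModuleCat.{0} (MonoidAlgebra k Γ)) (i : triv k Γ →ₗ[k] E)
      (π : E →ₗ[k] triv k Γ), ShortEx Γ i π ∧ Rel A (LinearMap.id : E →ₗ[k] E) ∧
      (∀ f : E →ₗ[k] triv k Γ, Eqv B f) ∧ Nat.card A = 2 ∧ Nat.card B = 2 := by
  classical
  have hord : ∀ s : Γ, s ≠ 1 → Nat.card (Subgroup.zpowers s) = 2 := fun s hs => by
    rw [Nat.card_zpowers]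
    exact orderOf_eq_prime (by rw [pow_two, hsq]) hs
  have : Nontrivial Γ := Finite.one_lt_card_iff_nontrivial.1 (by omega)
  obtain ⟨b, hb⟩ := exists_ne (1 : Γ)
  have hB := hord b hb
  have hBi : (Subgroup.zpowers b).index = 2 := by
    have := (Subgroup.zpowers b).card_mul_index
    rw [hB, hc] at this
    omega
  obtain ⟨a, ha⟩ : ∃ a, a ∉ Subgroup.zpowers b := by
    by_contra! h
    rw [(Subgroup.eq_top_iff' _).2 h, Subgroup.index_top] at hBi
    omega
  have ha1 : a ≠ 1 := fun h => ha (h ▸ one_mem _)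
  have h11 : (1 : k) + 1 = 0 := by rw [one_add_one_eq_two, h2]
  let χ : Γ → k := fun s => if s ∈ Subgroup.zpowers b then 0 else 1
  have hχ : ∀ s t, χ (s * t) = χ s + χ t := fun s t => by
    have := Subgroup.mul_mem_iff_of_index_two hBi (a := s) (b := t)
    by_cases hs : s ∈ Subgroup.zpowers b <;> by_cases ht : t ∈ Subgroup.zpowers b <;>
      simp [χ, this, hs, ht, h11]
  obtain ⟨E, i, π, hi, hπ, hex, hact, -⟩ := exists_unipotent_module χ hχ
  obtain ⟨⟨e⟩, htriv⟩ := exists_triv_equiv (k := k) (G := Γ)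
  have hpi : ∀ x, π (i x) = 0 := fun x => (hex _).2 ⟨x, rfl⟩
  have hS := shortEx_of_unipotent hi hπ hex hact e
  refine ⟨Subgroup.zpowers a, Subgroup.zpowers b, E, _, _, hS, ?_, fun f s x => ?_, hord a ha1, hB⟩
  · obtain ⟨ρ, hρ⟩ := i.exists_leftInverse_of_injective (LinearMap.ker_eq_bot.2 hi)
    have hρi : ∀ c, ρ (i c) = c := fun c => LinearMap.congr_fun hρ c
    obtain ⟨y, hy⟩ := hπ 1
    let y' := y - i (ρ y)
    have hy'π : π y' = 1 := by simp [y', hpi, hy]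
    have hy'ρ : ρ y' = 0 := by simp [y', hρi]
    have hdec : ∀ x, x = i (ρ x) + π x • y' := fun x => by
      obtain ⟨c, hc⟩ := (hex (x - π x • y')).1 (by simp [hy'π])
      have h3 : ρ x = c := by
        have h4 := congrArg ρ hc
        rw [hρi, map_sub, map_smul, hy'ρ, smul_zero, sub_zero] at h4
        exact h4.symm
      rw [h3, hc]
      abel
    let : Fintype (Subgroup.zpowers a) := Fintype.ofFinite _
    obtain ⟨c, -, hc1, hc', hsum⟩ := exists_sum_of_card_two (hord a ha1)
    have hχc : χ c = 1 := by
      have h3 : (⟨a, Subgroup.mem_zpowers a⟩ : Subgroup.zpowers a) = c :=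
        (hc' _).resolve_left fun h => ha1 (congrArg Subtype.val h)
      simp [χ, ← h3, ha]
    have hcc : ∀ x : E, c • x = x + i (π x) := fun x => by
      change (c : Γ) • x = _
      rw [hact, hχc, one_mul]
    have hci : c⁻¹ = c := inv_eq_of_mul_eq_one_right (Subtype.ext (hsq c))
    refine ⟨(ρ + π).smulRight y', LinearMap.ext fun x => ?_⟩
    refine Eq.trans ?_ (hdec x).symm
    rw [tr_apply, hsum, inv_one, one_smul, one_smul, hci, hcc, hcc]
    simp only [LinearMap.smulRight_apply, LinearMap.add_apply, map_add, hρi, hpi, map_smul, hy'π,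
      smul_eq_mul, mul_one, add_zero]
    linear_combination (norm := module) h2 • (i (π x) + (ρ x + π x) • y')
  · rw [show s • f x = f x from htriv s _]
    change f ((s : Γ) • x) = _
    rw [hact]
    simp [χ, s.2]

variable {k G : Type} [Field k] [Group G] [Finite G] {Ω : ℤ → ModuleCat.{0} (MonoidAlgebra k G)}

theorem not_stablyTriv_of_klein {H : Subgroup G} (h2 : (2 : k) = 0) (hc : Nat.card H = 4)
    (hsq : ∀ s : H, s * s = 1)
    (hΩ : ∀ i, ∃ Q : ModuleCat.{0} (MonoidAlgebra k G), Projective Q ∧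
      Nonempty (SES (Ω (i + 1)) Q (Ω i))) {i j : ℤ} (hij : i < j) (hi : StablyTriv k H (Ω i)) :
    ¬ StablyTriv k H (Ω j) := by
  rintro ⟨β, v, hβ, hv, hβv, hrel⟩
  obtain ⟨α, w, hα, hw, hαw, -⟩ := hi
  obtain ⟨A, B, E, ι, π, hE, hEA, hEB, hA, hB⟩ := exists_klein_extension k H h2 hc hsq
  obtain ⟨⟨e⟩, htriv⟩ := exists_triv_equiv (k := k) (G := H)
  obtain ⟨ρ, hρ⟩ := hE.exists_retraction
  have hA0 : (Nat.card A : k) = 0 := by rw [hA]; exact_mod_cast h2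
  have hB0 : (Nat.card B : k) = 0 := by rw [hB]; exact_mod_cast h2
  have hladder : ∀ n : ℕ, ∃ γ : Ω (i + n) →ₗ[k] triv k H, Eqv H γ ∧ ¬ Rel A γ ∧
      (0 < n → Rel B γ) := by
    intro n
    induction n with
    | zero =>
      rw [Nat.cast_zero, add_zero]
      refine ⟨e.symm.toLinearMap ∘ₗ α, fun s x => by rw [htriv]; simp [hα], fun h => ?_,
        fun h => absurd h (lt_irrefl 0)⟩
      have h1 : Eqv A (e.toLinearMap.smulRight w) := fun s x => by
        rw [show s • x = x from htriv s x, LinearMap.smulRight_apply, smul_comm s]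
        exact congrArg _ (hw s).symm
      have h3 := LinearMap.congr_fun ((h.comp_right h1).eq_zero_of_trivial
        (fun s : A => htriv (s : H)) (fun s => htriv (s : H)) hA0) (e.symm 1)
      simp [hαw] at h3
    | succ n ih =>
      obtain ⟨γ, hγ, hγA, -⟩ := ih
      obtain ⟨Q, hQ, ⟨S⟩⟩ := hΩ (i + n)
      have hS := S.shortEx.subgroup H
      have hQr := (rel_id_of_projective hQ).subgroup H
      obtain ⟨f, hf, hπf⟩ := hE.exists_lift hQr (hγ.comp hS.eqv_p)
      obtain ⟨γ', hγ', hγ'e⟩ := hE.exists_factor_ker (f ∘ₗ toLin S.i) (LinearMap.ext fun x => by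
        have h1 := LinearMap.congr_fun hπf (toLin S.i x)
        simpa only [LinearMap.comp_apply, hS.p_i, map_zero, LinearMap.zero_apply] using h1)
      have hfi := hf.comp hS.eqv_i
      rw [show i + ((n + 1 : ℕ) : ℤ) = i + n + 1 by push_cast; ring]
      refine ⟨γ', hγ'e hfi, fun h => hγA ((hS.subgroup A).rel_right (hE.subgroup A) hEA
        (hf.subgroup A) hγ' hπf h), fun _ => ?_⟩
      have h1 : γ' = (ρ ∘ₗ f) ∘ₗ toLin S.i := by
        rw [LinearMap.comp_assoc, ← hγ', ← LinearMap.comp_assoc, hρ, LinearMap.id_comp]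
      rw [h1]
      exact (Rel.of_source (hQr.subgroup B) ((hEB ρ).comp (hf.subgroup B))).comp_right
        (hS.eqv_i.subgroup B)
  obtain ⟨n, rfl⟩ := Int.le.dest hij.le
  obtain ⟨γ, hγ, hγA, hγB⟩ := hladder n
  have hγB := hγB (by omega)
  have h1 : Eqv B (e.toLinearMap.smulRight v) := fun s x => by
    rw [show s • x = x from htriv s x, LinearMap.smulRight_apply, smul_comm s]
    exact congrArg _ (hv s).symm
  have h3 := LinearMap.congr_fun ((hγB.comp_right h1).eq_zero_of_trivial
    (fun s : B => htriv (s : H)) (fun s => htriv (s : H)) hB0) (e.symm 1)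
  have h4 : γ v = 0 := by simpa using h3
  apply hγA
  have h5 : γ = γ ∘ₗ (LinearMap.id - β.smulRight v) := by
    ext x
    simp [h4]
  rw [h5]
  exact (hrel.comp_left hγ).subgroup A

end KleinFour

section HeartRestriction

open scoped ModuleCat

variable {k G : Type} [Field k] [Group G] [Fintype G]

omit [Fintype G] in
theorem exists_equivariant_equiv (H : Subgroup G) :
    ∃ ε : (G ⧸ H) × H ≃ G, ∀ (s h : H) t, ε (t, s * h) = s * ε (t, h) :=
  ⟨((Equiv.prodCongr (Equiv.refl _) (Equiv.inv H)).trans (cosetEquiv H)).trans (Equiv.inv G),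
    fun s h t => by simp [cosetEquiv_apply, mul_assoc]⟩

/-- Over a subgroup of invertible index, the heart of the subgroup is a direct summand. -/
theorem IsHeart.exists_split {I M : ModuleCat.{0} (MonoidAlgebra k G)}
    {j : I →ₗ[k] (G → k)} {q : I →ₗ[k] M} (h : IsHeart j q) {H : Subgroup G} [Fintype H]
    (hH : (H.index : k) ≠ 0) {I' K : ModuleCat.{0} (MonoidAlgebra k H)}
    {j' : I' →ₗ[k] (H → k)} {q' : I' →ₗ[k] K} (h' : IsHeart j' q') :
    ∃ (ι : K →ₗ[k] M) (r : M →ₗ[k] K), Eqv H ι ∧ Eqv H r ∧ r ∘ₗ ι = LinearMap.id := by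
  obtain ⟨ε, hε⟩ := exists_equivariant_equiv H
  let : Fintype (G ⧸ H) := Fintype.ofFinite _
  have hcard : (Fintype.card (G ⧸ H) : k) = H.index := by
    rw [Subgroup.index, Nat.card_eq_fintype_card]
  have hεs : ∀ (s : H) g, (ε.symm (s * g)).2 = s * (ε.symm g).2 := fun s g => by
    obtain ⟨⟨t, u⟩, rfl⟩ := ε.surjective g
    rw [← hε]
    simp
  let R : (G → k) →ₗ[k] (H → k) :=
    { toFun := fun F u => ∑ t, F (ε (t, u))
      map_add' := fun F F' => funext fun u => Finset.sum_add_distrib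
      map_smul' := fun c F => funext fun u => (Finset.mul_sum _ _ _).symm }
  let L : (H → k) →ₗ[k] (G → k) :=
    { toFun := fun F g => (H.index : k)⁻¹ * F (ε.symm g).2
      map_add' := fun F F' => funext fun u => mul_add _ _ _
      map_smul' := fun c F => funext fun u => mul_left_comm _ _ _ }
  have hR : ∀ F u, R F u = ∑ t, F (ε (t, u)) := fun _ _ => rfl
  have hL : ∀ F g, L F g = (H.index : k)⁻¹ * F (ε.symm g).2 := fun _ _ => rfl
  have hRL : ∀ F, R (L F) = F := fun F => funext fun u => by
    simp [hR, hL, hcard, hH]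
  obtain ⟨φ, hφ⟩ := exists_comp_eq_of_forall_exists j' (R ∘ₗ j) fun x => (h'.range _).2 (by
    simp only [LinearMap.comp_apply, hR]
    rw [← Fintype.sum_prod_type_right' fun t u => j x (ε (t, u)),
      Equiv.sum_comp ε fun g => j x g]
    exact (h.range _).1 ⟨x, rfl⟩)
  obtain ⟨ψ, hψ⟩ := exists_comp_eq_of_forall_exists j (L ∘ₗ j') fun x => (h.range _).2 (by
    simp only [LinearMap.comp_apply, hL]
    rw [← Equiv.sum_comp ε fun g => (H.index : k)⁻¹ * j' x (ε.symm g).2, Fintype.sum_prod_type]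
    simp [← Finset.mul_sum, (h'.range _).1 ⟨x, rfl⟩])
  have hφe : ∀ (s : H) x, φ (s • x) = s • φ x := fun s x => h'.inj (funext fun u => by
    rw [hφ, h'.trans, hφ]
    change R (j ((s : G) • x)) u = R (j x) (s⁻¹ * u)
    simp [hR, h.trans, hε])
  have hψe : ∀ (s : H) x, ψ (s • x) = s • ψ x := fun s x => h.inj (funext fun g => by
    change _ = j ((s : G) • ψ x) g
    rw [hψ, h.trans, hψ]
    have := hεs s⁻¹ g
    rw [Subgroup.coe_inv] at this
    simp [hL, h'.trans, this])
  obtain ⟨r, hr⟩ := exists_comp_eq_of_ker_le q (q' ∘ₗ φ) fun x hx => by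
    obtain ⟨c, hc⟩ := (h.ker x).1 hx
    exact (h'.ker _).2 ⟨H.index * c, fun u => by simp [hφ, hR, hc, hcard]⟩
  obtain ⟨ι, hι⟩ := exists_comp_eq_of_ker_le q' (q ∘ₗ ψ) fun x hx => by
    obtain ⟨c, hc⟩ := (h'.ker x).1 hx
    exact (h.ker _).2 ⟨(H.index : k)⁻¹ * c, fun u => by simp [hψ, hL, hc]⟩
  refine ⟨ι, r, fun s y => ?_, fun s y => ?_, LinearMap.ext fun y => ?_⟩
  · obtain ⟨x, rfl⟩ := h'.surj y
    rw [← h'.eqv, hι, hι, LinearMap.comp_apply, hψe]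
    exact h.eqv s _
  · obtain ⟨x, rfl⟩ := h.surj y
    rw [show s • q x = q (s • x) from (h.eqv s x).symm, hr, hr, LinearMap.comp_apply, hφe]
    exact h'.eqv s _
  · obtain ⟨x, rfl⟩ := h'.surj y
    rw [LinearMap.comp_apply, hι, LinearMap.comp_apply, hr, LinearMap.comp_apply,
      LinearMap.id_apply, show φ (ψ x) = x from h'.inj (by rw [hφ, LinearMap.comp_apply, hψ,
        LinearMap.comp_apply, hRL])]

/-- Under the generating hypothesis, Sylow subgroups have order less than four. -/
theorem GHolds.card_sylow_lt_four {p : ℕ} [Fact p.Prime] [CharP k p] (hG : GHolds k G)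
    (P : Sylow p G) (hp : p ∣ Nat.card P) : Nat.card P < 4 := by
  by_contra! hq
  have hχ := hG.char_eq_zero P hq
  let : Fintype P := Fintype.ofFinite _
  have hP : Nat.card P = Fintype.card P := Nat.card_eq_fintype_card
  have hindex : ((P : Subgroup G).index : k) ≠ 0 := fun h =>
    P.not_dvd_index ((CharP.cast_eq_zero_iff k p _).1 h)
  obtain ⟨I, M, j, q, h, hM, -, hMfd⟩ := exists_heart k G ((CharP.cast_eq_zero_iff k p _).2
    (hp.trans (Nat.card_eq_fintype_card (α := G) ▸ (P : Subgroup G).card_subgroup_dvd_card)))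
  obtain ⟨I', K, j', q', h', -, hK, hKfd⟩ := exists_heart k P
    ((CharP.cast_eq_zero_iff k p _).2 (hP ▸ hp))
  obtain ⟨ι, r, hι, hr, hrι⟩ := h.exists_split hindex h'
  have hMfin : Module.Finite (MonoidAlgebra k G) M := finite_of_finiteDimensional
  have := finite_triv (k := k) (G := G)
  obtain ⟨⟨e⟩, htriv⟩ := exists_triv_equiv (k := k) (G := G)
  obtain ⟨Ω, hΩ, h0⟩ := exists_isSyzygyFamily (triv k G)
  have hzero := eq_zero_of_id_mem_factorSpan P.isPGroup' hΩ h0 (hG.id_mem_factorSpan hΩ hM)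
    (by rw [hK, hP]) hι hr hrι
  have hPK : ∀ (s : P) (y : K), s • y = y := fun s y => sub_eq_zero.1 <|
    hzero _ fun _ _ _ _ ξ hξ => by rw [map_sub, hξ, sub_self]
  obtain ⟨h2, hsq, hcard⟩ := h'.klein_of_trivial (hP ▸ hq) hPK
  have hst : StablyTriv k P (Ω 0) := by
    rw [h0]
    refine ⟨e.toLinearMap, e.symm 1, fun s x => ?_, fun s => htriv s _, by simp, ?_⟩
    · rw [show s • x = x from htriv s x]
    · have h1 : (LinearMap.id : triv k G →ₗ[k] triv k G) - e.toLinearMap.smulRight (e.symm 1) = 0 :=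
        LinearMap.ext fun x => e.injective (by simp)
      rw [h1]
      exact Rel.zero
  have hg0 : ∀ g : Ω 0 ⟶ M, g = 0 := by
    rw [h0]
    exact fun g => toLin_injective (LinearMap.ext fun x => h.eq_zero_of_fixed hχ _ fun s => by
      rw [← toLin_eqv g s x, htriv])
  have hK0 : ∀ v : K, v = 0 := fun v => hzero v fun i g hg hi => by
    rcases lt_trichotomy i 0 with hi0 | rfl | hi0
    · exact absurd hst (not_stablyTriv_of_klein h2 (hP.trans hcard) hsq hΩ.2.2 hi0 hi)
    · exact absurd (hg0 g) hg
    · exact absurd hi (not_stablyTriv_of_klein h2 (hP.trans hcard) hsq hΩ.2.2 hi0 hst)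
  have : Subsingleton K := subsingleton_of_forall_eq 0 hK0
  rw [Module.finrank_zero_of_subsingleton] at hK
  omega

end HeartRestriction

/-- **Main Theorem.** Let `G` be a finite group and `k` a field of
characteristic `p` dividing `|G|`. The generating hypothesis holds for `kG` if and only if
a Sylow `p`-subgroup of `G` is cyclic of order `2` or cyclic of order `3`. -/
theorem GH_iff_sylow_C2_or_C3
    (k G : Type) [Field k] [Group G] [Fintype G]
    (p : ℕ) [Fact p.Prime] [CharP k p] (hp : p ∣ Fintype.card G) :
    GHolds k G ↔
      ∃ P : Sylow p G, IsCyclic P ∧ (Nat.card P = 2 ∨ Nat.card P = 3) := by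
  refine ⟨fun hG => ?_, fun ⟨P, _, hP⟩ => gHolds_of_sylow P hP⟩
  obtain ⟨P⟩ : Nonempty (Sylow p G) := inferInstance
  have hpP : p ∣ Nat.card P := P.dvd_card_of_dvd_card (by rwa [Nat.card_eq_fintype_card])
  have hlt := hG.card_sylow_lt_four P hpP
  have h2 := (Fact.out : p.Prime).two_le.trans (Nat.le_of_dvd Nat.card_pos hpP)
  have h23 : Nat.card P = 2 ∨ Nat.card P = 3 := by omega
  refine ⟨P, ?_, h23⟩
  rcases h23 with h | h
  · have : Fact (Nat.Prime 2) := ⟨Nat.prime_two⟩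
    exact isCyclic_of_prime_card h
  · have : Fact (Nat.Prime 3) := ⟨Nat.prime_three⟩
    exact isCyclic_of_prime_card h

end StmodGH
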